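/- There exist an absolute constant C>0 and n₀ such that the following holds for all n ≥ n₀. Let (d_w)_{w∈W} be a sequence of nonnegative integers with even sum on a set W of n vertices; define β_w by d_w = (n−1)/2 + β_w√(n−1)/2, and suppose |β_w| ≤ log n for each w∈W and Σ_{w∈W} β_w² ≤ n(log n)^{1/9}. Then (d_w)_{w∈W} is a graphic sequence. Moreover, letting G be a uniformly random graph on W with degree sequence (d_w)_{w∈W}, for any fixed v∈W, any S⊆W with h:=|S| satisfying min(h, n−h) ≥ n/(log n)^{1/8}, and any integer t∈[0,d_v]: (i) if |t−h/2| > n^{3/5}, then P(deg_S(v)=t) ≤ exp(−(t−h/2)²/(Cn)); and (ii) if |t−h/2| ≤ n^{3/5}, then P(deg_S(v)=t) = (1+θ)·[C(h,t)·C(n−h−1, d_v−t)/C(n−1, d_v)]·exp(Λ₁ − Λ₂ − Λ₃ + Λ₄) for some θ with |θ| ≤ C n^{−1/10}, where Λ₁ = (1/(2n²))(Σ_{i∈W}β_i)(Σ_{i∈W}β_i − 2nβ_v), Λ₂ = Σ_{i∈S∖{v}}(1 − 2t/h)·β_i/√(n−1) + Σ_{i∈(W∖S)∖{v}}(1 −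 2(d_v−t)/(n−h))·β_i/√(n−1), Λ₃ = (1/2)Σ_{i∈W∖{v}} β_i²/(n−1), and Λ₄ = (1/(2nh))Σ_{{i,j}⊆S∖{v}}(β_i−β_j)² + (1/(2n(n−h)))Σ_{{i,j}⊆(W∖S)∖{v}}(β_i−β_j)², the sums in Λ₄ ranging over unordered two-element subsets. -/

import Mathlib

open Finset

open scoped Classical

/-- The number of neighbours of `v` (in the graph `G`) lying in the set `S`. -/
noncomputable def degIn {n : ℕ} (G : SimpleGraph (Fin n)) (S : Finset (Fin n)) (v : Fin n) : ℕ :=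
  (S.filter fun w => G.Adj v w).card

/-- The set of simple graphs on `Fin n` with degree sequence `d`. -/
noncomputable def degSeqGraphs (n : ℕ) (d : Fin n → ℕ) : Finset (SimpleGraph (Fin n)) :=
  univ.filter fun G => ∀ w, degIn G Finset.univ w = d w

/-- For a uniformly random graph with degree sequence `d`, the probability that the number of
neighbours of `v` in `S` equals `t`. -/
noncomputable def degProb (n : ℕ) (d : Fin n → ℕ) (S : Finset (Fin n)) (v : Fin n)
    (t : ℕ) : ℝ :=
  (((degSeqGraphs n d).filter fun G => degIn G S v = t).card : ℝ) /
    ((degSeqGraphs n d).card : ℝ)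

/-- `β_w`, defined by `d_w = (n-1)/2 + β_w √(n-1) / 2`. -/
noncomputable def beta (n : ℕ) (d : Fin n → ℕ) (w : Fin n) : ℝ :=
  (2 * (d w : ℝ) - ((n : ℝ) - 1)) / Real.sqrt ((n : ℝ) - 1)

noncomputable def Lam1 (n : ℕ) (d : Fin n → ℕ) (v : Fin n) : ℝ :=
  (1 / (2 * (n : ℝ) ^ 2)) * (∑ i, beta n d i) * ((∑ i, beta n d i) - 2 * (n : ℝ) * beta n d v)

noncomputable def Lam2 (n : ℕ) (d : Fin n → ℕ) (v : Fin n) (S : Finset (Fin n)) (t : ℕ) : ℝ :=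
  (∑ i ∈ S.erase v,
      (1 - 2 * (t : ℝ) / (S.card : ℝ)) * beta n d i / Real.sqrt ((n : ℝ) - 1)) +
    (∑ i ∈ Sᶜ.erase v,
      (1 - 2 * ((d v : ℝ) - (t : ℝ)) / ((n : ℝ) - (S.card : ℝ))) * beta n d i /
        Real.sqrt ((n : ℝ) - 1))

noncomputable def Lam3 (n : ℕ) (d : Fin n → ℕ) (v : Fin n) : ℝ :=
  (1 / 2) * ∑ i ∈ Finset.univ.erase v, (beta n d i) ^ 2 / ((n : ℝ) - 1)

/-- `Λ₄`; the sums over unordered two-element subsets are written as halves of the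
corresponding double sums (the diagonal terms vanish). -/
noncomputable def Lam4 (n : ℕ) (d : Fin n → ℕ) (v : Fin n) (S : Finset (Fin n)) : ℝ :=
  (1 / (4 * (n : ℝ) * (S.card : ℝ))) *
      (∑ i ∈ S.erase v, ∑ j ∈ S.erase v, (beta n d i - beta n d j) ^ 2) +
    (1 / (4 * (n : ℝ) * ((n : ℝ) - (S.card : ℝ)))) *
      (∑ i ∈ Sᶜ.erase v, ∑ j ∈ Sᶜ.erase v, (beta n d i - beta n d j) ^ 2)

/-- The integer-valued adjacency indicator of a graph. -/
noncomputable def adjInd {n : ℕ} (G : SimpleGraph (Fin n)) (a b : Fin n) : ℤ :=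
  if G.Adj a b then 1 else 0

lemma adjInd_comm {n : ℕ} (G : SimpleGraph (Fin n)) (a b : Fin n) :
    adjInd G a b = adjInd G b a := by
  simp [adjInd, G.adj_comm]

lemma adjInd_self {n : ℕ} (G : SimpleGraph (Fin n)) (a : Fin n) : adjInd G a a = 0 := by
  simp [adjInd]

lemma degIn_eq_sum_adjInd {n : ℕ} (G : SimpleGraph (Fin n)) (S : Finset (Fin n)) (w : Fin n) :
    (degIn G S w : ℤ) = ∑ u ∈ S, adjInd G w u := by
  unfold degIn adjInd
  rw [Finset.card_filter]
  push_cast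
  rfl

/-- The graph whose adjacency indicator is that of `G` plus a symmetrised rank-one term. -/
noncomputable def perturb {n : ℕ} (G : SimpleGraph (Fin n)) (ψ χ : Fin n → ℤ) :
    SimpleGraph (Fin n) where
  Adj a b := adjInd G a b + ψ a * χ b + χ a * ψ b = 1
  symm := ⟨fun a b h => by rw [adjInd_comm]; linarith⟩
  loopless := ⟨fun a h => by
    rw [adjInd_self, mul_comm (χ a)] at h
    omega⟩

lemma adjInd_perturb {n : ℕ} {G : SimpleGraph (Fin n)} {ψ χ : Fin n → ℤ}
    (h : ∀ a b, adjInd G a b + ψ a * χ b + χ a * ψ b = 0 ∨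
      adjInd G a b + ψ a * χ b + χ a * ψ b = 1) (a b : Fin n) :
    adjInd (perturb G ψ χ) a b = adjInd G a b + ψ a * χ b + χ a * ψ b := by
  rcases h a b with h | h
  · rw [h, adjInd, if_neg]
    change ¬ (_ = _)
    rw [h]; norm_num
  · rw [h, adjInd, if_pos]
    exact h

lemma degIn_perturb {n : ℕ} {G : SimpleGraph (Fin n)} {ψ χ : Fin n → ℤ}
    (h : ∀ a b, adjInd G a b + ψ a * χ b + χ a * ψ b = 0 ∨
      adjInd G a b + ψ a * χ b + χ a * ψ b = 1) (S : Finset (Fin n)) (w : Fin n) :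
    (degIn (perturb G ψ χ) S w : ℤ) =
      degIn G S w + ψ w * ∑ u ∈ S, χ u + χ w * ∑ u ∈ S, ψ u := by
  rw [degIn_eq_sum_adjInd, degIn_eq_sum_adjInd, Finset.mul_sum, Finset.mul_sum,
    ← Finset.sum_add_distrib, ← Finset.sum_add_distrib]
  exact Finset.sum_congr rfl fun u _ => adjInd_perturb h w u

lemma graph_ext_adjInd {n : ℕ} {G H : SimpleGraph (Fin n)}
    (h : ∀ a b, adjInd G a b = adjInd H a b) : G = H := by
  ext a b
  have := h a b
  unfold adjInd at this
  split_ifs at this <;> simp_all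

/-- The graphs supported on `W` whose degrees on `W` are given by `d`. -/
noncomputable def gset {n : ℕ} (W : Finset (Fin n)) (d : Fin n → ℤ) :
    Finset (SimpleGraph (Fin n)) :=
  univ.filter fun G => (∀ a b, G.Adj a b → a ∈ W) ∧ ∀ w ∈ W, (degIn G univ w : ℤ) = d w

lemma exists_top_subset {α : Type*} [DecidableEq α] (W : Finset α) (d : α → ℤ) (k : ℕ)
    (hk : k ≤ W.card) :
    ∃ H ⊆ W, H.card = k ∧ ∀ a ∈ H, ∀ b ∈ W \ H, d b ≤ d a := by
  induction k with
  | zero => exact ⟨∅, by simp, by simp, by simp⟩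
  | succ k ih =>
    obtain ⟨H, hHW, hc, hH⟩ := ih (by omega)
    have hne : (W \ H).Nonempty := by
      rw [← Finset.card_pos, Finset.card_sdiff_of_subset hHW]; omega
    obtain ⟨a, ha, hmax⟩ := Finset.exists_max_image (W \ H) d hne
    rw [Finset.mem_sdiff] at ha
    refine ⟨insert a H, Finset.insert_subset ha.1 hHW, by
      rw [Finset.card_insert_of_notMem ha.2, hc], ?_⟩
    intro a' ha' b hb
    have hb' : b ∈ W \ H := by
      simp only [Finset.mem_sdiff, Finset.mem_insert] at hb ⊢; tauto
    rcases Finset.mem_insert.1 ha' with rfl | ha'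
    · exact hmax b hb'
    · exact hH a' ha' b hb'

/-- If `a` has larger degree than `b`, one edge end can be moved from `a` to `b`. -/
lemma exists_transfer {n : ℕ} (G : SimpleGraph (Fin n)) (W : Finset (Fin n))
    (hG : ∀ a b, G.Adj a b → a ∈ W) (a b : Fin n) (hb : b ∈ W)
    (hab : degIn G univ b < degIn G univ a) :
    ∃ G' : SimpleGraph (Fin n), (∀ a b, G'.Adj a b → a ∈ W) ∧
      ∀ w, (degIn G' univ w : ℤ) =
        degIn G univ w + ((if w = b then 1 else 0) - (if w = a then 1 else 0)) := by
  have hne : a ≠ b := by rintro rfl; omega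
  obtain ⟨x, hxa, hxb, hx⟩ : ∃ x, G.Adj a x ∧ ¬ G.Adj b x ∧ x ≠ b := by
    by_contra! hcon
    have key : ∀ x, G.Adj a x → G.Adj b x ∨ x = b := fun x hx => by
      by_cases h : G.Adj b x
      · exact Or.inl h
      · exact Or.inr (hcon x hx h)
    unfold degIn at hab
    by_cases h : G.Adj a b
    · have hsub : (univ.filter fun w => G.Adj a w) ⊆
          insert b ((univ.filter fun w => G.Adj b w).erase a) := by
        intro x hx
        simp only [mem_filter, mem_univ, true_and, mem_insert, mem_erase] at hx ⊢
        rcases key x hx with h1 | h1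
        · exact Or.inr ⟨fun e => by subst e; exact G.irrefl hx, h1⟩
        · exact Or.inl h1
      have h1 := Finset.card_le_card hsub
      have h2 := Finset.card_insert_le b ((univ.filter fun w => G.Adj b w).erase a)
      have h3 : ((univ.filter fun w => G.Adj b w).erase a).card + 1 =
          (univ.filter fun w => G.Adj b w).card :=
        Finset.card_erase_add_one (by simpa using h.symm)
      omega
    · have hsub : (univ.filter fun w => G.Adj a w) ⊆ (univ.filter fun w => G.Adj b w) := by
        intro x hx
        simp only [mem_filter, mem_univ, true_and] at hx ⊢
        rcases key x hx with h1 | h1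
        · exact h1
        · subst h1; exact absurd hx h
      have h1 := Finset.card_le_card hsub
      omega
  have hxa' : x ≠ a := fun e => by subst e; exact G.irrefl hxa
  set ψ : Fin n → ℤ := fun w => if w = x then 1 else 0 with hψ
  set χ : Fin n → ℤ := fun w => (if w = b then 1 else 0) - (if w = a then 1 else 0) with hχ
  have hp : ∀ u w, adjInd G u w + ψ u * χ w + χ u * ψ w = 0 ∨
      adjInd G u w + ψ u * χ w + χ u * ψ w = 1 := by
    have e1 : adjInd G x a = 1 := by simp [adjInd, hxa.symm]
    have e2 : adjInd G a x = 1 := by simp [adjInd, hxa]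
    have e3 : adjInd G x b = 0 := by simp [adjInd, G.adj_comm x b, hxb]
    have e4 : adjInd G b x = 0 := by simp [adjInd, hxb]
    have e5 : ∀ u w, adjInd G u w = 0 ∨ adjInd G u w = 1 := fun u w => by
      unfold adjInd; split_ifs <;> simp
    intro u w
    simp only [hψ, hχ]
    by_cases hux : u = x <;> by_cases hwx : w = x <;> by_cases hua : u = a <;>
      by_cases hub : u = b <;> by_cases hwa : w = a <;> by_cases hwb : w = b <;>
      simp_all [adjInd_self]
  refine ⟨perturb G ψ χ, ?_, ?_⟩
  · intro u w huw
    have := adjInd_perturb hp u w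
    rw [adjInd, if_pos huw] at this
    by_cases h1 : G.Adj u w
    · exact hG u w h1
    · have h2 : u = x ∨ u = b ∨ u = a := by
        by_contra! h3
        simp [hψ, hχ, h3, adjInd, h1] at this
      rcases h2 with rfl | rfl | rfl
      · exact hG _ _ hxa.symm
      · exact hb
      · exact hG _ _ hxa
  · intro w
    rw [degIn_perturb hp]
    have h1 : ∑ u, χ u = 0 := by simp [hχ]
    have h2 : ∑ u, ψ u = 1 := by simp [hψ]
    rw [h1, h2]
    simp [hχ]

/-- Repeated transfers balance a graph whose degrees dominate `d` on `H` and are dominated by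
`d` on the rest of `W`. -/
lemma gset_nonempty_of_dominating {n : ℕ} (W H : Finset (Fin n)) (hHW : H ⊆ W) (d : Fin n → ℤ)
    (hd : ∀ a ∈ H, ∀ b ∈ W \ H, d b ≤ d a) (N : ℕ) :
    ∀ G : SimpleGraph (Fin n), (∀ a b, G.Adj a b → a ∈ W) →
      (∑ w ∈ W, (degIn G univ w : ℤ) = ∑ w ∈ W, d w) →
      (∀ a ∈ H, d a ≤ degIn G univ a) → (∀ b ∈ W \ H, (degIn G univ b : ℤ) ≤ d b) →
      (∑ a ∈ H, ((degIn G univ a : ℤ) - d a) ≤ N) → (gset W d).Nonempty := by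
  induction N with
  | zero =>
    intro G hG hsum h1 h2 hN
    have e1 : ∀ a ∈ H, (degIn G univ a : ℤ) - d a = 0 := by
      apply (Finset.sum_eq_zero_iff_of_nonneg fun a ha => by linarith [h1 a ha]).1
      apply le_antisymm (by simpa using hN)
      exact Finset.sum_nonneg fun a ha => by linarith [h1 a ha]
    have e3 : ∑ b ∈ W \ H, (d b - (degIn G univ b : ℤ)) = 0 := by
      have a1 := Finset.sum_sdiff hHW (f := fun w => (degIn G univ w : ℤ) - d w)
      rw [Finset.sum_eq_zero e1, add_zero, Finset.sum_sub_distrib (s := W), hsum, sub_self] at a1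
      rw [← neg_eq_zero, ← Finset.sum_neg_distrib, ← a1]
      exact Finset.sum_congr rfl fun _ _ => by ring
    have e2 : ∀ b ∈ W \ H, d b - (degIn G univ b : ℤ) = 0 :=
      (Finset.sum_eq_zero_iff_of_nonneg fun a ha => by linarith [h2 a ha]).1 e3
    refine ⟨G, ?_⟩
    simp only [gset, mem_filter, mem_univ, true_and]
    refine ⟨hG, fun w hw => ?_⟩
    by_cases hwH : w ∈ H
    · linarith [e1 w hwH]
    · linarith [e2 w (mem_sdiff.2 ⟨hw, hwH⟩)]
  | succ N ih =>
    intro G hG hsum h1 h2 hN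
    by_cases hcase : ∑ a ∈ H, ((degIn G univ a : ℤ) - d a) ≤ N
    · exact ih G hG hsum h1 h2 hcase
    have hpos : 0 < ∑ a ∈ H, ((degIn G univ a : ℤ) - d a) := by
      have : (0 : ℤ) ≤ N := by positivity
      omega
    obtain ⟨a, haH, ha⟩ := Finset.exists_lt_of_sum_lt
      (s := H) (f := fun _ => (0 : ℤ))
      (g := fun a => (degIn G univ a : ℤ) - d a) (by rw [Finset.sum_const_zero]; exact hpos)
    have hpos2 : 0 < ∑ b ∈ W \ H, (d b - (degIn G univ b : ℤ)) := by
      have a1 := Finset.sum_sdiff hHW (f := fun w => (degIn G univ w : ℤ) - d w)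
      rw [Finset.sum_sub_distrib (s := W), hsum, sub_self] at a1
      have a2 : ∑ b ∈ W \ H, (d b - (degIn G univ b : ℤ)) =
          - ∑ b ∈ W \ H, ((degIn G univ b : ℤ) - d b) := by
        rw [← Finset.sum_neg_distrib]
        exact Finset.sum_congr rfl fun _ _ => by ring
      omega
    obtain ⟨b, hbL, hb⟩ := Finset.exists_lt_of_sum_lt
      (s := W \ H) (f := fun _ => (0 : ℤ))
      (g := fun b => d b - (degIn G univ b : ℤ)) (by rw [Finset.sum_const_zero]; exact hpos2)
    have hbW := (mem_sdiff.1 hbL).1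
    have hbH := (mem_sdiff.1 hbL).2
    have hdab := hd a haH b hbL
    have hlt : degIn G univ b < degIn G univ a := by
      have : (degIn G univ b : ℤ) < degIn G univ a := by linarith
      exact_mod_cast this
    obtain ⟨G', hG', hdeg⟩ := exists_transfer G W hG a b hbW hlt
    apply ih G' hG'
    · rw [← hsum]
      simp only [hdeg]
      rw [Finset.sum_add_distrib, Finset.sum_sub_distrib]
      simp [hbW, hHW haH]
    · intro w hw
      rw [hdeg]
      have hwb : w ≠ b := fun e => hbH (e ▸ hw)
      by_cases hwa : w = a
      · subst hwa; simp [hwb]; omega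
      · simp [hwb, hwa]; exact h1 w hw
    · intro w hw
      rw [hdeg]
      have hwa : w ≠ a := fun e => (mem_sdiff.1 hw).2 (e ▸ haH)
      by_cases hwb : w = b
      · subst hwb; simp [hwa]; omega
      · simp [hwb, hwa]; exact h2 w hw
    · have : ∑ w ∈ H, ((degIn G' univ w : ℤ) - d w) =
          ∑ w ∈ H, ((degIn G univ w : ℤ) - d w) - 1 := by
        have : ∀ w ∈ H, (degIn G' univ w : ℤ) - d w =
            ((degIn G univ w : ℤ) - d w) - (if w = a then 1 else 0) := by
          intro w hw
          have hwb : w ≠ b := fun e => hbH (e ▸ hw)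
          rw [hdeg, if_neg hwb]; ring
        rw [Finset.sum_congr rfl this, Finset.sum_sub_distrib (s := H)]
        simp [haH]
      rw [this]
      push_cast at hN
      omega

/-- The graph consisting of a clique on `H` together with the pairs in `F`. -/
def cliqueUnion {n : ℕ} (H : Finset (Fin n)) (F : Finset (Fin n × Fin n)) :
    SimpleGraph (Fin n) where
  Adj a b := a ≠ b ∧ ((a ∈ H ∧ b ∈ H) ∨ (a, b) ∈ F ∨ (b, a) ∈ F)
  symm := ⟨fun a b h => ⟨h.1.symm, by tauto⟩⟩
  loopless := ⟨fun a h => h.1 rfl⟩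

lemma adjInd_cliqueUnion {n : ℕ} (H : Finset (Fin n)) (F : Finset (Fin n × Fin n))
    (hF : ∀ a b, (a, b) ∈ F → a ∈ H ∧ b ∉ H) (a b : Fin n) :
    adjInd (cliqueUnion H F) a b = (if a ∈ H ∧ b ∈ H.erase a then 1 else 0) +
      (if (a, b) ∈ F then 1 else 0) + (if (b, a) ∈ F then 1 else 0) := by
  have h1 := hF a b
  have h2 := hF b a
  have h0 : (cliqueUnion H F).Adj a b ↔
    a ≠ b ∧ ((a ∈ H ∧ b ∈ H) ∨ (a, b) ∈ F ∨ (b, a) ∈ F) := Iff.rfl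
  unfold adjInd
  simp only [h0, mem_erase]
  by_cases haF : (a, b) ∈ F
  · obtain ⟨ha, hb⟩ := h1 haF
    have hba : (b, a) ∉ F := fun h => hb (h2 h).1
    have hab : a ≠ b := fun h => hb (h ▸ ha)
    simp [haF, hba, ha, hb, hab]
  · by_cases hbF : (b, a) ∈ F
    · obtain ⟨hb, ha⟩ := h2 hbF
      have hab : a ≠ b := fun h => ha (h ▸ hb)
      simp [haF, hbF, ha, hb, hab]
    · by_cases hab : a = b
      · subst hab; simp [haF]
      · have hba : b ≠ a := fun h => hab h.symm
        simp [haF, hbF, hab, hba]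

set_option maxHeartbeats 1000000 in
lemma gset_nonempty_of_near_regular {n : ℕ} (W : Finset (Fin n)) (d : Fin n → ℤ)
    (hm : 100 ≤ W.card) (hd : ∀ w ∈ W, 9 * (W.card : ℤ) ≤ 20 * d w ∧ 20 * d w ≤ 11 * W.card)
    (heven : Even (∑ w ∈ W, d w)) : (gset W d).Nonempty := by
  obtain ⟨m, hmW⟩ : ∃ m, m = W.card := ⟨_, rfl⟩
  rw [← hmW] at hm hd
  obtain ⟨k, hk1, hk2⟩ : ∃ k : ℕ, 5 * k ≤ 2 * m ∧ 2 * m < 5 * k + 5 :=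
    ⟨2 * m / 5, by omega, by omega⟩
  obtain ⟨l, hl1, hl2⟩ : ∃ l : ℕ, m + 5 < 5 * l ∧ 5 * l ≤ m + 10 := ⟨m / 5 + 2, by omega, by omega⟩
  obtain ⟨H, hHW, hHc, hH⟩ := exists_top_subset W d k (by omega)
  have hLc : (W \ H).card = m - k := by rw [card_sdiff_of_subset hHW, hHc, hmW]
  obtain ⟨L, hLW, hLcard⟩ := Finset.exists_subset_card_eq (s := W \ H) (n := l) (by omega)
  obtain ⟨E, hE⟩ := heven
  have hEl : 9 * (m : ℤ) * m ≤ 40 * E := by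
    have : ∑ w ∈ W, (9 * (m : ℤ)) ≤ ∑ w ∈ W, 20 * d w := Finset.sum_le_sum fun w hw => (hd w hw).1
    rw [Finset.sum_const, ← hmW, ← Finset.mul_sum, hE] at this
    simp at this
    linarith
  have hEu : 40 * E ≤ 11 * (m : ℤ) * m := by
    have : ∑ w ∈ W, 20 * d w ≤ ∑ w ∈ W, (11 * (m : ℤ)) := Finset.sum_le_sum fun w hw => (hd w hw).2
    rw [Finset.sum_const, ← hmW, ← Finset.mul_sum, hE] at this
    simp at this
    linarith
  obtain ⟨c, hc⟩ : ∃ c : ℕ, 2 * c = k * (k - 1) :=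
    ⟨k * (k - 1) / 2, Nat.two_mul_div_two_of_even (Nat.even_mul_pred_self k)⟩
  have hcz : 2 * (c : ℤ) = k * (k - 1) := by
    have h1 : 1 ≤ k := by omega
    have := congrArg (Nat.cast : ℕ → ℤ) hc
    push_cast [Nat.cast_sub h1] at this
    exact this
  have z1 : 5 * (k : ℤ) ≤ 2 * m := by exact_mod_cast hk1
  have z2 : 2 * (m : ℤ) < 5 * k + 5 := by exact_mod_cast hk2
  have z3 : (m : ℤ) + 5 < 5 * l := by exact_mod_cast hl1
  have z4 : 5 * (l : ℤ) ≤ m + 10 := by exact_mod_cast hl2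
  have z5 : (100 : ℤ) ≤ m := by exact_mod_cast hm
  have hf1 : (c : ℤ) + k * l ≤ E := by nlinarith
  have hf2 : E ≤ (c : ℤ) + k * (m - k) := by nlinarith
  obtain ⟨f, hf⟩ : ∃ f : ℕ, (f : ℤ) = E - c := ⟨(E - c).toNat, by
    rw [Int.toNat_of_nonneg]; nlinarith⟩
  obtain ⟨F, hF1, hF2, hFc⟩ := Finset.exists_subsuperset_card_eq (s := H ×ˢ L)
    (t := H ×ˢ (W \ H)) (n := f) (Finset.product_subset_product_right hLW)
    (by rw [card_product, hHc, hLcard]; zify; linarith)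
    (by rw [card_product, hHc, hLc]; zify [show k ≤ m by omega]; linarith)
  have hFmem : ∀ a b, (a, b) ∈ F → a ∈ H ∧ b ∈ W ∧ b ∉ H := fun a b h => by
    have := hF2 h
    simp only [mem_product, mem_sdiff] at this
    exact this
  obtain ⟨G, hGdef⟩ : ∃ G, G = cliqueUnion H F := ⟨_, rfl⟩
  have hG : ∀ a b, adjInd G a b = (if a ∈ H ∧ b ∈ H.erase a then 1 else 0) +
      (if (a, b) ∈ F then 1 else 0) + (if (b, a) ∈ F then 1 else 0) := by
    rw [hGdef]
    exact adjInd_cliqueUnion H F fun a b h => ⟨(hFmem a b h).1, (hFmem a b h).2.2⟩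
  have hdeg : ∀ a, (degIn G univ a : ℤ) = (if a ∈ H then (k : ℤ) - 1 else 0) +
      (∑ b, if (a, b) ∈ F then 1 else 0) + ∑ b, if (b, a) ∈ F then 1 else 0 := by
    intro a
    rw [degIn_eq_sum_adjInd]
    simp only [hG]
    rw [Finset.sum_add_distrib, Finset.sum_add_distrib]
    congr 2
    by_cases ha : a ∈ H
    · have : ((H.erase a).card : ℤ) = k - 1 := by
        rw [Finset.cast_card_erase_of_mem ha, hHc]
      simp only [ha, true_and, if_true]
      rw [← this, Finset.sum_boole, Finset.filter_mem_eq_inter, Finset.univ_inter]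
    · simp [ha]
  have hdegH : ∀ a ∈ H, (k : ℤ) - 1 + l ≤ degIn G univ a := by
    intro a ha
    rw [hdeg, if_pos ha]
    have e1 : (l : ℤ) ≤ ∑ b, if (a, b) ∈ F then 1 else 0 := by
      rw [Finset.sum_boole, ← hLcard]
      norm_cast
      apply Finset.card_le_card
      intro b hb
      simpa using hF1 (mem_product.2 ⟨ha, hb⟩)
    have e2 : (0 : ℤ) ≤ ∑ b, if (b, a) ∈ F then 1 else 0 :=
      Finset.sum_nonneg fun _ _ => by split_ifs <;> simp
    linarith
  have hdegL : ∀ b ∈ W \ H, (degIn G univ b : ℤ) ≤ k := by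
    intro b hb
    rw [hdeg, if_neg (mem_sdiff.1 hb).2]
    have e1 : (∑ x, if (x, b) ∈ F then (1 : ℤ) else 0) ≤ k := by
      rw [Finset.sum_boole, ← hHc]
      norm_cast
      apply Finset.card_le_card
      intro x hx
      exact (hFmem x b (by simpa using hx)).1
    have e2 : (∑ x, if (b, x) ∈ F then (1 : ℤ) else 0) = 0 :=
      Finset.sum_eq_zero fun x _ => if_neg fun h => (mem_sdiff.1 hb).2 (hFmem b x h).1
    linarith
  have hFsum : ∑ a, ∑ b, (if (a, b) ∈ F then (1 : ℤ) else 0) = f := by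
    rw [← Fintype.sum_prod_type' (f := fun a b => if (a, b) ∈ F then (1 : ℤ) else 0)]
    rw [← hFc]
    simp
  have hsupp : ∀ a b, G.Adj a b → a ∈ W := by
    intro a b h
    rw [hGdef] at h
    rcases h.2 with h | h | h
    · exact hHW h.1
    · exact hHW (hFmem _ _ h).1
    · exact (hFmem _ _ h).2.1
  have hsumW : ∑ w ∈ W, (degIn G univ w : ℤ) = ∑ w, (degIn G univ w : ℤ) := by
    apply Finset.sum_subset (Finset.subset_univ W)
    intro w _ hw
    rw [degIn_eq_sum_adjInd]
    exact Finset.sum_eq_zero fun b _ => if_neg fun h => hw (hsupp w b h)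
  obtain ⟨N, hN⟩ : ∃ N : ℕ, ∑ a ∈ H, ((degIn G univ a : ℤ) - d a) ≤ N :=
    ⟨_, Int.self_le_toNat _⟩
  refine gset_nonempty_of_dominating W H hHW d hH N G hsupp ?_ ?_ ?_ hN
  · rw [hsumW]
    simp only [hdeg]
    rw [Finset.sum_add_distrib, Finset.sum_add_distrib, hFsum, Finset.sum_comm (f := fun a b =>
      if (b, a) ∈ F then (1 : ℤ) else 0), hFsum, hE, hf]
    have : (∑ x, if x ∈ H then (k : ℤ) - 1 else 0) = 2 * c := by
      rw [hcz, ← Finset.sum_filter, Finset.filter_mem_eq_inter, Finset.univ_inter,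
        Finset.sum_const, hHc]
      simp
    linarith
  · intro a ha
    have h1 := hdegH a ha
    have h2 := (hd a (hHW ha)).2
    omega
  · intro b hb
    have h1 := hdegL b hb
    have h2 := (hd b (mem_sdiff.1 hb).1).1
    omega

/-- Adding a vertex `v` with neighbourhood `T` to a graph. -/
def addStar {n : ℕ} (H : SimpleGraph (Fin n)) (v : Fin n) (T : Finset (Fin n)) (hv : v ∉ T) :
    SimpleGraph (Fin n) where
  Adj a b := H.Adj a b ∨ (a = v ∧ b ∈ T) ∨ (b = v ∧ a ∈ T)
  symm := ⟨fun a b h => by rw [H.adj_comm]; tauto⟩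
  loopless := ⟨fun a h => by
    rcases h with h | ⟨rfl, h⟩ | ⟨rfl, h⟩
    · exact H.irrefl h
    · exact hv h
    · exact hv h⟩

lemma card_gset_erase_le {n : ℕ} (W : Finset (Fin n)) (d : Fin n → ℤ) (v : Fin n) (hv : v ∈ W)
    (T : Finset (Fin n)) (hT : T ⊆ W.erase v) (hTc : (T.card : ℤ) = d v) :
    (gset (W.erase v) fun w => d w - if w ∈ T then 1 else 0).card ≤
      ((gset W d).filter fun G => univ.filter (fun w => G.Adj v w) = T).card := by
  have hvT : v ∉ T := fun h => by simpa using hT h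
  apply Finset.card_le_card_of_injOn (fun H => addStar H v T hvT)
  · intro H hH
    simp only [gset, coe_filter, mem_univ, true_and, Set.mem_ofPred_eq] at hH
    obtain ⟨h1, h2⟩ := hH
    have hn1 : ∀ b, ¬ H.Adj v b := fun b h => by simpa using h1 v b h
    have hn2 : ∀ b, ¬ H.Adj b v := fun b h => hn1 b h.symm
    have hnb : (univ.filter fun w => (addStar H v T hvT).Adj v w) = T := by
      ext w
      simp only [addStar, mem_filter, mem_univ, true_and]
      have := hn1 w
      have : w = v → v ∉ T := fun _ => hvT
      tauto
    simp only [gset, coe_filter, mem_filter, mem_univ, true_and, Set.mem_ofPred_eq]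
    refine ⟨⟨?_, ?_⟩, hnb⟩
    · rintro a b (h | ⟨rfl, h⟩ | ⟨rfl, h⟩)
      · exact Finset.mem_of_mem_erase (h1 a b h)
      · exact hv
      · exact Finset.mem_of_mem_erase (hT h)
    · intro w hw
      by_cases hwv : w = v
      · subst hwv
        rw [← hTc, degIn, hnb]
      · have h3 := h2 w (Finset.mem_erase.2 ⟨hwv, hw⟩)
        rw [degIn_eq_sum_adjInd] at h3 ⊢
        have : ∀ u, adjInd (addStar H v T hvT) w u =
            adjInd H w u + if u = v then (if w ∈ T then 1 else 0) else 0 := by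
          intro u
          unfold adjInd
          have h0 : (addStar H v T hvT).Adj w u ↔
            H.Adj w u ∨ (w = v ∧ u ∈ T) ∨ (u = v ∧ w ∈ T) := Iff.rfl
          rw [h0]
          have := hn2 w
          by_cases huv : u = v
          · subst huv; simp [this, hwv]
          · simp [huv, hwv]
        simp only [this]
        rw [Finset.sum_add_distrib, h3]
        simp
  · intro H hH H' hH' heq
    simp only [gset, coe_filter, mem_univ, true_and, Set.mem_ofPred_eq] at hH hH'
    ext a b
    have key := congrArg (fun G : SimpleGraph (Fin n) => G.Adj a b) heq
    simp only [addStar, eq_iff_iff] at key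
    have hn : ∀ K : SimpleGraph (Fin n), (∀ a b, K.Adj a b → a ∈ W.erase v) →
        K.Adj a b → a ≠ v ∧ b ≠ v := fun K hK h => by
      have h1 := hK a b h
      have h2 := hK b a h.symm
      simp only [mem_erase] at h1 h2
      exact ⟨h1.1, h2.1⟩
    have k1 := hn H hH.1
    have k2 := hn H' hH'.1
    tauto

lemma choose_mul_pow_le_mode (M k j : ℕ) (hk : k ≤ M) (hj : j ≤ M) :
    (M.choose j : ℝ) * ((k : ℝ) ^ j * ((M : ℝ) - k) ^ (M - j)) ≤
      (M.choose k : ℝ) * ((k : ℝ) ^ k * ((M : ℝ) - k) ^ (M - k)) := by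
  set f : ℕ → ℝ := fun j => (M.choose j : ℝ) * ((k : ℝ) ^ j * ((M : ℝ) - k) ^ (M - j)) with hf
  have hkM : (k : ℝ) ≤ M := by exact_mod_cast hk
  have hq : 0 ≤ (M : ℝ) - k := by linarith
  have hf0 : ∀ j, 0 ≤ f j := fun j => by positivity
  have hrec : ∀ j < M, f (j + 1) * ((j + 1) * ((M : ℝ) - k)) = f j * (((M : ℝ) - j) * k) := by
    intro j hjM
    have h1 := Nat.choose_succ_right_eq M j
    have h2 : (M.choose (j + 1) : ℝ) * (j + 1) = M.choose j * ((M : ℝ) - j) := by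
      rw [← Nat.cast_sub hjM.le]; exact_mod_cast h1
    have h3 : M - j = M - (j + 1) + 1 := by omega
    simp only [hf]
    rw [h3, pow_succ, pow_succ]
    linear_combination (k : ℝ) ^ j * k * ((M : ℝ) - k) ^ (M - (j + 1)) * ((M : ℝ) - k) * h2
  have hup : ∀ j, j < k → f j ≤ f (j + 1) := by
    intro j hjk
    have hjM : j < M := by omega
    have e1 : (j : ℝ) + 1 ≤ k := by exact_mod_cast hjk
    have e2 : ((j : ℝ) + 1) * ((M : ℝ) - k) ≤ ((M : ℝ) - j) * k := by nlinarith
    have e3 : 0 < ((M : ℝ) - j) * k := by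
      have : (j : ℝ) < M := by exact_mod_cast hjM
      have : (0 : ℝ) ≤ j := by positivity
      apply mul_pos <;> linarith
    have := hrec j hjM
    nlinarith [hf0 j, hf0 (j + 1), mul_le_mul_of_nonneg_left e2 (hf0 (j + 1))]
  have hdown : ∀ j, k ≤ j → j < M → f (j + 1) ≤ f j := by
    intro j hjk hjM
    have e0 : (k : ℝ) ≤ j := by exact_mod_cast hjk
    have e4 : (j : ℝ) < M := by exact_mod_cast hjM
    have e2 : ((M : ℝ) - j) * k ≤ ((j : ℝ) + 1) * ((M : ℝ) - k) := by nlinarith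
    have e3 : 0 < ((j : ℝ) + 1) * ((M : ℝ) - k) := by
      have : (0 : ℝ) ≤ j := by positivity
      apply mul_pos <;> linarith
    have := hrec j hjM
    nlinarith [hf0 j, hf0 (j + 1), mul_le_mul_of_nonneg_left e2 (hf0 j)]
  change f j ≤ f k
  rcases le_total j k with h | h
  · induction h using Nat.decreasingInduction with
    | self => exact le_rfl
    | of_succ i hi ih => exact (hup i hi).trans (ih (by omega))
  · induction j, h using Nat.le_induction with
    | base => exact le_rfl
    | succ i hi ih => exact (hdown i hi (by omega)).trans (ih (by omega))

lemma choose_ge_two_pow (M k : ℕ) (hM : 0 < M) (hk : k ≤ M) :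
    (2 : ℝ) ^ M * Real.exp (-((2 * k - M : ℝ) ^ 2 / M)) ≤ (M + 1) * (M.choose k : ℝ) := by
  have hM' : (0 : ℝ) < M := by exact_mod_cast hM
  have hkM : (k : ℝ) ≤ M := by exact_mod_cast hk
  have hq : 0 ≤ (M : ℝ) - k := by linarith
  have h1 : (M : ℝ) ^ M ≤ (M + 1) * ((M.choose k : ℝ) *
      ((k : ℝ) ^ k * ((M : ℝ) - k) ^ (M - k))) := by
    have h := add_pow (k : ℝ) ((M : ℝ) - k) M
    rw [add_sub_cancel] at h
    rw [h]
    calc _ ≤ ∑ j ∈ range (M + 1), (M.choose k : ℝ) * ((k : ℝ) ^ k * ((M : ℝ) - k) ^ (M - k)) := by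
          apply Finset.sum_le_sum
          intro j hj
          rw [mul_comm]
          exact choose_mul_pow_le_mode M k j hk (by simpa [Nat.lt_succ_iff] using hj)
      _ = _ := by simp
  have h2 : ((2 * k / M : ℝ)) ^ k * (2 * ((M : ℝ) - k) / M) ^ (M - k) ≤
      Real.exp ((2 * k - M : ℝ) ^ 2 / M) := by
    have a1 : (2 * k / M : ℝ) ^ k ≤ Real.exp (2 * k / M - 1) ^ k := by
      apply pow_le_pow_left₀ (by positivity)
      linarith [Real.add_one_le_exp (2 * k / M - 1 : ℝ)]
    have a2 : (2 * ((M : ℝ) - k) / M) ^ (M - k) ≤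
        Real.exp (2 * ((M : ℝ) - k) / M - 1) ^ (M - k) := by
      apply pow_le_pow_left₀ (by positivity)
      linarith [Real.add_one_le_exp (2 * ((M : ℝ) - k) / M - 1 : ℝ)]
    refine (mul_le_mul a1 a2 (by positivity) (by positivity)).trans (le_of_eq ?_)
    rw [← Real.exp_nat_mul, ← Real.exp_nat_mul, ← Real.exp_add, Nat.cast_sub hk]
    congr 1
    field_simp
    ring
  have h3 : ((2 * k / M : ℝ)) ^ k * (2 * ((M : ℝ) - k) / M) ^ (M - k) =
      2 ^ M * ((k : ℝ) ^ k * ((M : ℝ) - k) ^ (M - k)) / M ^ M := by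
    have : M = k + (M - k) := by omega
    conv_rhs => rw [show (2 : ℝ) ^ M = 2 ^ k * 2 ^ (M - k) by rw [← pow_add, ← this],
      show (M : ℝ) ^ M = (M : ℝ) ^ k * (M : ℝ) ^ (M - k) by rw [← pow_add, ← this]]
    rw [div_pow, div_pow, mul_pow, mul_pow]
    field_simp
  rw [h3, div_le_iff₀ (by positivity)] at h2
  rw [Real.exp_neg, ← div_eq_mul_inv, div_le_iff₀ (Real.exp_pos _)]
  have hMM : (0 : ℝ) < (M : ℝ) ^ M := by positivity
  have h4 := mul_le_mul_of_nonneg_left h1 (show (0 : ℝ) ≤ 2 ^ M by positivity)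
  have h5 := mul_le_mul_of_nonneg_left h2 (show (0 : ℝ) ≤ (M + 1) * (M.choose k : ℝ) by positivity)
  refine le_of_mul_le_mul_right ?_ hMM
  calc _ ≤ _ := h4
    _ = (M + 1) * (M.choose k : ℝ) * (2 ^ M * ((k : ℝ) ^ k * ((M : ℝ) - k) ^ (M - k))) := by ring
    _ ≤ _ := h5
    _ = _ := by ring

lemma sum_powersetCard_ite {α : Type*} [DecidableEq α] (s : Finset α) (k : ℕ) (w : α) (hw : w ∈ s)
    (a b : ℝ) :
    (s.card : ℝ) * ∑ T ∈ s.powersetCard k, (if w ∈ T then a else b) =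
      (s.card.choose k : ℝ) * (k * a + ((s.card : ℝ) - k) * b) := by
  have h1 : ∑ T ∈ s.powersetCard k, (if w ∈ T then a else b) =
      ((s.powersetCard k).filter fun T => w ∈ T).card * a +
        ((s.card.choose k : ℝ) - ((s.powersetCard k).filter fun T => w ∈ T).card) * b := by
    rw [Finset.sum_ite, Finset.sum_const, Finset.sum_const, nsmul_eq_mul, nsmul_eq_mul]
    congr 2
    have := Finset.card_filter_add_card_filter_not (s := s.powersetCard k) (fun T => w ∈ T)
    rw [Finset.card_powersetCard] at this
    rw [← this]
    push_cast
    ring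
  have h2 : (s.card : ℝ) * ((s.powersetCard k).filter fun T => w ∈ T).card =
      (s.card.choose k : ℝ) * k := by
    rcases Nat.eq_zero_or_pos k with rfl | hk
    · simp
    have h3 := Finset.card_filter_powersetCard_subset {w} s k (by simpa using hw) (by simp; omega)
    simp only [Finset.singleton_subset_iff, Finset.card_singleton] at h3
    have hs : 0 < s.card := Finset.card_pos.2 ⟨w, hw⟩
    rw [h3]
    obtain ⟨m, hm⟩ := Nat.exists_eq_add_of_lt hs
    obtain ⟨l, hl⟩ := Nat.exists_eq_add_of_lt hk
    rw [hm, hl]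
    simp only [zero_add, Nat.add_sub_cancel]
    exact_mod_cast Nat.add_one_mul_choose_eq m l
  rw [h1]
  linear_combination (a - b) * h2

/-- The exponential potential measuring how far the degrees `d` on `W` are from `(|W| - 1) / 2`. -/
noncomputable def degPotential {n : ℕ} (κ : ℝ) (W : Finset (Fin n)) (d : Fin n → ℤ) : ℝ :=
  ∑ w ∈ W, Real.cosh (κ * (d w - ((W.card : ℝ) - 1) / 2))

lemma exists_pivot {n : ℕ} (κ : ℝ) (hκ : 0 < κ) (W : Finset (Fin n)) (hW : W.Nonempty)
    (δ : Fin n → ℝ) : ∃ v ∈ W, 0 ≤ δ v * ∑ w ∈ W, Real.sinh (κ * δ w) := by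
  rcases lt_trichotomy (∑ w ∈ W, Real.sinh (κ * δ w)) 0 with h | h | h
  · obtain ⟨v, hv, hlt⟩ := Finset.exists_lt_of_sum_lt (s := W) (f := fun w => Real.sinh (κ * δ w))
      (g := fun _ => (0 : ℝ)) (by simpa using h)
    refine ⟨v, hv, ?_⟩
    rw [Real.sinh_neg_iff] at hlt
    exact mul_nonneg_of_nonpos_of_nonpos (by nlinarith) h.le
  · obtain ⟨v, hv⟩ := hW
    exact ⟨v, hv, by simp [h]⟩
  · obtain ⟨v, hv, hlt⟩ := Finset.exists_lt_of_sum_lt (s := W) (g := fun w => Real.sinh (κ * δ w))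
      (f := fun _ => (0 : ℝ)) (by simpa using h)
    refine ⟨v, hv, ?_⟩
    rw [Real.sinh_pos_iff] at hlt
    exact mul_nonneg (by nlinarith) h.le

lemma sum_degPotential_erase_le {n : ℕ} (κ : ℝ) (hκ : 0 < κ) (W : Finset (Fin n)) (d : Fin n → ℤ)
    (v : Fin n) (hv : v ∈ W) (k : ℕ) (hk : (k : ℤ) = d v) (hkM : k ≤ (W.erase v).card)
    (hpiv : 0 ≤ (d v - ((W.card : ℝ) - 1) / 2) *
      ∑ w ∈ W, Real.sinh (κ * (d w - ((W.card : ℝ) - 1) / 2))) :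
    ∑ T ∈ (W.erase v).powersetCard k,
      degPotential κ (W.erase v) (fun w => d w - if w ∈ T then 1 else 0) ≤
      ((W.erase v).card.choose k : ℝ) * (Real.cosh (κ / 2) * degPotential κ W d) := by
  obtain ⟨M, hM⟩ : ∃ M, M = (W.erase v).card := ⟨_, rfl⟩
  have hWc : (W.card : ℝ) = M + 1 := by
    have := Finset.card_erase_add_one hv
    rw [← hM] at this; exact_mod_cast this.symm
  rw [hWc, add_sub_cancel_right] at hpiv
  set δ : Fin n → ℝ := fun w => (d w : ℝ) - M / 2 with hδ
  have hdv : (d v : ℝ) = k := by exact_mod_cast hk.symm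
  have hδv : δ v = k - M / 2 := by simp only [hδ]; rw [hdv]
  rcases Nat.eq_zero_or_pos M with h0 | hMpos
  · have hE : W.erase v = ∅ := by rw [← Finset.card_eq_zero, ← hM, h0]
    rw [hE]
    have : 0 ≤ degPotential κ W d := Finset.sum_nonneg fun w _ => (Real.cosh_pos _).le
    simp only [degPotential, Finset.sum_empty, Finset.sum_const_zero]
    have := Real.cosh_pos (κ / 2)
    positivity
  have hM0 : (0 : ℝ) < M := by exact_mod_cast hMpos
  unfold degPotential
  rw [Finset.sum_comm, hWc, add_sub_cancel_right]
  change _ ≤ _ * (_ * ∑ w ∈ W, Real.cosh (κ * δ w))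
  change 0 ≤ δ v * ∑ w ∈ W, Real.sinh (κ * δ w) at hpiv
  rw [← hM] at hkM ⊢
  have hterm : ∀ w ∈ W.erase v, ∑ T ∈ (W.erase v).powersetCard k,
      Real.cosh (κ * (((d w - if w ∈ T then 1 else 0 : ℤ) : ℝ) - ((M : ℝ) - 1) / 2)) =
      (M.choose k : ℝ) * (Real.cosh (κ / 2) * Real.cosh (κ * δ w)
        - 2 * δ v / M * Real.sinh (κ / 2) * Real.sinh (κ * δ w)) := by
    intro w hw
    have h1 : ∀ T : Finset (Fin n), Real.cosh
        (κ * (((d w - if w ∈ T then 1 else 0 : ℤ) : ℝ) - ((M : ℝ) - 1) / 2)) =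
        if w ∈ T then Real.cosh (κ * δ w - κ / 2) else Real.cosh (κ * δ w + κ / 2) := by
      intro T
      split_ifs
      · congr 1; simp only [hδ]; push_cast; ring
      · congr 1; simp only [hδ]; push_cast; ring
    simp only [h1]
    have h2 := sum_powersetCard_ite (W.erase v) k w hw (Real.cosh (κ * δ w - κ / 2))
      (Real.cosh (κ * δ w + κ / 2))
    rw [← hM] at h2
    refine mul_left_cancel₀ hM0.ne' (h2.trans ?_)
    rw [Real.cosh_sub, Real.cosh_add, hδv]
    field_simp
    ring
  rw [Finset.sum_congr rfl hterm, ← Finset.mul_sum]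
  apply mul_le_mul_of_nonneg_left _ (by positivity)
  rw [Finset.sum_sub_distrib, ← Finset.mul_sum, ← Finset.mul_sum]
  have e1 := Finset.add_sum_erase W (fun w => Real.cosh (κ * δ w)) hv
  have e2 := Finset.add_sum_erase W (fun w => Real.sinh (κ * δ w)) hv
  rw [← e1]
  have e3 : ∑ w ∈ W.erase v, Real.sinh (κ * δ w) =
    ∑ w ∈ W, Real.sinh (κ * δ w) - Real.sinh (κ * δ v) := by rw [← e2]; ring
  rw [e3]
  have hs : 0 < Real.sinh (κ / 2) := Real.sinh_pos_iff.2 (by linarith)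
  have hc : Real.sinh (κ / 2) ≤ Real.cosh (κ / 2) := (Real.sinh_lt_cosh _).le
  have hkM' : (k : ℝ) ≤ M := by exact_mod_cast hkM
  have hr1 : -1 ≤ 2 * δ v / M := by
    rw [le_div_iff₀ hM0, hδv]
    have : (0 : ℝ) ≤ k := by positivity
    linarith
  have hr2 : 2 * δ v / M ≤ 1 := by
    rw [div_le_iff₀ hM0, hδv]; linarith
  have hself : 2 * δ v / M * Real.sinh (κ * δ v) ≤ Real.cosh (κ * δ v) := by
    have a1 := (Real.sinh_lt_cosh (κ * δ v)).le
    have a2 : -Real.cosh (κ * δ v) ≤ Real.sinh (κ * δ v) := by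
      have := (Real.sinh_lt_cosh (-(κ * δ v))).le
      rw [Real.sinh_neg, Real.cosh_neg] at this; linarith
    have := abs_le.2 ⟨a2, a1⟩
    have h4 := abs_le.2 ⟨hr1, hr2⟩
    calc _ ≤ |2 * δ v / M * Real.sinh (κ * δ v)| := le_abs_self _
      _ = |2 * δ v / M| * |Real.sinh (κ * δ v)| := abs_mul _ _
      _ ≤ 1 * Real.cosh (κ * δ v) := by gcongr
      _ = _ := one_mul _
  have hP : 0 ≤ 2 * δ v / M * Real.sinh (κ / 2) * ∑ w ∈ W, Real.sinh (κ * δ w) := by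
    have : 2 * δ v / M * Real.sinh (κ / 2) * ∑ w ∈ W, Real.sinh (κ * δ w) =
      2 / M * Real.sinh (κ / 2) * (δ v * ∑ w ∈ W, Real.sinh (κ * δ w)) := by ring
    rw [this]; positivity
  have hcc := Real.cosh_pos (κ * δ v)
  nlinarith [mul_le_mul_of_nonneg_left hself hs.le, mul_le_mul_of_nonneg_right hc hcc.le]

lemma card_filter_ge_of_sum_le {ι : Type*} (s : Finset ι) (f : ι → ℝ) (A : ℝ) (n : ℕ) (hn : 0 < n)
    (hA : 0 < A) (hf : ∀ i ∈ s, 0 ≤ f i) (hsum : ∑ i ∈ s, f i ≤ s.card * A) :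
    (s.card : ℝ) ≤ (n + 1) * (s.filter fun i => f i ≤ (1 + 1 / n) * A).card := by
  have hn' : (0 : ℝ) < n := by exact_mod_cast hn
  have h1 := Finset.card_filter_add_card_filter_not (s := s) (fun i => f i ≤ (1 + 1 / n) * A)
  have h2 : ((s.filter fun i => ¬ f i ≤ (1 + 1 / n) * A).card : ℝ) * ((1 + 1 / n) * A) ≤
      ∑ i ∈ s, f i := by
    rw [← nsmul_eq_mul]
    refine (Finset.card_nsmul_le_sum _ f _ ?_).trans
      (Finset.sum_le_sum_of_subset_of_nonneg (Finset.filter_subset _ _) fun i hi _ => hf i hi)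
    intro i hi
    exact (not_le.1 (Finset.mem_filter.1 hi).2).le
  have h3 : ((s.filter fun i => ¬ f i ≤ (1 + 1 / n) * A).card : ℝ) * (1 + 1 / n) ≤ s.card := by
    refine le_of_mul_le_mul_right ?_ hA
    linarith
  have h4 : (s.card : ℝ) = (s.filter fun i => f i ≤ (1 + 1 / n) * A).card +
      (s.filter fun i => ¬ f i ≤ (1 + 1 / n) * A).card := by exact_mod_cast h1.symm
  have h5 : ((s.filter fun i => ¬ f i ≤ (1 + 1 / n) * A).card : ℝ) * (n + 1) ≤ s.card * n := by
    have := mul_le_mul_of_nonneg_right h3 hn'.le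
    have e : (1 + 1 / (n : ℝ)) * n = n + 1 := by field_simp
    rwa [mul_assoc, e] at this
  nlinarith

lemma abs_le_of_degPotential_le {n : ℕ} {κ D : ℝ} (hκ : 0 < κ) {W : Finset (Fin n)}
    {d : Fin n → ℤ} (h : degPotential κ W d ≤ Real.exp (κ * D) / 2) :
    ∀ w ∈ W, |(d w : ℝ) - ((W.card : ℝ) - 1) / 2| ≤ D := by
  intro w hw
  have h1 : Real.cosh (κ * (d w - ((W.card : ℝ) - 1) / 2)) ≤ Real.exp (κ * D) / 2 :=
    le_trans (Finset.single_le_sum (f := fun w => Real.cosh (κ * (d w - ((W.card : ℝ) - 1) / 2)))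
      (fun i _ => (Real.cosh_pos _).le) hw) h
  rw [← Real.cosh_abs, abs_mul, abs_of_pos hκ, Real.cosh_eq] at h1
  have h2 := Real.exp_pos (-(κ * |(d w : ℝ) - ((W.card : ℝ) - 1) / 2|))
  have h3 : Real.exp (κ * |(d w : ℝ) - ((W.card : ℝ) - 1) / 2|) ≤ Real.exp (κ * D) := by linarith
  exact le_of_mul_le_mul_left (Real.exp_le_exp.1 h3) hκ

/-- Peeling off one vertex multiplies the number of realisations by at least
`2 ^ (|W| - 1)` up to small factors. -/
lemma card_gset_ge_mul {n : ℕ} (κ D A L : ℝ) (hκ : 0 < κ) (hn : 0 < n) (W : Finset (Fin n))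
    (d : Fin n → ℤ) (M : ℕ) (hM : 100 ≤ M) (hMn : M + 1 ≤ n) (hW : W.card = M + 1)
    (hDM : 20 * D + 10 ≤ M)
    (heven : Even (∑ w ∈ W, d w)) (hΨ : degPotential κ W d ≤ A)
    (hA : A ≤ Real.exp (κ * D) / 2) (hL : 0 ≤ L)
    (ih : ∀ (W' : Finset (Fin n)) (d' : Fin n → ℤ), W'.card = M → Even (∑ w ∈ W', d' w) →
      degPotential κ W' d' ≤ (1 + 1 / n) * Real.cosh (κ / 2) * A → L ≤ (gset W' d').card) :
    Real.exp (M * Real.log 2 - 4 * D ^ 2 / M - 2 * Real.log (n + 1)) * L ≤ (gset W d).card := by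
  have hM0 : (100 : ℝ) ≤ M := by exact_mod_cast hM
  have hWne : W.Nonempty := Finset.card_pos.1 (by omega)
  have hδ := abs_le_of_degPotential_le hκ (hΨ.trans hA)
  have hWc : (W.card : ℝ) - 1 = M := by rw [hW]; push_cast; ring
  rw [hWc] at hδ
  obtain ⟨v, hv, hpiv⟩ := exists_pivot κ hκ W hWne fun w => (d w : ℝ) - M / 2
  have hδv := abs_le.1 (hδ v hv)
  have hdv0 : 0 ≤ d v := by
    have : (0 : ℝ) ≤ d v := by linarith
    exact_mod_cast this
  obtain ⟨k, hk⟩ := Int.eq_ofNat_of_zero_le hdv0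
  have hkr : (d v : ℝ) = k := by rw [hk]; push_cast; rfl
  have hkM : k ≤ M := by
    have : (k : ℝ) ≤ M := by rw [← hkr]; linarith
    exact_mod_cast this
  have hWe : (W.erase v).card = M := by rw [Finset.card_erase_of_mem hv, hW]; rfl
  have hA0 : 0 < A := by
    refine lt_of_lt_of_le ?_ hΨ
    exact Finset.sum_pos (fun w _ => Real.cosh_pos _) hWne
  have hcosh := Real.cosh_pos (κ / 2)
  have hsum := sum_degPotential_erase_le κ hκ W d v hv k (by omega) (by omega)
    (by rw [hWc]; exact hpiv)
  rw [hWe] at hsum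
  set P := (W.erase v).powersetCard k with hP
  have hPc : P.card = M.choose k := by rw [hP, Finset.card_powersetCard, hWe]
  set F := fun T : Finset (Fin n) =>
    degPotential κ (W.erase v) (fun w => d w - if w ∈ T then 1 else 0) with hF
  have hgood := card_filter_ge_of_sum_le P F (Real.cosh (κ / 2) * A) n hn (by positivity)
    (fun T _ => Finset.sum_nonneg fun w _ => (Real.cosh_pos _).le)
    (by
      rw [hPc]
      refine hsum.trans ?_
      gcongr)
  set Q := P.filter fun T => F T ≤ (1 + 1 / n) * (Real.cosh (κ / 2) * A) with hQ
  have hQmem : ∀ T ∈ Q, L ≤ ((gset W d).filter fun G => univ.filter (fun w => G.Adj v w) =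
      T).card := by
    intro T hT
    simp only [hQ, hP, mem_filter, mem_powersetCard] at hT
    obtain ⟨⟨hT1, hT2⟩, hT3⟩ := hT
    have h1 := card_gset_erase_le W d v hv T hT1 (by rw [hT2, hk])
    have h2 := ih (W.erase v) (fun w => d w - if w ∈ T then 1 else 0) hWe ?_ (by
      rw [mul_assoc]; exact hT3)
    · exact h2.trans (by exact_mod_cast h1)
    · rw [Finset.sum_sub_distrib, Finset.sum_boole, Finset.filter_mem_eq_inter,
        Finset.inter_eq_right.2 hT1, hT2]
      have := Finset.add_sum_erase W d hv
      have e : ∑ w ∈ W.erase v, d w - (k : ℤ) = ∑ w ∈ W, d w - 2 * k := by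
        rw [← this, hk]; ring
      rw [e]
      exact heven.sub (even_two_mul _)
  have hcount : (Q.card : ℝ) * L ≤ (gset W d).card := by
    have h1 : ∑ T ∈ Q, ((gset W d).filter fun G => univ.filter (fun w => G.Adj v w) = T).card ≤
        (gset W d).card := by
      rw [← Finset.card_biUnion]
      · exact Finset.card_le_card (Finset.biUnion_subset.2 fun T _ => Finset.filter_subset _ _)
      · intro T _ T' _ hne
        refine Finset.disjoint_left.2 fun G h1 h2 => hne ?_
        rw [← (Finset.mem_filter.1 h1).2, ← (Finset.mem_filter.1 h2).2]
    calc (Q.card : ℝ) * L = ∑ T ∈ Q, L := by rw [Finset.sum_const, nsmul_eq_mul]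
      _ ≤ ∑ T ∈ Q, (((gset W d).filter fun G =>
          univ.filter (fun w => G.Adj v w) = T).card : ℝ) := Finset.sum_le_sum hQmem
      _ ≤ _ := by exact_mod_cast h1
  refine le_trans (mul_le_mul_of_nonneg_right ?_ hL) hcount
  rw [hPc] at hgood
  have hch := choose_ge_two_pow M k (by omega) hkM
  have hM1 : (M : ℝ) + 1 ≤ n + 1 := by
    have : (M : ℝ) + 1 ≤ n := by exact_mod_cast hMn
    linarith
  have hsq : (2 * k - M : ℝ) ^ 2 ≤ 4 * D ^ 2 := by
    have : |(k : ℝ) - M / 2| ≤ D := by rw [← hkr]; exact hδ v hv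
    have := sq_le_sq' (abs_le.1 this).1 (abs_le.1 this).2
    nlinarith
  have hexp : Real.exp (M * Real.log 2 - 4 * D ^ 2 / M) ≤
      (2 : ℝ) ^ M * Real.exp (-((2 * k - M : ℝ) ^ 2 / M)) := by
    rw [sub_eq_add_neg, Real.exp_add, mul_comm (M : ℝ), Real.exp_mul, Real.exp_log (by norm_num),
      Real.rpow_natCast]
    gcongr
  have hn1 : (0 : ℝ) < n + 1 := by positivity
  have hlog : Real.exp (M * Real.log 2 - 4 * D ^ 2 / M - 2 * Real.log (n + 1)) =
      Real.exp (M * Real.log 2 - 4 * D ^ 2 / M) / (n + 1) ^ 2 := by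
    rw [Real.exp_sub, two_mul, Real.exp_add, Real.exp_log hn1, ← pow_two (_ + _)]
  rw [hlog, div_le_iff₀ (by positivity)]
  calc _ ≤ _ := hexp
    _ ≤ _ := hch
    _ ≤ (n + 1) * ((n + 1) * (Q.card : ℝ)) := by gcongr
    _ = _ := by ring

lemma card_gset_ge {n : ℕ} (κ D B γ : ℝ) (hκ : 0 < κ) (hn : 0 < n) (m : ℕ) (hm : 100 ≤ m)
    (hDm : 20 * D + 10 ≤ m) (hγ : γ = (1 + 1 / n) * Real.cosh (κ / 2)) (hB0 : 0 ≤ B)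
    (hB : B * γ ^ n ≤ Real.exp (κ * D) / 2) (M : ℕ) (hmM : m ≤ M) :
    M ≤ n → ∀ (W : Finset (Fin n)) (d : Fin n → ℤ), W.card = M → Even (∑ w ∈ W, d w) →
      degPotential κ W d ≤ B * γ ^ (n - M) →
      Real.exp (∑ i ∈ Ico m M, (i * Real.log 2 - 4 * D ^ 2 / i - 2 * Real.log (n + 1))) ≤
        (gset W d).card := by
  have hn' : (0 : ℝ) < n := by exact_mod_cast hn
  have hγ1 : 1 ≤ γ := by
    rw [hγ]
    have h1 := Real.one_le_cosh (κ / 2)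
    have : (0 : ℝ) < 1 / n := by positivity
    nlinarith
  have hpow : ∀ j ≤ n, B * γ ^ j ≤ Real.exp (κ * D) / 2 := fun j hj =>
    le_trans (mul_le_mul_of_nonneg_left (pow_le_pow_right₀ hγ1 hj) hB0) hB
  induction M, hmM using Nat.le_induction with
  | base =>
    intro hmn W d hW heven hΨ
    rw [Finset.Ico_self, Finset.sum_empty, Real.exp_zero]
    have hδ := abs_le_of_degPotential_le hκ (hΨ.trans (hpow _ (Nat.sub_le _ _)))
    have : (gset W d).Nonempty := by
      apply gset_nonempty_of_near_regular W d (by omega) _ heven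
      intro w hw
      have h1 := abs_le.1 (hδ w hw)
      rw [hW] at h1 ⊢
      constructor
      · have : 9 * (m : ℝ) ≤ 20 * d w := by linarith
        exact_mod_cast this
      · have : 20 * (d w : ℝ) ≤ 11 * m := by linarith
        exact_mod_cast this
    exact_mod_cast Finset.card_pos.2 this
  | succ M hmM ih =>
    intro hMn W d hW heven hΨ
    rw [Finset.sum_Ico_succ_top hmM, Real.exp_add, mul_comm]
    have hmM' : (m : ℝ) ≤ M := by exact_mod_cast hmM
    refine card_gset_ge_mul κ D _ _ hκ hn W d M (by omega) hMn hW (by linarith) heven hΨ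
      (hpow _ (Nat.sub_le _ _)) (Real.exp_pos _).le fun W' d' h1 h2 h3 =>
        ih (by omega) W' d' h1 h2 (h3.trans (le_of_eq ?_))
    rw [← hγ, show n - M = n - (M + 1) + 1 by omega, pow_succ]
    ring

lemma sum_Ico_rate_ge (n m : ℕ) (x D : ℝ) (hx : 10000 ≤ x) (hn : (n : ℝ) = x ^ 200)
    (hlog : Real.log n ≤ x) (hm : 1 ≤ m) (hm' : (m : ℝ) ≤ x ^ 103 + 1) (hmn : m ≤ n - 1)
    (hD : D = 2 * x ^ 101) :
    n * (n - 1) / 2 * Real.log 2 - x ^ 210 ≤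
      ∑ i ∈ Ico m (n - 1), (i * Real.log 2 - 4 * D ^ 2 / i - 2 * Real.log (n + 1)) := by
  have hn2 : 2 ≤ n := by omega
  have hx0 : 0 < x := by linarith
  rw [Finset.sum_sub_distrib, Finset.sum_sub_distrib, ← Finset.sum_mul, Finset.sum_const,
    Nat.card_Ico, nsmul_eq_mul]
  have hgauss : ∀ k : ℕ, ∑ i ∈ range k, (i : ℝ) = k * (k - 1) / 2 := by
    intro k
    induction k with
    | zero => simp
    | succ k ih => rw [Finset.sum_range_succ, ih]; push_cast; ring
  have h1 : ∑ i ∈ Ico m (n - 1), (i : ℝ) = ((n : ℝ) - 1) * (n - 2) / 2 - m * (m - 1) / 2 := by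
    rw [Finset.sum_Ico_eq_sub _ hmn, hgauss, hgauss, Nat.cast_sub (by omega)]
    push_cast; ring
  have h2 : ∑ i ∈ Ico m (n - 1), 4 * D ^ 2 / (i : ℝ) ≤ 4 * D ^ 2 * (1 + x) := by
    simp only [div_eq_mul_inv (4 * D ^ 2)]
    rw [← Finset.mul_sum]
    apply mul_le_mul_of_nonneg_left _ (by positivity)
    have a1 : ∑ i ∈ Ico m (n - 1), (i : ℝ)⁻¹ ≤ ∑ i ∈ Icc 1 n, (i : ℝ)⁻¹ := by
      apply Finset.sum_le_sum_of_subset_of_nonneg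
      · intro i hi
        simp only [mem_Ico, mem_Icc] at hi ⊢
        omega
      · intros; positivity
    have a2 := harmonic_le_one_add_log n
    rw [harmonic_eq_sum_Icc] at a2
    push_cast at a2
    linarith
  have h3 : Real.log (n + 1) ≤ x + 1 := by
    have b1 : (n : ℝ) + 1 ≤ n * 2 := by
      have : (1 : ℝ) ≤ n := by exact_mod_cast (by omega : 1 ≤ n)
      linarith
    have b2 : Real.log (n + 1) ≤ Real.log (n * 2) := Real.log_le_log (by positivity) b1
    rw [Real.log_mul (by positivity) (by norm_num)] at b2
    linarith [Real.log_two_lt_d9]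
  have h4 : ((n - 1 - m : ℕ) : ℝ) * (2 * Real.log (n + 1)) ≤ n * (2 * (x + 1)) := by
    have : ((n - 1 - m : ℕ) : ℝ) ≤ n := by exact_mod_cast (by omega)
    have h0 : 0 ≤ Real.log ((n : ℝ) + 1) := Real.log_nonneg (by
      have : (0 : ℝ) ≤ n := by positivity
      linarith)
    gcongr
  rw [h1]
  have l0 := Real.log_pos (by norm_num : (1 : ℝ) < 2)
  have l1 : Real.log 2 ≤ 1 := by linarith [Real.log_two_lt_d9]
  have hmm : (m : ℝ) * (m - 1) ≤ (x ^ 103 + 1) * (x ^ 103) := by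
    have : (1 : ℝ) ≤ m := by exact_mod_cast hm
    apply mul_le_mul hm' (by linarith) (by linarith) (by positivity)
  have h5 : (n * ((n : ℝ) - 1) / 2 - (((n : ℝ) - 1) * (n - 2) / 2 - m * (m - 1) / 2)) * Real.log 2 ≤
      n + (x ^ 103 + 1) * x ^ 103 := by
    have e : (n * ((n : ℝ) - 1) / 2 - (((n : ℝ) - 1) * (n - 2) / 2 - m * (m - 1) / 2)) =
      n - 1 + m * (m - 1) / 2 := by ring
    rw [e]
    have p0 : (0 : ℝ) ≤ (m : ℝ) * (m - 1) := by
      have : (1 : ℝ) ≤ m := by exact_mod_cast hm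
      apply mul_nonneg <;> linarith
    have p1 : (2 : ℝ) ≤ n := by exact_mod_cast hn2
    have : (0 : ℝ) ≤ n - 1 + m * (m - 1) / 2 := by linarith
    nlinarith [mul_le_mul_of_nonneg_left l1 this]
  have h6 : (n : ℝ) + (x ^ 103 + 1) * x ^ 103 + 4 * D ^ 2 * (1 + x) + n * (2 * (x + 1)) ≤
      x ^ 210 := by
    rw [hn, hD]
    have k1 : (1 : ℝ) ≤ x := by linarith
    have k2 : ∀ j ≤ 207, x ^ j ≤ x ^ 207 := fun j hj => pow_le_pow_right₀ k1 hj
    have k3 : 10000 * x ^ 207 ≤ x ^ 210 := by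
      have : x ^ 210 = x ^ 207 * x ^ 3 := by ring
      rw [this]
      have : x ≤ x ^ 3 := le_self_pow₀ k1 (by norm_num)
      nlinarith [pow_pos hx0 207]
    have e : x ^ 200 + (x ^ 103 + 1) * x ^ 103 + 4 * (2 * x ^ 101) ^ 2 * (1 + x) +
      x ^ 200 * (2 * (x + 1)) = 3 * x ^ 200 + x ^ 206 + x ^ 103 + 16 * x ^ 202 + 16 * x ^ 203 +
        2 * x ^ 201 := by ring
    rw [e]
    linarith [k2 200 (by norm_num), k2 206 (by norm_num), k2 103 (by norm_num),
      k2 202 (by norm_num), k2 203 (by norm_num), k2 201 (by norm_num), pow_pos hx0 207]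
  linarith

/-- Every neighbourhood of `v` of the right size is realised by many graphs. -/
lemma card_degSeqGraphs_nbhd_ge (n : ℕ) (x : ℝ) (hx : 10000 ≤ x) (hn : (n : ℝ) = x ^ 200)
    (hlog : Real.log n ≤ x) (d : Fin n → ℕ) (heven : Even (∑ w, d w))
    (hd : ∀ w, |2 * (d w : ℝ) - (n - 1)| ≤ x ^ 101) (v : Fin n) (T : Finset (Fin n))
    (hT : T ⊆ univ.erase v) (hTc : T.card = d v) :
    Real.exp (n * (n - 1) / 2 * Real.log 2 - x ^ 210) ≤
      ((degSeqGraphs n d).filter fun G => univ.filter (fun w => G.Adj v w) = T).card := by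
  have hx0 : 0 < x := by linarith
  have hx1 : 1 ≤ x := by linarith
  have hn0 : (0 : ℝ) < n := by rw [hn]; positivity
  have hn1 : 0 < n := by exact_mod_cast hn0
  have hsub := card_gset_erase_le univ (fun w => (d w : ℤ)) v (mem_univ v) T hT (by
    exact_mod_cast hTc)
  have hset : gset univ (fun w => (d w : ℤ)) = degSeqGraphs n d := by
    ext G; simp [gset, degSeqGraphs]
  rw [hset] at hsub
  refine le_trans ?_ (Nat.cast_le.2 hsub)
  obtain ⟨κ, hκ⟩ : ∃ κ : ℝ, κ = 1 / x ^ 100 := ⟨_, rfl⟩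
  obtain ⟨D, hD⟩ : ∃ D : ℝ, D = 2 * x ^ 101 := ⟨_, rfl⟩
  obtain ⟨γ, hγ⟩ : ∃ γ : ℝ, γ = (1 + 1 / n) * Real.cosh (κ / 2) := ⟨_, rfl⟩
  have hκ0 : 0 < κ := by rw [hκ]; positivity
  have hκD : κ * D = 2 * x := by rw [hκ, hD]; field_simp
  have hm1 := Nat.le_ceil (x ^ 103)
  have hm2 := (Nat.ceil_lt_add_one (show 0 ≤ x ^ 103 by positivity)).le
  set m := ⌈x ^ 103⌉₊ with hm
  have hp103 : 10000 * x ^ 101 ≤ x ^ 103 := by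
    have : x ^ 103 = x ^ 101 * x ^ 2 := by ring
    rw [this]
    have : x ≤ x ^ 2 := le_self_pow₀ hx1 (by norm_num)
    nlinarith [pow_pos hx0 101]
  have hp101 : 1 ≤ x ^ 101 := one_le_pow₀ hx1
  have hm100 : 100 ≤ m := by
    have : (100 : ℝ) ≤ m := by linarith
    exact_mod_cast this
  have hmn : m ≤ n - 1 := by
    have : (m : ℝ) + 1 ≤ n := by
      rw [hn]
      have e : x ^ 200 = x ^ 103 * x ^ 97 := by ring
      have : x ≤ x ^ 97 := le_self_pow₀ hx1 (by norm_num)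
      rw [e]
      nlinarith [pow_pos hx0 103]
    have : m + 1 ≤ n := by exact_mod_cast this
    omega
  have hγn : γ ^ n ≤ Real.exp 2 := by
    have a1 : γ ≤ Real.exp (1 / n + (κ / 2) ^ 2 / 2) := by
      rw [hγ, Real.exp_add]
      have := Real.add_one_le_exp (1 / (n : ℝ))
      have := Real.cosh_le_exp_half_sq (κ / 2)
      have := Real.cosh_pos (κ / 2)
      gcongr
      linarith
    have hγ0 : 0 ≤ γ := by rw [hγ]; have := Real.cosh_pos (κ / 2); positivity
    refine (pow_le_pow_left₀ hγ0 a1 n).trans ?_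
    rw [← Real.exp_nat_mul]
    apply Real.exp_le_exp.2
    have : (n : ℝ) * (1 / n + (κ / 2) ^ 2 / 2) = 1 + 1 / 8 := by
      rw [hκ, hn]; field_simp; norm_num
    rw [this]; norm_num
  have hγ1 : 1 ≤ γ := by
    rw [hγ]
    have h1 := Real.one_le_cosh (κ / 2)
    have : (0 : ℝ) < 1 / n := by positivity
    nlinarith
  have hWc : (univ.erase v : Finset (Fin n)).card = n - 1 := by
    rw [Finset.card_erase_of_mem (mem_univ v), Finset.card_univ, Fintype.card_fin]
  refine le_trans (Real.exp_le_exp.2 (sum_Ico_rate_ge n m x D hx hn hlog (by omega) hm2 hmn hD))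
    (card_gset_ge κ D (n * Real.exp (x / 2 + 1)) γ hκ0 hn1 m hm100 (by rw [hD]; linarith) hγ
      (by positivity) ?_ (n - 1) hmn (Nat.sub_le _ _) _ _ hWc ?_ ?_)
  · calc n * Real.exp (x / 2 + 1) * γ ^ n ≤ Real.exp x * Real.exp (x / 2 + 1) * Real.exp 2 := by
          gcongr
          rw [← Real.exp_log hn0]
          exact Real.exp_le_exp.2 hlog
      _ = Real.exp (x + (x / 2 + 1) + 2) := by rw [← Real.exp_add, ← Real.exp_add]
      _ ≤ Real.exp (κ * D - 1) := Real.exp_le_exp.2 (by rw [hκD]; linarith)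
      _ ≤ _ := by
          rw [Real.exp_sub]
          have := Real.exp_one_gt_d9
          gcongr
          linarith
  · rw [Finset.sum_sub_distrib, Finset.sum_boole, Finset.filter_mem_eq_inter,
        Finset.inter_eq_right.2 hT, hTc]
    have := Finset.add_sum_erase univ (fun w => (d w : ℤ)) (mem_univ v)
    have e : ∑ w ∈ univ.erase v, (d w : ℤ) - (d v : ℤ) = ∑ w, (d w : ℤ) - 2 * d v := by
      rw [← this]; ring
    have h2 : Even (∑ w, (d w : ℤ)) := by
      have := (Int.even_coe_nat (∑ w, d w)).2 heven
      push_cast at this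
      exact this
    have e3 := h2.sub (even_two_mul (d v : ℤ))
    rw [← e] at e3
    exact e3
  · have hbound : degPotential κ (univ.erase v) (fun w => (d w : ℤ) - if w ∈ T then 1 else 0) ≤
        n * Real.exp (x / 2 + 1) := by
      unfold degPotential
      have hc : ∀ w ∈ (univ.erase v : Finset (Fin n)),
          Real.cosh (κ * ((((d w : ℤ) - if w ∈ T then 1 else 0 : ℤ) : ℝ) -
            (((univ.erase v : Finset (Fin n)).card : ℝ) - 1) / 2)) ≤ Real.exp (x / 2 + 1) := by
        intro w _
        rw [hWc, Nat.cast_sub (by omega), ← Real.cosh_abs]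
        have hdw := abs_le.1 (hd w)
        have hab : |κ * ((((d w : ℤ) - if w ∈ T then 1 else 0 : ℤ) : ℝ) -
            ((n : ℝ) - (1 : ℕ) - 1) / 2)| ≤ x / 2 + 1 := by
          have hb : |(((d w : ℤ) - if w ∈ T then 1 else 0 : ℤ) : ℝ) -
            ((n : ℝ) - (1 : ℕ) - 1) / 2| ≤ x ^ 101 / 2 + 1 := by
            rw [abs_le]
            split_ifs <;> push_cast <;> constructor <;> linarith
          rw [abs_mul, abs_of_pos hκ0]
          calc _ ≤ κ * (x ^ 101 / 2 + 1) := by gcongr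
            _ = x / 2 + κ := by rw [hκ]; field_simp
            _ ≤ _ := by
              have : κ ≤ 1 := by
                rw [hκ]; exact div_le_one_of_le₀ (one_le_pow₀ hx1) (by positivity)
              linarith
        refine le_trans ?_ (Real.exp_le_exp.2 hab)
        rw [Real.cosh_eq]
        have : Real.exp (-|κ * ((((d w : ℤ) - if w ∈ T then 1 else 0 : ℤ) : ℝ) -
            ((n : ℝ) - (1 : ℕ) - 1) / 2)|) ≤
                Real.exp (|κ * ((((d w : ℤ) - if w ∈ T then 1 else 0 : ℤ) : ℝ) -
            ((n : ℝ) - (1 : ℕ) - 1) / 2)|) := Real.exp_le_exp.2 (by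
              linarith [abs_nonneg (κ * ((((d w : ℤ) - if w ∈ T then 1 else 0 : ℤ) : ℝ) -
            ((n : ℝ) - (1 : ℕ) - 1) / 2))])
        linarith
      refine (Finset.sum_le_sum hc).trans ?_
      rw [Finset.sum_const, nsmul_eq_mul, hWc]
      gcongr
      exact Nat.sub_le _ _
    refine hbound.trans ?_
    exact le_mul_of_one_le_right (by positivity) (one_le_pow₀ hγ1)

/-- Twice the deviation of the degree of `c` into `A` from `|A| / 2`. -/
noncomputable def degDev {n : ℕ} (G : SimpleGraph (Fin n)) (A : Finset (Fin n)) (c : Fin n) : ℤ :=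
  2 * degIn G A c - A.card

lemma abs_degDev_le {n : ℕ} (G : SimpleGraph (Fin n)) (A : Finset (Fin n)) (c : Fin n) :
    |degDev G A c| ≤ A.card := by
  have h : degIn G A c ≤ A.card := Finset.card_filter_le _ _
  unfold degDev
  rw [abs_le]
  constructor <;> omega

lemma sum_mul_degDev {n : ℕ} (G : SimpleGraph (Fin n)) (A : Finset (Fin n)) (z : Fin n → ℝ) :
    ∑ c, z c * (degDev G A c : ℝ) =
      (∑ p ∈ univ.filter (fun p : Fin n × Fin n => p.1 < p.2),
        (z p.1 * (if p.2 ∈ A then 1 else 0) + z p.2 * (if p.1 ∈ A then 1 else 0)) *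
          (if G.Adj p.1 p.2 then 1 else -1)) - ∑ c ∈ A, z c := by
  set g : Fin n → Fin n → ℝ := fun c a => z c * (if a ∈ A then 1 else 0) *
    (if G.Adj c a then 1 else -1) with hg
  have h1 : ∀ c, z c * (degDev G A c : ℝ) = ∑ a, g c a := by
    intro c
    have : (degDev G A c : ℝ) = ∑ a, (if a ∈ A then (1 : ℝ) else 0) *
        (if G.Adj c a then 1 else -1) := by
      have e : ∀ a, (if a ∈ A then (1 : ℝ) else 0) * (if G.Adj c a then 1 else -1) =
          if a ∈ A then 2 * (if G.Adj c a then 1 else 0) - 1 else 0 := by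
        intro a; split_ifs <;> norm_num
      simp only [e]
      rw [← Finset.sum_filter, Finset.filter_mem_eq_inter, Finset.univ_inter,
        Finset.sum_sub_distrib, ← Finset.mul_sum, Finset.sum_boole]
      simp [degDev, degIn]
    rw [this, Finset.mul_sum]
    exact Finset.sum_congr rfl fun a _ => by simp only [hg]; ring
  simp only [h1]
  have h2 : ∑ c, ∑ a, g c a = ∑ p : Fin n × Fin n, g p.1 p.2 := by
    rw [Fintype.sum_prod_type]
  rw [h2]
  have h3 : ∑ p : Fin n × Fin n, g p.1 p.2 =
      ∑ p ∈ univ.filter (fun p : Fin n × Fin n => p.1 < p.2), g p.1 p.2 +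
      (∑ p ∈ univ.filter (fun p : Fin n × Fin n => p.2 < p.1), g p.1 p.2 +
      ∑ p ∈ univ.filter (fun p : Fin n × Fin n => p.1 = p.2), g p.1 p.2) := by
    rw [Finset.sum_filter, Finset.sum_filter, Finset.sum_filter, ← Finset.sum_add_distrib,
      ← Finset.sum_add_distrib]
    refine Finset.sum_congr rfl fun p _ => ?_
    rcases lt_trichotomy p.1 p.2 with h | h | h
    · simp [h, h.not_gt, h.ne]
    · simp [h]
    · simp [h, h.not_gt, h.ne']
  have h4 : ∑ p ∈ univ.filter (fun p : Fin n × Fin n => p.2 < p.1), g p.1 p.2 =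
      ∑ p ∈ univ.filter (fun p : Fin n × Fin n => p.1 < p.2), g p.2 p.1 := by
    apply Finset.sum_equiv (Equiv.prodComm _ _)
    · simp
    · simp
  have h5 : ∑ p ∈ univ.filter (fun p : Fin n × Fin n => p.1 = p.2), g p.1 p.2 = - ∑ c ∈ A, z c := by
    rw [Finset.sum_filter, Fintype.sum_prod_type]
    simp [hg]
  rw [h3, h4, h5, ← add_assoc, ← Finset.sum_add_distrib, sub_eq_add_neg]
  congr 1
  refine Finset.sum_congr rfl fun p _ => ?_
  simp only [hg, G.adj_comm p.2 p.1]
  ring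

/-- The exponential generating function of edge weights over all graphs. -/
lemma sum_exp_edges_le {n : ℕ} (w : Fin n × Fin n → ℝ) :
    ∑ G : SimpleGraph (Fin n), Real.exp (∑ p ∈ univ.filter (fun p : Fin n × Fin n => p.1 < p.2),
      w p * (if G.Adj p.1 p.2 then 1 else -1)) ≤
    ∏ p ∈ univ.filter (fun p : Fin n × Fin n => p.1 < p.2), (2 * Real.exp (w p ^ 2 / 2)) := by
  set s := univ.filter (fun p : Fin n × Fin n => p.1 < p.2) with hs
  set E : SimpleGraph (Fin n) → Finset (Fin n × Fin n) := fun G => s.filter fun p => G.Adj p.1 p.2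
    with hE
  set F : Finset (Fin n × Fin n) → ℝ := fun t => (∏ p ∈ t, Real.exp (w p)) *
    ∏ p ∈ s \ t, Real.exp (-w p) with hF
  have hinj : Function.Injective E := by
    intro G G' h
    have hlt : ∀ a b, a < b → (G.Adj a b ↔ G'.Adj a b) := by
      intro a b hab
      have := congrArg (fun t => (a, b) ∈ t) h
      simpa [hE, hs, hab] using this
    ext a b
    rcases lt_trichotomy a b with h1 | h1 | h1
    · exact hlt a b h1
    · subst h1; simp
    · rw [G.adj_comm, G'.adj_comm]; exact hlt b a h1
  have h1 : ∀ G : SimpleGraph (Fin n), Real.exp (∑ p ∈ s,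
      w p * (if G.Adj p.1 p.2 then 1 else -1)) = F (E G) := by
    intro G
    simp only [hF, hE]
    rw [Real.exp_sum, ← Finset.prod_filter_mul_prod_filter_not s (fun p => G.Adj p.1 p.2)]
    congr 1
    · refine Finset.prod_congr rfl fun p hp => ?_
      rw [if_pos (Finset.mem_filter.1 hp).2, mul_one]
    · rw [Finset.filter_not]
      refine Finset.prod_congr rfl fun p hp => ?_
      rw [← Finset.filter_not, Finset.mem_filter] at hp
      rw [if_neg hp.2, mul_neg_one]
  simp only [h1]
  calc ∑ G, F (E G) = ∑ t ∈ univ.image E, F t := by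
        rw [Finset.sum_image hinj.injOn]
    _ ≤ ∑ t ∈ s.powerset, F t := by
        apply Finset.sum_le_sum_of_subset_of_nonneg
        · intro t ht
          obtain ⟨G, _, rfl⟩ := Finset.mem_image.1 ht
          exact Finset.mem_powerset.2 (Finset.filter_subset _ _)
        · intro t _ _
          exact mul_nonneg (Finset.prod_nonneg fun _ _ => (Real.exp_pos _).le)
            (Finset.prod_nonneg fun _ _ => (Real.exp_pos _).le)
    _ = ∏ p ∈ s, (Real.exp (w p) + Real.exp (-w p)) := (Finset.prod_add _ _ _).symm
    _ ≤ _ := by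
        apply Finset.prod_le_prod
        · intros; positivity
        · intro p _
          have := Real.cosh_le_exp_half_sq (w p)
          rw [Real.cosh_eq] at this
          linarith

lemma card_pairs_lt (n : ℕ) :
    ((univ.filter (fun p : Fin n × Fin n => p.1 < p.2)).card : ℝ) = n * (n - 1) / 2 := by
  have h1 : ∑ p : Fin n × Fin n, (1 : ℝ) =
      ∑ p : Fin n × Fin n, ((if p.1 < p.2 then (1 : ℝ) else 0) +
      ((if p.2 < p.1 then 1 else 0) + if p.1 = p.2 then 1 else 0)) := by
    refine Finset.sum_congr rfl fun p _ => ?_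
    rcases lt_trichotomy p.1 p.2 with h | h | h
    · simp [h, h.not_gt, h.ne]
    · simp [h]
    · simp [h, h.not_gt, h.ne']
  have h2 : ∑ p : Fin n × Fin n, (if p.2 < p.1 then (1 : ℝ) else 0) =
      ∑ p : Fin n × Fin n, (if p.1 < p.2 then (1 : ℝ) else 0) :=
    Fintype.sum_equiv (Equiv.prodComm _ _) _ _ fun _ => rfl
  have h3 : ∑ p : Fin n × Fin n, (if p.1 = p.2 then (1 : ℝ) else 0) = n := by
    rw [Fintype.sum_prod_type]; simp
  rw [Finset.sum_add_distrib, Finset.sum_add_distrib, h2, h3, Finset.sum_boole] at h1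
  simp only [sum_const, card_univ, Fintype.card_prod, Fintype.card_fin, nsmul_eq_mul,
    mul_one, Nat.cast_mul] at h1
  linarith

lemma sum_sq_pair_le {n : ℕ} (A : Finset (Fin n)) (z : Fin n → ℝ) :
    ∑ p ∈ univ.filter (fun p : Fin n × Fin n => p.1 < p.2),
      (z p.1 * (if p.2 ∈ A then 1 else 0) + z p.2 * (if p.1 ∈ A then 1 else 0)) ^ 2 ≤
      2 * n * ∑ c, z c ^ 2 := by
  have h1 : ∀ p : Fin n × Fin n,
      (z p.1 * (if p.2 ∈ A then 1 else 0) + z p.2 * (if p.1 ∈ A then 1 else 0)) ^ 2 ≤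
      2 * (z p.1 ^ 2 + z p.2 ^ 2) := by
    intro p
    split_ifs <;> nlinarith [sq_nonneg (z p.1 - z p.2), sq_nonneg (z p.1), sq_nonneg (z p.2)]
  refine (Finset.sum_le_sum fun p _ => h1 p).trans ?_
  have h2 : ∑ p ∈ univ.filter (fun p : Fin n × Fin n => p.1 < p.2), z p.2 ^ 2 =
      ∑ p ∈ univ.filter (fun p : Fin n × Fin n => p.2 < p.1), z p.1 ^ 2 := by
    apply Finset.sum_equiv (Equiv.prodComm _ _)
    · simp
    · simp
  rw [← Finset.mul_sum, Finset.sum_add_distrib, h2, mul_assoc]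
  apply mul_le_mul_of_nonneg_left _ (by norm_num)
  calc _ ≤ ∑ p : Fin n × Fin n, z p.1 ^ 2 := by
        rw [Finset.sum_filter, Finset.sum_filter, ← Finset.sum_add_distrib]
        refine Finset.sum_le_sum fun p _ => ?_
        have := sq_nonneg (z p.1)
        rcases lt_trichotomy p.1 p.2 with h | h | h
        · simp [h, h.not_gt]
        · simp [h, sq_nonneg]
        · simp [h, h.not_gt]
    _ = _ := by rw [Fintype.sum_prod_type]; simp [Finset.mul_sum]

lemma sum_exp_degDev_le {n : ℕ} (hn : 0 < n) (A : Finset (Fin n)) (z : Fin n → ℝ)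
    (hz : ∀ c, |z c| ≤ n) :
    ∑ G : SimpleGraph (Fin n), Real.exp (1 / (2 * n) * ∑ c, z c * (degDev G A c : ℝ)) ≤
      Real.exp (n * (n - 1) / 2 * Real.log 2 + (∑ c, z c ^ 2) / (4 * n) + n / 2) := by
  have hn0 : (0 : ℝ) < n := by exact_mod_cast hn
  set s := univ.filter (fun p : Fin n × Fin n => p.1 < p.2) with hs
  set w : Fin n × Fin n → ℝ := fun p =>
    (z p.1 * (if p.2 ∈ A then 1 else 0) + z p.2 * (if p.1 ∈ A then 1 else 0)) with hw
  have h1 : ∀ G : SimpleGraph (Fin n), Real.exp (1 / (2 * n) * ∑ c, z c * (degDev G A c : ℝ)) ≤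
      Real.exp (n / 2) * Real.exp (∑ p ∈ s, (1 / (2 * n) * w p) *
        (if G.Adj p.1 p.2 then 1 else -1)) := by
    intro G
    rw [← Real.exp_add, sum_mul_degDev]
    apply Real.exp_le_exp.2
    have h2 : -∑ c ∈ A, z c ≤ n * n := by
      calc -∑ c ∈ A, z c ≤ |∑ c ∈ A, z c| := neg_le_abs _
        _ ≤ ∑ c ∈ A, |z c| := Finset.abs_sum_le_sum_abs _ _
        _ ≤ ∑ c ∈ A, (n : ℝ) := Finset.sum_le_sum fun c _ => hz c
        _ = A.card * n := by rw [Finset.sum_const, nsmul_eq_mul]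
        _ ≤ n * n := by
          gcongr
          have := Finset.card_le_univ A
          rwa [Fintype.card_fin] at this
    have h3 : ∑ p ∈ s, (1 / (2 * n) * w p) * (if G.Adj p.1 p.2 then 1 else -1) =
        1 / (2 * n) * ∑ p ∈ s, w p * (if G.Adj p.1 p.2 then 1 else -1) := by
      rw [Finset.mul_sum]
      exact Finset.sum_congr rfl fun p _ => by ring
    rw [h3]
    have h4 : 1 / (2 * (n : ℝ)) * -∑ c ∈ A, z c ≤ n / 2 := by
      calc _ ≤ 1 / (2 * (n : ℝ)) * (n * n) := by gcongr
        _ = n / 2 := by field_simp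
    rw [mul_sub]
    linarith
  refine (Finset.sum_le_sum fun G _ => h1 G).trans ?_
  rw [← Finset.mul_sum]
  have h5 := sum_exp_edges_le fun p => 1 / (2 * n) * w p
  rw [Finset.prod_mul_distrib, Finset.prod_const, ← Real.exp_sum] at h5
  have h6 : (2 : ℝ) ^ s.card = Real.exp (n * (n - 1) / 2 * Real.log 2) := by
    rw [← card_pairs_lt, mul_comm, Real.exp_mul, Real.exp_log (by norm_num), Real.rpow_natCast]
  rw [h6] at h5
  have h7 : ∑ p ∈ s, (1 / (2 * n) * w p) ^ 2 / 2 ≤ (∑ c, z c ^ 2) / (4 * n) := by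
    have e : ∑ p ∈ s, (1 / (2 * n) * w p) ^ 2 / 2 = 1 / (8 * n ^ 2) * ∑ p ∈ s, w p ^ 2 := by
      rw [Finset.mul_sum]
      exact Finset.sum_congr rfl fun p _ => by field_simp; ring
    rw [e]
    calc _ ≤ 1 / (8 * (n : ℝ) ^ 2) * (2 * n * ∑ c, z c ^ 2) := by
          gcongr
          exact sum_sq_pair_le A z
      _ = _ := by field_simp; ring
  calc _ ≤ Real.exp (n / 2) * _ := mul_le_mul_of_nonneg_left h5 (Real.exp_pos _).le
    _ ≤ Real.exp (n / 2) * (Real.exp (n * (n - 1) / 2 * Real.log 2) *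
        Real.exp ((∑ c, z c ^ 2) / (4 * n))) := by gcongr
    _ = _ := by rw [← Real.exp_add, ← Real.exp_add]; congr 1; ring

/-- Graphs in which all degree deviation vectors into vertex subsets have small `ℓ²` norm. -/
def IsSpread {n : ℕ} (K : ℝ) (G : SimpleGraph (Fin n)) : Prop :=
  ∀ A : Finset (Fin n), ∑ c, (degDev G A c : ℝ) ^ 2 ≤ K

lemma card_not_isSpread_le {n : ℕ} (hn : 0 < n) (K : ℝ) :
    ((univ.filter fun G : SimpleGraph (Fin n) => ¬ IsSpread K G).card : ℝ) ≤
      2 ^ n * (2 * n + 1) ^ n *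
        Real.exp (n * (n - 1) / 2 * Real.log 2 + n / 2 - K / (4 * n)) := by
  have hn0 : (0 : ℝ) < n := by exact_mod_cast hn
  set Z : Finset (Fin n → ℤ) := Fintype.piFinset fun _ => Finset.Icc (-n : ℤ) n with hZ
  set I := ((univ : Finset (Finset (Fin n))) ×ˢ Z).filter fun i => K < ∑ c, (i.2 c : ℝ) ^ 2 with hI
  have hsub : (univ.filter fun G : SimpleGraph (Fin n) => ¬ IsSpread K G) ⊆
      I.biUnion fun i => univ.filter fun G => degDev G i.1 = i.2 := by
    intro G hG
    simp only [mem_filter, mem_univ, true_and, IsSpread, not_forall, not_le] at hG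
    obtain ⟨A, hA⟩ := hG
    refine Finset.mem_biUnion.2 ⟨(A, degDev G A), ?_, by simp⟩
    simp only [hI, hZ, mem_filter, mem_product, mem_univ, true_and, Fintype.mem_piFinset, mem_Icc]
    refine ⟨fun c => ?_, hA⟩
    have h1 := abs_le.1 (abs_degDev_le G A c)
    have h2 := Finset.card_le_univ A
    rw [Fintype.card_fin] at h2
    omega
  have hIc : (I.card : ℝ) ≤ 2 ^ n * (2 * n + 1) ^ n := by
    have : I.card ≤ 2 ^ n * (2 * n + 1) ^ n := by
      refine (Finset.card_filter_le _ _).trans ?_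
      rw [Finset.card_product, hZ, Fintype.card_piFinset]
      simp only [card_univ, Fintype.card_finset, Fintype.card_fin, Int.card_Icc, prod_const]
      apply le_of_eq
      congr 2
      omega
    exact_mod_cast this
  have hterm : ∀ i ∈ I, ((univ.filter fun G : SimpleGraph (Fin n) => degDev G i.1 = i.2).card : ℝ) ≤
      Real.exp (n * (n - 1) / 2 * Real.log 2 + n / 2 - K / (4 * n)) := by
    intro i hi
    simp only [hI, hZ, mem_filter, mem_product, mem_univ, true_and, Fintype.mem_piFinset,
      mem_Icc] at hi
    have h1 := sum_exp_degDev_le hn i.1 (fun c => (i.2 c : ℝ)) (fun c => by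
      have := hi.1 c
      rw [abs_le]
      exact ⟨by exact_mod_cast this.1, by exact_mod_cast this.2⟩)
    have h2 : ((univ.filter fun G : SimpleGraph (Fin n) => degDev G i.1 = i.2).card : ℝ) *
        Real.exp (1 / (2 * n) * ∑ c, (i.2 c : ℝ) ^ 2) ≤
        ∑ G : SimpleGraph (Fin n), Real.exp
            (1 / (2 * n) * ∑ c, (i.2 c : ℝ) * (degDev G i.1 c : ℝ)) := by
      rw [← nsmul_eq_mul]
      refine (Finset.card_nsmul_le_sum _
        (fun G => Real.exp (1 / (2 * n) * ∑ c, (i.2 c : ℝ) * (degDev G i.1 c : ℝ))) _ ?_).trans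
        (Finset.sum_le_sum_of_subset_of_nonneg (Finset.subset_univ _)
          fun _ _ _ => (Real.exp_pos _).le)
      intro G hG
      rw [(Finset.mem_filter.1 hG).2]
      simp only [pow_two]
      exact le_rfl
    have h3 := h2.trans h1
    rw [← le_div_iff₀ (Real.exp_pos _), ← Real.exp_sub] at h3
    refine h3.trans (Real.exp_le_exp.2 ?_)
    have h4 : K / (4 * n) ≤ (∑ c, (i.2 c : ℝ) ^ 2) / (4 * n) := by
      gcongr
      exact hi.2.le
    have h5 : 1 / (2 * n) * ∑ c, (i.2 c : ℝ) ^ 2 = 2 * ((∑ c, (i.2 c : ℝ) ^ 2) / (4 * n)) := by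
      field_simp; ring
    rw [h5]
    linarith
  calc ((univ.filter fun G : SimpleGraph (Fin n) => ¬ IsSpread K G).card : ℝ) ≤
        ∑ i ∈ I, ((univ.filter fun G : SimpleGraph (Fin n) => degDev G i.1 = i.2).card : ℝ) := by
        exact_mod_cast (Finset.card_le_card hsub).trans Finset.card_biUnion_le
    _ ≤ ∑ i ∈ I, Real.exp (n * (n - 1) / 2 * Real.log 2 + n / 2 - K / (4 * n)) :=
        Finset.sum_le_sum hterm
    _ = I.card * Real.exp (n * (n - 1) / 2 * Real.log 2 + n / 2 - K / (4 * n)) := by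
        rw [Finset.sum_const, nsmul_eq_mul]
    _ ≤ _ := by gcongr

/-- Non-spread graphs are rare compared with any realisable class. -/
lemma card_not_isSpread_mul_le (n : ℕ) (x : ℝ) (hx : 10000 ≤ x) (hn : (n : ℝ) = x ^ 200)
    (hlog : Real.log n ≤ x) (d : Fin n → ℕ) (heven : Even (∑ w, d w))
    (hd : ∀ w, |2 * (d w : ℝ) - (n - 1)| ≤ x ^ 101) (v : Fin n) (T : Finset (Fin n))
    (hT : T ⊆ univ.erase v) (hTc : T.card = d v) :
    ((univ.filter fun G : SimpleGraph (Fin n) => ¬ IsSpread (x ^ 412) G).card : ℝ) * n ^ 10 ≤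
      ((degSeqGraphs n d).filter fun G => univ.filter (fun w => G.Adj v w) = T).card := by
  have hx0 : 0 < x := by linarith
  have hx1 : 1 ≤ x := by linarith
  have hn0 : (0 : ℝ) < n := by rw [hn]; positivity
  have hn1 : 0 < n := by exact_mod_cast hn0
  refine le_trans ?_ (card_degSeqGraphs_nbhd_ge n x hx hn hlog d heven hd v T hT hTc)
  have h1 := card_not_isSpread_le hn1 (x ^ 412)
  have h2 : (n : ℝ) ^ 10 = Real.exp (10 * Real.log n) := by
    rw [← Real.exp_log (pow_pos hn0 10), Real.log_pow]; push_cast; rfl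
  have h3 : (2 : ℝ) ^ n * (2 * n + 1) ^ n = Real.exp (n * (Real.log 2 + Real.log (2 * n + 1))) := by
    rw [mul_add, Real.exp_add, Real.exp_nat_mul, Real.exp_nat_mul, Real.exp_log (by norm_num),
      Real.exp_log (by positivity)]
  have h4 : Real.log (2 * n + 1) ≤ x + 2 := by
    have e1 : (1 : ℝ) ≤ n := by exact_mod_cast hn1
    have e2 : Real.log (2 * n + 1) ≤ Real.log (n * (2 * 2)) :=
      Real.log_le_log (by positivity) (by linarith)
    rw [Real.log_mul (by positivity) (by norm_num), Real.log_mul (by norm_num) (by norm_num)] at e2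
    linarith [Real.log_two_lt_d9]
  have h5 := Real.log_two_lt_d9
  calc _ ≤ (2 ^ n * (2 * n + 1) ^ n *
        Real.exp (n * (n - 1) / 2 * Real.log 2 + n / 2 - x ^ 412 / (4 * n))) * n ^ 10 := by gcongr
    _ = Real.exp (n * (Real.log 2 + Real.log (2 * n + 1)) + (n * (n - 1) / 2 * Real.log 2 + n / 2 -
        x ^ 412 / (4 * n)) + 10 * Real.log n) := by rw [h3, h2, ← Real.exp_add, ← Real.exp_add]
    _ ≤ _ := Real.exp_le_exp.2 ?_
  have h6 : x ^ 412 / (4 * n) = x ^ 212 / 4 := by rw [hn]; field_simp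
  rw [h6]
  have h7 : n * (Real.log 2 + Real.log (2 * n + 1)) ≤ n * (x + 3) := by
    apply mul_le_mul_of_nonneg_left _ hn0.le; linarith
  have h8 : n * (x + 3) + n / 2 + 10 * x + x ^ 210 ≤ x ^ 212 / 4 := by
    rw [hn]
    have k2 : ∀ j ≤ 211, x ^ j ≤ x ^ 211 := fun j hj => pow_le_pow_right₀ hx1 hj
    have k3 : 10000 * x ^ 211 ≤ x ^ 212 := by
      have : x ^ 212 = x ^ 211 * x := by ring
      rw [this]
      nlinarith [pow_pos hx0 211]
    have e : x ^ 200 * (x + 3) = x ^ 201 + 3 * x ^ 200 := by ring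
    have k1 := k2 1 (by norm_num)
    rw [pow_one] at k1
    rw [e]
    linarith [k2 200 (by norm_num), k2 201 (by norm_num), k2 210 (by norm_num), pow_pos hx0 211]
  linarith

/-- The graphs with degree sequence `d` in which `v` has exactly `t` neighbours in `U`. -/
noncomputable def fiberGraphs {n : ℕ} (d : Fin n → ℕ) (U : Finset (Fin n)) (v : Fin n) (t : ℕ) :
    Finset (SimpleGraph (Fin n)) :=
  (degSeqGraphs n d).filter fun G => degIn G U v = t

lemma fiberGraphs_not_isSpread (n : ℕ) (x : ℝ) (hx : 10000 ≤ x) (hn : (n : ℝ) = x ^ 200)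
    (hlog : Real.log n ≤ x) (d : Fin n → ℕ) (heven : Even (∑ w, d w))
    (hd : ∀ w, |2 * (d w : ℝ) - (n - 1)| ≤ x ^ 101) (v : Fin n) (U : Finset (Fin n)) (t : ℕ) :
    (((fiberGraphs d U v t).filter fun G => ¬ IsSpread (x ^ 412) G).card : ℝ) * n ^ 10 ≤
      (fiberGraphs d U v t).card := by
  rcases (fiberGraphs d U v t).eq_empty_or_nonempty with h | ⟨G, hG⟩
  · simp [h]
  simp only [fiberGraphs, degSeqGraphs, mem_filter, mem_univ, true_and] at hG
  obtain ⟨hG1, hG2⟩ := hG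
  have h1 := card_not_isSpread_mul_le n x hx hn hlog d heven hd v
    (univ.filter fun w => G.Adj v w) (by
      intro w hw
      simp only [mem_filter, mem_univ, true_and] at hw
      simpa using hw.ne') (hG1 v)
  refine le_trans ?_ (h1.trans ?_)
  · refine mul_le_mul_of_nonneg_right ?_ (by positivity)
    exact Nat.cast_le.2 (Finset.card_le_card
      (Finset.filter_subset_filter _ (Finset.subset_univ (fiberGraphs d U v t))))
  · gcongr
    intro H hH
    simp only [fiberGraphs, mem_filter] at hH ⊢
    refine ⟨hH.1, ?_⟩
    rw [← hG2]
    unfold degIn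
    congr 1
    ext w
    have := congrArg (fun t => w ∈ t) hH.2
    simp only [mem_filter, mem_univ, true_and, eq_iff_iff] at this ⊢
    tauto

/-- The number of ways of exchanging the edge `v p` for `v q` by a switching. -/
noncomputable def switchCount {n : ℕ} (G : SimpleGraph (Fin n)) (p q : Fin n) : ℕ :=
  (univ.filter fun c => G.Adj q c ∧ ¬ G.Adj p c ∧ c ≠ p).card

/-- The switchings available in a fiber. -/
noncomputable def switchings {n : ℕ} (d : Fin n → ℕ) (U : Finset (Fin n)) (v : Fin n) (t : ℕ)
    (p q : Fin n) : Finset (SimpleGraph (Fin n) × Fin n) :=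
  (fiberGraphs d U v t ×ˢ univ).filter fun i =>
    (i.1.Adj v p ∧ ¬ i.1.Adj v q) ∧ i.1.Adj q i.2 ∧ ¬ i.1.Adj p i.2 ∧ i.2 ≠ p

lemma card_switchings_le {n : ℕ} (d : Fin n → ℕ) (U : Finset (Fin n)) (v : Fin n) (t t' : ℕ)
    (p q : Fin n) (hpv : p ≠ v) (hqv : q ≠ v)
    (ht : (t' : ℤ) = t + (if q ∈ U then 1 else 0) - (if p ∈ U then 1 else 0)) :
    (switchings d U v t p q).card ≤ (switchings d U v t' q p).card := by
  set ψ : Fin n → Fin n → ℤ := fun c w =>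
      (if w = v then 1 else 0) - (if w = c then 1 else 0) with hψ
  set χ : Fin n → ℤ := fun w => (if w = q then 1 else 0) - (if w = p then 1 else 0) with hχ
  have hbin : ∀ i ∈ switchings d U v t p q, ∀ a b,
      adjInd i.1 a b + ψ i.2 a * χ b + χ a * ψ i.2 b = 0 ∨
      adjInd i.1 a b + ψ i.2 a * χ b + χ a * ψ i.2 b = 1 := by
    rintro ⟨G, c⟩ hi a b
    simp only [switchings, mem_filter, mem_product] at hi
    obtain ⟨_, ⟨h1, h2⟩, h3, h4, h5⟩ := hi
    have hpq : p ≠ q := fun e => h2 (e ▸ h1)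
    have hcv : c ≠ v := fun e => h2 (by subst e; exact h3.symm)
    have hcq : c ≠ q := h3.ne'
    have e1 : adjInd G v p = 1 := if_pos h1
    have e2 : adjInd G p v = 1 := if_pos h1.symm
    have e3 : adjInd G v q = 0 := if_neg h2
    have e4 : adjInd G q v = 0 := if_neg fun h => h2 h.symm
    have e5 : adjInd G q c = 1 := if_pos h3
    have e6 : adjInd G c q = 1 := if_pos h3.symm
    have e7 : adjInd G p c = 0 := if_neg h4
    have e8 : adjInd G c p = 0 := if_neg fun h => h4 h.symm
    have e9 : ∀ u w, adjInd G u w = 0 ∨ adjInd G u w = 1 := fun u w => by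
      unfold adjInd; split_ifs <;> simp
    have ha : a = v ∨ a = c ∨ a = p ∨ a = q ∨ (a ≠ v ∧ a ≠ c ∧ a ≠ p ∧ a ≠ q) := by tauto
    have hb : b = v ∨ b = c ∨ b = p ∨ b = q ∨ (b ≠ v ∧ b ≠ c ∧ b ≠ p ∧ b ≠ q) := by tauto
    simp only [hψ, hχ]
    clear h1 h2 h3 h4 ht
    rcases ha with rfl | rfl | rfl | rfl | ⟨a1, a2, a3, a4⟩ <;>
      rcases hb with rfl | rfl | rfl | rfl | ⟨b1, b2, b3, b4⟩ <;>
      simp [*, adjInd_self, Ne.symm, hpv.symm, hqv.symm, hcv.symm, hcq.symm, h5.symm, hpq.symm]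
  apply Finset.card_le_card_of_injOn fun i => (perturb i.1 (ψ i.2) χ, i.2)
  · rintro ⟨G, c⟩ hi
    have hb := hbin _ hi
    have hadj := adjInd_perturb hb
    have hdeg := degIn_perturb hb
    simp only [switchings, coe_filter, mem_filter, mem_product, mem_univ, and_true,
        Set.mem_ofPred_eq, fiberGraphs, degSeqGraphs, true_and] at hi hadj hdeg ⊢
    obtain ⟨⟨hd, hU⟩, ⟨h1, h2⟩, h3, h4, h5⟩ := hi
    have hpq : p ≠ q := fun e => h2 (e ▸ h1)
    have hcv : c ≠ v := fun e => h2 (by subst e; exact h3.symm)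
    have hcq : c ≠ q := h3.ne'
    have hadj' : ∀ a b, (perturb G (ψ c) χ).Adj a b ↔ adjInd (perturb G (ψ c) χ) a b = 1 := by
      intro a b; unfold adjInd; split_ifs <;> simp_all
    simp only [hadj', hadj]
    have e1 : adjInd G v p = 1 := if_pos h1
    have e3 : adjInd G v q = 0 := if_neg h2
    have e5 : adjInd G q c = 1 := if_pos h3
    have e7 : adjInd G p c = 0 := if_neg h4
    refine ⟨⟨?_, ?_⟩, ⟨?_, ?_⟩, ?_, ?_, hcq⟩
    · intro w
      have h := hdeg univ w
      have k1 : ∑ u, χ u = 0 := by simp [hχ]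
      have k2 : ∑ u, ψ c u = 0 := by simp [hψ]
      rw [k1, k2, mul_zero, mul_zero, add_zero, add_zero, Nat.cast_inj, hd w] at h
      exact h
    · have h := hdeg U v
      have k1 : ∑ u ∈ U, χ u = (if q ∈ U then 1 else 0) - (if p ∈ U then 1 else 0) := by
        simp [hχ]
      have k2 : ψ c v = 1 := by simp [hψ, hcv.symm]
      have k3 : χ v = 0 := by simp [hχ, hpv.symm, hqv.symm]
      rw [k1, k2, k3, zero_mul, one_mul, add_zero, hU] at h
      omega
    all_goals simp [hψ, hχ, e1, e3, e5, e7, hpv, hqv, hcv, hcq, h5, hpq, hpv.symm, hqv.symm,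
        hcv.symm,
      hcq.symm, h5.symm, hpq.symm]
  · rintro ⟨G, c⟩ hi ⟨G', c'⟩ hi' heq
    simp only [Prod.mk.injEq] at heq
    obtain ⟨h1, rfl⟩ := heq
    have a1 := adjInd_perturb (hbin _ hi)
    have a2 := adjInd_perturb (hbin _ hi')
    simp only at a1 a2
    have : G = G' := graph_ext_adjInd fun a b => by
      have b1 := a1 a b
      have b2 := a2 a b
      rw [h1] at b1
      linarith
    rw [this]

lemma card_switchings_eq {n : ℕ} (d : Fin n → ℕ) (U : Finset (Fin n)) (v : Fin n) (t t' : ℕ)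
    (p q : Fin n) (hpv : p ≠ v) (hqv : q ≠ v)
    (ht : (t' : ℤ) = t + (if q ∈ U then 1 else 0) - (if p ∈ U then 1 else 0)) :
    (switchings d U v t p q).card = (switchings d U v t' q p).card :=
  le_antisymm (card_switchings_le d U v t t' p q hpv hqv ht)
    (card_switchings_le d U v t' t q p hqv hpv (by omega))

lemma sum_mul_card_switchings {n : ℕ} (d : Fin n → ℕ) (U : Finset (Fin n)) (v : Fin n) (t : ℕ)
    (A B : Finset (Fin n)) (f : Fin n → Fin n → ℝ) :
    ∑ p ∈ A, ∑ q ∈ B, f p q * (switchings d U v t p q).card =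
      ∑ G ∈ fiberGraphs d U v t, ∑ p ∈ A.filter (fun p => G.Adj v p),
        ∑ q ∈ B.filter (fun q => ¬ G.Adj v q), f p q * switchCount G p q := by
  have h1 : ∀ p q, ((switchings d U v t p q).card : ℝ) = ∑ G ∈ fiberGraphs d U v t,
      if G.Adj v p then (if ¬ G.Adj v q then (switchCount G p q : ℝ) else 0) else 0 := by
    intro p q
    unfold switchings switchCount
    rw [Finset.card_filter, Finset.sum_product]
    push_cast
    refine Finset.sum_congr rfl fun G _ => ?_
    by_cases h1 : G.Adj v p <;> by_cases h2 : G.Adj v q <;> simp [h1, h2]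
  simp only [h1, Finset.mul_sum]
  rw [Finset.sum_congr rfl fun p _ => Finset.sum_comm, Finset.sum_comm]
  refine Finset.sum_congr rfl fun G _ => ?_
  rw [Finset.sum_filter]
  refine Finset.sum_congr rfl fun p _ => ?_
  by_cases h1 : G.Adj v p
  · simp only [h1, if_true]
    rw [Finset.sum_filter]
    refine Finset.sum_congr rfl fun q _ => ?_
    split_ifs <;> simp
  · simp [h1]

/-- The `±1` adjacency matrix entry. -/
noncomputable def adjSign {n : ℕ} (G : SimpleGraph (Fin n)) (a b : Fin n) : ℝ :=
  2 * (adjInd G a b : ℝ) - 1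

lemma adjSign_sq {n : ℕ} (G : SimpleGraph (Fin n)) (a b : Fin n) : adjSign G a b ^ 2 = 1 := by
  unfold adjSign adjInd
  split_ifs <;> norm_num

lemma sum_adjSign {n : ℕ} (G : SimpleGraph (Fin n)) (A : Finset (Fin n)) (c : Fin n) :
    ∑ p ∈ A, adjSign G p c = degDev G A c := by
  unfold adjSign degDev
  have h := degIn_eq_sum_adjInd G A c
  have h' : (degIn G A c : ℝ) = ∑ u ∈ A, (adjInd G c u : ℝ) := by exact_mod_cast h
  rw [Finset.sum_sub_distrib, ← Finset.mul_sum]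
  push_cast
  rw [h']
  simp [adjInd_comm]

/-- Twice the deviation of a degree from `(n - 1) / 2`. -/
def degExcess {n : ℕ} (d : Fin n → ℕ) (w : Fin n) : ℝ := 2 * (d w : ℝ) - (n - 1)

lemma sum_adjSign_univ {n : ℕ} {d : Fin n → ℕ} {G : SimpleGraph (Fin n)}
    (hG : ∀ w, degIn G univ w = d w) (p : Fin n) :
    ∑ c, adjSign G p c = degExcess d p - 1 := by
  have h := sum_adjSign G univ p
  rw [Finset.sum_congr rfl fun c _ => show adjSign G p c = adjSign G c p by
    unfold adjSign; rw [adjInd_comm], h]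
  unfold degDev degExcess
  rw [hG]
  push_cast
  simp
  ring

lemma four_mul_switchCount {n : ℕ} {d : Fin n → ℕ} {G : SimpleGraph (Fin n)}
    (hG : ∀ w, degIn G univ w = d w) (p q : Fin n) :
    4 * (switchCount G p q : ℝ) = n + degExcess d q - degExcess d p
      - ∑ c, adjSign G p c * adjSign G q c - 4 * adjInd G q p := by
  have h1 : (switchCount G p q : ℝ) = ∑ c, (((adjInd G q c : ℝ) * (1 - adjInd G p c))
      - if c = p then (adjInd G q p : ℝ) else 0) := by
    unfold switchCount
    rw [Finset.card_filter]
    push_cast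
    refine Finset.sum_congr rfl fun c _ => ?_
    by_cases hcp : c = p
    · subst hcp; simp [adjInd_self]
    · unfold adjInd
      by_cases h1 : G.Adj q c <;> by_cases h2 : G.Adj p c <;> simp [h1, h2, hcp]
  have h2 : ∀ c, 4 * ((adjInd G q c : ℝ) * (1 - adjInd G p c)) =
      1 + adjSign G q c - adjSign G p c - adjSign G p c * adjSign G q c := fun c => by
    unfold adjSign; ring
  rw [h1, Finset.sum_sub_distrib, mul_sub, Finset.mul_sum, Finset.sum_congr rfl fun c _ => h2 c]
  rw [Finset.sum_sub_distrib, Finset.sum_sub_distrib, Finset.sum_add_distrib, sum_adjSign_univ hG,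
    sum_adjSign_univ hG]
  simp
  ring

lemma sum_sum_gram {n : ℕ} (G : SimpleGraph (Fin n)) (P Q : Finset (Fin n)) :
    ∑ p ∈ P, ∑ q ∈ Q, ∑ c, adjSign G p c * adjSign G q c =
      ∑ c, (degDev G P c : ℝ) * degDev G Q c := by
  simp only [← sum_adjSign]
  rw [Finset.sum_congr rfl fun p _ => Finset.sum_comm, Finset.sum_comm]
  refine Finset.sum_congr rfl fun c _ => ?_
  rw [Finset.sum_mul_sum]

lemma abs_sum_gram_le {n : ℕ} {K M : ℝ} (hM : 0 ≤ M) (hK : n * K ≤ M ^ 2) {G : SimpleGraph (Fin n)}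
    (hG : IsSpread K G) (P : Finset (Fin n)) (q : Fin n) :
    |∑ p ∈ P, ∑ c, adjSign G p c * adjSign G q c| ≤ M := by
  rw [Finset.sum_comm]
  simp only [← Finset.sum_mul, sum_adjSign]
  apply abs_le_of_sq_le_sq _ hM
  refine le_trans (Finset.sum_mul_sq_le_sq_mul_sq _ _ _) (le_trans ?_ hK)
  simp only [adjSign_sq]
  rw [mul_comm]
  simp
  exact mul_le_mul_of_nonneg_left (hG P) (by positivity)

lemma adjInd_nonneg_le_one {n : ℕ} (G : SimpleGraph (Fin n)) (a b : Fin n) :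
    (0 : ℝ) ≤ adjInd G a b ∧ (adjInd G a b : ℝ) ≤ 1 := by
  unfold adjInd; split_ifs <;> norm_num

lemma card_le_real {n : ℕ} (P : Finset (Fin n)) : (P.card : ℝ) ≤ n := by
  have := Finset.card_le_univ P
  simp at this
  exact_mod_cast this

lemma abs_sum_switchCount_sub_le {n : ℕ} {K : ℝ} {d : Fin n → ℕ} {G : SimpleGraph (Fin n)}
    (hG : ∀ w, degIn G univ w = d w) (hs : IsSpread K G) (P Q : Finset (Fin n)) :
    |∑ p ∈ P, ∑ q ∈ Q, 4 * (switchCount G p q : ℝ) - (n * P.card * Q.card +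
      P.card * ∑ q ∈ Q, degExcess d q - Q.card * ∑ p ∈ P, degExcess d p)| ≤ K + 4 * n ^ 2 := by
  have h1 : ∑ p ∈ P, ∑ q ∈ Q, 4 * (switchCount G p q : ℝ) - (n * P.card * Q.card +
      P.card * ∑ q ∈ Q, degExcess d q - Q.card * ∑ p ∈ P, degExcess d p) =
      - ∑ c, (degDev G P c : ℝ) * degDev G Q c - 4 * ∑ p ∈ P, ∑ q ∈ Q, (adjInd G q p : ℝ) := by
    simp only [four_mul_switchCount hG]
    rw [← sum_sum_gram]
    simp only [Finset.sum_sub_distrib, Finset.sum_add_distrib, Finset.sum_const, nsmul_eq_mul,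
      ← Finset.mul_sum]
    ring
  rw [h1]
  have h2 : |∑ c, (degDev G P c : ℝ) * degDev G Q c| ≤ K := by
    refine (Finset.abs_sum_le_sum_abs _ _).trans ?_
    have : ∑ c, |(degDev G P c : ℝ) * degDev G Q c| ≤
        ∑ c, ((degDev G P c : ℝ) ^ 2 / 2 + (degDev G Q c : ℝ) ^ 2 / 2) := by
      refine Finset.sum_le_sum fun c _ => ?_
      rw [abs_le]
      constructor <;> nlinarith [sq_nonneg ((degDev G P c : ℝ) + degDev G Q c),
        sq_nonneg ((degDev G P c : ℝ) - degDev G Q c)]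
    refine this.trans ?_
    rw [Finset.sum_add_distrib, ← Finset.sum_div, ← Finset.sum_div]
    linarith [hs P, hs Q]
  have h3 : 0 ≤ ∑ p ∈ P, ∑ q ∈ Q, (adjInd G q p : ℝ) :=
    Finset.sum_nonneg fun p _ => Finset.sum_nonneg fun q _ => (adjInd_nonneg_le_one G q p).1
  have h4 : ∑ p ∈ P, ∑ q ∈ Q, (adjInd G q p : ℝ) ≤ n ^ 2 := by
    calc _ ≤ ∑ p ∈ P, ∑ q ∈ Q, (1 : ℝ) := Finset.sum_le_sum fun p _ => Finset.sum_le_sum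
          fun q _ => (adjInd_nonneg_le_one G q p).2
      _ = P.card * Q.card := by simp
      _ ≤ n * n := mul_le_mul (card_le_real _) (card_le_real _) (by positivity) (by positivity)
      _ = _ := by ring
  rw [abs_le] at h2 ⊢
  constructor <;> linarith

lemma abs_sum_left_switchCount_le {n : ℕ} {K M D : ℝ} (hM : 0 ≤ M) (hK : n * K ≤ M ^ 2)
    {d : Fin n → ℕ} {G : SimpleGraph (Fin n)} (hD : ∀ w, |degExcess d w| ≤ D)
    (hG : ∀ w, degIn G univ w = d w) (hs : IsSpread K G) (P : Finset (Fin n)) (q : Fin n) :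
    |∑ p ∈ P, 4 * (switchCount G p q : ℝ) - n * P.card| ≤ 2 * n * D + M + 4 * n ∧
    |∑ p ∈ P, 4 * (switchCount G q p : ℝ) - n * P.card| ≤ 2 * n * D + M + 4 * n := by
  have hg := abs_sum_gram_le hM hK hs P q
  have e1 : |∑ p ∈ P, (degExcess d q - degExcess d p)| ≤ 2 * n * D := by
    refine (Finset.abs_sum_le_sum_abs _ _).trans ?_
    have : ∀ p ∈ P, |degExcess d q - degExcess d p| ≤ 2 * D := fun p _ =>
      (abs_sub _ _).trans (by linarith [hD p, hD q])
    refine (Finset.sum_le_card_nsmul _ _ _ this).trans ?_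
    rw [nsmul_eq_mul]
    have hD0 : 0 ≤ D := (abs_nonneg _).trans (hD q)
    nlinarith [card_le_real P]
  have e2 : ∀ f : Fin n → ℝ, (∀ p, 0 ≤ f p ∧ f p ≤ 1) → 0 ≤ ∑ p ∈ P, f p ∧ ∑ p ∈ P, f p ≤ n := by
    intro f hf
    refine ⟨Finset.sum_nonneg fun p _ => (hf p).1, ?_⟩
    calc _ ≤ ∑ p ∈ P, (1 : ℝ) := Finset.sum_le_sum fun p _ => (hf p).2
      _ ≤ n := by simpa using card_le_real P
  have e3 := e2 (fun p => (adjInd G q p : ℝ)) fun p => adjInd_nonneg_le_one G q p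
  have e4 := e2 (fun p => (adjInd G p q : ℝ)) fun p => adjInd_nonneg_le_one G p q
  constructor
  · have : ∑ p ∈ P, 4 * (switchCount G p q : ℝ) - n * P.card =
        ∑ p ∈ P, (degExcess d q - degExcess d p) -
        ∑ p ∈ P, ∑ c, adjSign G p c * adjSign G q c - 4 * ∑ p ∈ P, (adjInd G q p : ℝ) := by
      simp only [four_mul_switchCount hG, Finset.sum_sub_distrib, Finset.sum_add_distrib,
        Finset.sum_const, nsmul_eq_mul, ← Finset.mul_sum]
      ring
    rw [this]
    rw [abs_le] at e1 hg ⊢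
    constructor <;> linarith
  · have : ∑ p ∈ P, 4 * (switchCount G q p : ℝ) - n * P.card =
        - ∑ p ∈ P, (degExcess d q - degExcess d p) -
        ∑ p ∈ P, ∑ c, adjSign G p c * adjSign G q c - 4 * ∑ p ∈ P, (adjInd G p q : ℝ) := by
      have hc : ∀ p c, adjSign G q c * adjSign G p c = adjSign G p c * adjSign G q c :=
        fun p c => mul_comm _ _
      simp only [four_mul_switchCount hG, Finset.sum_sub_distrib, Finset.sum_add_distrib,
        Finset.sum_const, nsmul_eq_mul, ← Finset.mul_sum, hc]
      ring
    rw [this]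
    rw [abs_le] at e1 hg ⊢
    constructor <;> linarith

lemma abs_sum_mul_le {n : ℕ} (Q : Finset (Fin n)) (f g : Fin n → ℝ) {A B : ℝ}
    (hf : ∀ q, |f q| ≤ A) (hg : ∀ q, |g q| ≤ B) : |∑ q ∈ Q, f q * g q| ≤ n * (A * B) := by
  refine (Finset.abs_sum_le_sum_abs _ _).trans ?_
  have : ∀ p ∈ Q, |f p * g p| ≤ A * B := fun p _ => by
    rw [abs_mul]
    exact mul_le_mul (hf p) (hg p) (abs_nonneg _) ((abs_nonneg _).trans (hf p))
  refine (Finset.sum_le_card_nsmul _ _ _ this).trans ?_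
  rw [nsmul_eq_mul]
  rcases Q.eq_empty_or_nonempty with rfl | ⟨q, -⟩
  · simp
    rcases Nat.eq_zero_or_pos n with rfl | hn
    · simp
    · have hA := (abs_nonneg _).trans (hf ⟨0, hn⟩)
      have hB := (abs_nonneg _).trans (hg ⟨0, hn⟩)
      positivity
  · have hA := (abs_nonneg _).trans (hf q)
    have hB := (abs_nonneg _).trans (hg q)
    exact mul_le_mul_of_nonneg_right (card_le_real Q) (by positivity)

lemma abs_weighted_switchCount_sub_le {n : ℕ} {K M D : ℝ} (hM : 0 ≤ M) (hK : n * K ≤ M ^ 2)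
    {d : Fin n → ℕ} {G : SimpleGraph (Fin n)} (hD : ∀ w, |degExcess d w| ≤ D)
    (hG : ∀ w, degIn G univ w = d w) (hs : IsSpread K G) (P Q : Finset (Fin n)) :
    |∑ p ∈ P, ∑ q ∈ Q, (degExcess d q - degExcess d p) * (4 * (switchCount G p q : ℝ)) -
      n * (P.card * ∑ q ∈ Q, degExcess d q - Q.card * ∑ p ∈ P, degExcess d p)| ≤
      2 * n * (D * (2 * n * D + M + 4 * n)) := by
  have h1 : ∑ p ∈ P, ∑ q ∈ Q, (degExcess d q - degExcess d p) * (4 * (switchCount G p q : ℝ)) -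
      n * (P.card * ∑ q ∈ Q, degExcess d q - Q.card * ∑ p ∈ P, degExcess d p) =
      ∑ q ∈ Q, degExcess d q * (∑ p ∈ P, 4 * (switchCount G p q : ℝ) - n * P.card) -
      ∑ p ∈ P, degExcess d p * (∑ q ∈ Q, 4 * (switchCount G p q : ℝ) - n * Q.card) := by
    simp only [sub_mul, mul_sub, Finset.sum_sub_distrib, ← Finset.sum_mul, ← Finset.mul_sum]
    rw [Finset.sum_comm]
    simp only [Finset.mul_sum]
    ring_nf
    simp only [Finset.mul_sum]
  rw [h1]
  refine (abs_sub _ _).trans ?_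
  have := abs_sum_mul_le Q (degExcess d)
      (fun q => ∑ p ∈ P, 4 * (switchCount G p q : ℝ) - n * P.card)
    hD fun q => (abs_sum_left_switchCount_le hM hK hD hG hs P q).1
  have := abs_sum_mul_le P (degExcess d)
      (fun q => ∑ p ∈ Q, 4 * (switchCount G q p : ℝ) - n * Q.card)
    hD fun q => (abs_sum_left_switchCount_le hM hK hD hG hs Q q).2
  linarith

lemma abs_sum_fiberGraphs_le {n : ℕ} {x : ℝ} (hx : 10000 ≤ x) (hn : (n : ℝ) = x ^ 200)
    (hlog : Real.log n ≤ x) {d : Fin n → ℕ} (heven : Even (∑ w, d w))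
    (hd : ∀ w, |degExcess d w| ≤ x ^ 101) (v : Fin n) (U : Finset (Fin n)) (t : ℕ)
    (f : SimpleGraph (Fin n) → ℝ) {M E : ℝ} (hM : ∀ G ∈ fiberGraphs d U v t, |f G| ≤ M * n ^ 10)
    (hE : ∀ G ∈ fiberGraphs d U v t, IsSpread (x ^ 412) G → |f G| ≤ E) (hM0 : 0 ≤ M) (hE0 : 0 ≤ E) :
    |∑ G ∈ fiberGraphs d U v t, f G| ≤ (E + M) * (fiberGraphs d U v t).card := by
  have hb := fiberGraphs_not_isSpread n x hx hn hlog d heven hd v U t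
  refine (Finset.abs_sum_le_sum_abs _ _).trans ?_
  have h1 : ∀ G ∈ fiberGraphs d U v t,
      |f G| ≤ E + M * n ^ 10 * (if ¬ IsSpread (x ^ 412) G then 1 else 0) := by
    intro G hG
    by_cases h : IsSpread (x ^ 412) G
    · simpa [h] using hE G hG h
    · simp only [h, not_false_eq_true, if_true]
      linarith [hM G hG]
  refine (Finset.sum_le_sum h1).trans ?_
  rw [Finset.sum_add_distrib, ← Finset.mul_sum, Finset.sum_boole, Finset.sum_const, nsmul_eq_mul]
  nlinarith

lemma degIn_union_of_disjoint {n : ℕ} (G : SimpleGraph (Fin n)) {A B : Finset (Fin n)}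
    (h : Disjoint A B) (v : Fin n) : degIn G (A ∪ B) v = degIn G A v + degIn G B v := by
  unfold degIn
  rw [Finset.filter_union, Finset.card_union_of_disjoint]
  exact Finset.disjoint_filter_filter h

lemma degIn_erase_self {n : ℕ} (G : SimpleGraph (Fin n)) (A : Finset (Fin n)) (v : Fin n) :
    degIn G (A.erase v) v = degIn G A v := by
  unfold degIn
  congr 1
  ext w
  simp only [mem_filter, mem_erase]
  constructor
  · tauto
  · rintro ⟨h1, h2⟩
    exact ⟨⟨h2.ne', h1⟩, h2⟩

lemma mem_fiberGraphs {n : ℕ} {d : Fin n → ℕ} {U : Finset (Fin n)} {v : Fin n} {t : ℕ}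
    {G : SimpleGraph (Fin n)} :
    G ∈ fiberGraphs d U v t ↔ (∀ w, degIn G univ w = d w) ∧ degIn G U v = t := by
  simp [fiberGraphs, degSeqGraphs]

lemma switchCount_le {n : ℕ} (G : SimpleGraph (Fin n)) (p q : Fin n) :
    (switchCount G p q : ℝ) ≤ n := card_le_real _

lemma abs_sum_degExcess_le {n : ℕ} {d : Fin n → ℕ} {D : ℝ} (hd : ∀ w, |degExcess d w| ≤ D)
    (A : Finset (Fin n)) : |∑ w ∈ A, degExcess d w| ≤ n * D := by
  have := abs_sum_mul_le A (degExcess d) (fun _ => (1 : ℝ)) hd (B := 1) (by simp)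
  simpa using this

lemma abs_sum_sum_le {n : ℕ} (P Q : Finset (Fin n)) (f : Fin n → Fin n → ℝ) {A : ℝ}
    (hf : ∀ p q, |f p q| ≤ A) : |∑ p ∈ P, ∑ q ∈ Q, f p q| ≤ n * (n * A) := by
  have h1 : ∀ p, |∑ q ∈ Q, f p q| ≤ n * A := by
    intro p
    have := abs_sum_mul_le Q (f p) (fun _ => (1 : ℝ)) (hf p) (B := 1) (by simp)
    simpa using this
  have := abs_sum_mul_le P (fun p => ∑ q ∈ Q, f p q) (fun _ => (1 : ℝ)) h1 (B := 1) (by simp)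
  simpa using this

/-- The average excess of the non-neighbours of `v` inside `U`. -/
lemma abs_sum_fiberGraphs_nonneighbours_le {n : ℕ} {x : ℝ} (hx : 10000 ≤ x)
    (hn : (n : ℝ) = x ^ 200)
    (hlog : Real.log n ≤ x) {d : Fin n → ℕ} (heven : Even (∑ w, d w))
    (hd : ∀ w, |degExcess d w| ≤ x ^ 101) {v : Fin n} {U : Finset (Fin n)} (hv : v ∉ U) (t : ℕ) :
    |∑ G ∈ fiberGraphs d U v t, ((U.card : ℝ) * ∑ q ∈ U.filter (fun q => ¬ G.Adj v q),
        degExcess d q -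
      (U.card - t) * ∑ q ∈ U, degExcess d q)| ≤ x ^ 408 * (fiberGraphs d U v t).card := by
  have hx0 : 0 < x := by linarith
  have hx1 : 1 ≤ x := by linarith
  have hn0 : (0 : ℝ) < n := by rw [hn]; positivity
  set X := fiberGraphs d U v t with hX
  set F : SimpleGraph (Fin n) → ℝ := fun G => ∑ p ∈ U.filter (fun p => G.Adj v p),
    ∑ q ∈ U.filter (fun q => ¬ G.Adj v q),
      (degExcess d q - degExcess d p) * (4 * (switchCount G p q : ℝ)) with hF
  set R : SimpleGraph (Fin n) → ℝ := fun G =>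
    (U.card : ℝ) * ∑ q ∈ U.filter (fun q => ¬ G.Adj v q), degExcess d q -
      (U.card - t) * ∑ q ∈ U, degExcess d q with hR
  have hz : ∑ G ∈ X, F G = 0 := by
    have h1 := sum_mul_card_switchings d U v t U U fun p q => 4 * (degExcess d q - degExcess d p)
    have h2 : ∑ p ∈ U, ∑ q ∈ U, 4 * (degExcess d q - degExcess d p) *
        ((switchings d U v t p q).card : ℝ) = 0 := by
      have h3 : ∑ p ∈ U, ∑ q ∈ U, 4 * (degExcess d q - degExcess d p) *
          ((switchings d U v t p q).card : ℝ) =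
              - ∑ p ∈ U, ∑ q ∈ U, 4 * (degExcess d q - degExcess d p) *
          ((switchings d U v t p q).card : ℝ) := by
        conv_lhs => rw [Finset.sum_comm]
        rw [← Finset.sum_neg_distrib]
        refine Finset.sum_congr rfl fun q hq => ?_
        rw [← Finset.sum_neg_distrib]
        refine Finset.sum_congr rfl fun p hp => ?_
        rw [card_switchings_eq d U v t t p q (fun e => hv (e ▸ hp)) (fun e => hv (e ▸ hq))
          (by simp [hp, hq])]
        ring
      linarith
    rw [h2] at h1
    rw [h1]
    refine Finset.sum_congr rfl fun G _ => Finset.sum_congr rfl fun p _ =>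
      Finset.sum_congr rfl fun q _ => by ring
  have hdec : ∀ G ∈ X, F G - n * R G = F G - n * (((U.filter fun p => G.Adj v p).card : ℝ) *
      ∑ q ∈ U.filter (fun q => ¬ G.Adj v q), degExcess d q -
      ((U.filter fun p => ¬ G.Adj v p).card : ℝ) *
      ∑ q ∈ U.filter (fun q => G.Adj v q), degExcess d q) := by
    intro G hG
    have hc : (U.filter fun p => G.Adj v p).card = t := (mem_fiberGraphs.1 hG).2
    have hc2 := Finset.card_filter_add_card_filter_not (s := U) (fun p => G.Adj v p)
    rw [hc] at hc2
    have hc3 : ((U.filter fun p => ¬ G.Adj v p).card : ℝ) = U.card - t := by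
      rw [← hc2]; push_cast; ring
    have hs := Finset.sum_filter_add_sum_filter_not U (fun p => G.Adj v p) (degExcess d)
    simp only [hR]
    rw [hc3, hc, ← hs]
    ring
  have hmain := abs_sum_fiberGraphs_le hx hn hlog heven hd v U t (fun G => F G - n * R G)
    (M := x ^ 200) (E := 20 * x ^ 607) ?_ ?_ (by positivity) (by positivity)
  · rw [Finset.sum_sub_distrib, hz, zero_sub, abs_neg, ← Finset.mul_sum, abs_mul,
      abs_of_pos hn0] at hmain
    have : x ^ 200 * |∑ G ∈ X, R G| ≤ x ^ 200 * (x ^ 408 * X.card) := by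
      rw [← hn]
      refine hmain.trans ?_
      rw [hn, ← mul_assoc]
      refine mul_le_mul_of_nonneg_right ?_ (by positivity)
      have k1 : x ^ 200 ≤ x ^ 607 := pow_le_pow_right₀ hx1 (by norm_num)
      have k2 : x ^ 200 * x ^ 408 = x ^ 607 * x := by ring
      rw [k2]
      nlinarith [pow_pos hx0 607]
    exact le_of_mul_le_mul_left this (by positivity)
  · intro G hG
    rw [hdec G hG]
    refine (abs_sub _ _).trans ?_
    have h1 : |F G| ≤ n * (n * (2 * x ^ 101 * (4 * n))) := by
      refine abs_sum_sum_le _ _ _ fun p q => ?_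
      rw [abs_mul]
      refine mul_le_mul ((abs_sub _ _).trans (by linarith [hd p, hd q])) ?_ (abs_nonneg _)
        (by positivity)
      rw [abs_of_nonneg (by positivity)]
      linarith [switchCount_le G p q]
    have h2 : ∀ A B : Finset (Fin n), |(A.card : ℝ) * ∑ q ∈ B, degExcess d q| ≤
        n * (n * x ^ 101) := by
      intro A B
      rw [abs_mul, abs_of_nonneg (by positivity)]
      exact mul_le_mul (card_le_real A) (abs_sum_degExcess_le hd B) (abs_nonneg _) hn0.le
    rw [abs_mul, abs_of_pos hn0]
    have h3 := (abs_sub ((#(U.filter fun p => G.Adj v p) : ℝ) *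
      ∑ q ∈ U.filter (fun q => ¬ G.Adj v q), degExcess d q)
      ((#(U.filter fun p => ¬ G.Adj v p) : ℝ) *
      ∑ q ∈ U.filter (fun q => G.Adj v q), degExcess d q)).trans (add_le_add (h2 _ _) (h2 _ _))
    have h4 := mul_le_mul_of_nonneg_left h3 hn0.le
    refine (add_le_add h1 h4).trans ?_
    rw [hn]
    have k2 : x ^ 200 * (x ^ 200) ^ 10 = x ^ 702 * x ^ 1498 := by ring
    have k3 : (1 : ℝ) ≤ x ^ 1498 := one_le_pow₀ hx1
    have k4 : x ^ 702 = x ^ 701 * x := by ring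
    have k5 : x ^ 200 * (x ^ 200 * (2 * x ^ 101 * (4 * x ^ 200))) +
      x ^ 200 * (x ^ 200 * (x ^ 200 * x ^ 101) + x ^ 200 * (x ^ 200 * x ^ 101)) =
          10 * x ^ 701 := by ring
    rw [k5, k2]
    have k6 : 10 * x ^ 701 ≤ x ^ 702 := by rw [k4]; nlinarith [pow_pos hx0 701]
    nlinarith [pow_pos hx0 702]
  · intro G hG hs
    rw [hdec G hG]
    have := abs_weighted_switchCount_sub_le (M := x ^ 306) (by positivity)
        (by rw [hn]; ring_nf; rfl) hd
      (mem_fiberGraphs.1 hG).1 hs (U.filter fun p => G.Adj v p) (U.filter fun p => ¬ G.Adj v p)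
    refine this.trans ?_
    rw [hn]
    have k1 : x ^ 502 ≤ x ^ 607 := pow_le_pow_right₀ hx1 (by norm_num)
    have k2 : x ^ 602 ≤ x ^ 607 := pow_le_pow_right₀ hx1 (by norm_num)
    have k3 : x ^ 501 ≤ x ^ 607 := pow_le_pow_right₀ hx1 (by norm_num)
    have k4 : 2 * x ^ 200 * (x ^ 101 * (2 * x ^ 200 * x ^ 101 + x ^ 306 + 4 * x ^ 200)) =
      4 * x ^ 602 + 2 * x ^ 607 + 8 * x ^ 501 := by ring
    rw [k4]
    have k5 := pow_pos hx0 607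
    linarith

lemma fiberGraphs_compl {n : ℕ} {d : Fin n → ℕ} {v : Fin n} {A B : Finset (Fin n)}
    (hdis : Disjoint A B) (hAB : A ∪ B = univ.erase v) {t s : ℕ} (hts : t + s = d v) :
    fiberGraphs d A v t = fiberGraphs d B v s := by
  ext G
  rw [mem_fiberGraphs, mem_fiberGraphs]
  refine and_congr_right fun hG => ?_
  have h1 := degIn_union_of_disjoint G hdis v
  rw [hAB, degIn_erase_self, hG v] at h1
  omega

lemma balance_error_le {x N : ℝ} (hx : 10000 ≤ x) (hN : 0 ≤ N) :
    2 * x * (x ^ 408 * N) + 2 * x * (x ^ 408 * N) + (10 * x ^ 412 + x ^ 200) * N ≤ x ^ 413 * N := by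
  have hx0 : 0 < x := by linarith
  have hx1 : 1 ≤ x := by linarith
  have k0 : 2 * x * (x ^ 408 * N) + 2 * x * (x ^ 408 * N) + (10 * x ^ 412 + x ^ 200) * N =
    (4 * x ^ 409 + 10 * x ^ 412 + x ^ 200) * N := by ring
  rw [k0]
  refine mul_le_mul_of_nonneg_right ?_ hN
  have k1 : x ^ 409 ≤ x ^ 412 := pow_le_pow_right₀ hx1 (by norm_num)
  have k2 : x ^ 200 ≤ x ^ 412 := pow_le_pow_right₀ hx1 (by norm_num)
  have k3 : x ^ 413 = x ^ 412 * x := by ring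
  rw [k3]
  nlinarith [pow_pos hx0 412]

lemma abs_sum_fiberGraphs_switchCount_sub_le {n : ℕ} {x : ℝ} (hx : 10000 ≤ x)
    (hn : (n : ℝ) = x ^ 200)
    (hlog : Real.log n ≤ x) {d : Fin n → ℕ} (heven : Even (∑ w, d w))
    (hd : ∀ w, |degExcess d w| ≤ x ^ 101) {v : Fin n} {A B : Finset (Fin n)}
    (hdis : Disjoint A B) (hAB : A ∪ B = univ.erase v) (hA : (n : ℝ) ≤ 2 * x * A.card)
    (hB : (n : ℝ) ≤ 2 * x * B.card) {t s : ℕ} (hts : t + s = d v) :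
    |∑ G ∈ fiberGraphs d A v t, ∑ p ∈ B.filter (fun p => G.Adj v p),
        ∑ q ∈ A.filter (fun q => ¬ G.Adj v q), 4 * (switchCount G p q : ℝ) -
      s * (A.card - t) * (n + (∑ w ∈ A, degExcess d w) / A.card -
        (∑ w ∈ B, degExcess d w) / B.card) * (fiberGraphs d A v t).card| ≤
      x ^ 413 * (fiberGraphs d A v t).card := by
  have hx0 : 0 < x := by linarith
  have hx1 : 1 ≤ x := by linarith
  have hn0 : (0 : ℝ) < n := by rw [hn]; positivity
  have hvA : v ∉ A := fun h => by
    have : v ∈ univ.erase v := hAB ▸ mem_union_left B h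
    simp at this
  have hvB : v ∉ B := fun h => by
    have : v ∈ univ.erase v := hAB ▸ mem_union_right A h
    simp at this
  have ha0 : (0 : ℝ) < A.card := by
    by_contra h
    nlinarith
  have hb0 : (0 : ℝ) < B.card := by
    by_contra h
    nlinarith
  have hXX := fiberGraphs_compl hdis hAB hts
  have hr1 := abs_sum_fiberGraphs_nonneighbours_le hx hn hlog heven hd hvA t
  have hr2 := abs_sum_fiberGraphs_nonneighbours_le hx hn hlog heven hd hvB s
  rw [← hXX] at hr2
  rcases (fiberGraphs d A v t).eq_empty_or_nonempty with hemp | ⟨G₀, hG₀⟩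
  · simp [hemp]
  have hcA : ∀ G ∈ fiberGraphs d A v t, ((A.filter fun q => ¬ G.Adj v q).card : ℝ) =
      A.card - t := by
    intro G hG
    have hc2 := Finset.card_filter_add_card_filter_not (s := A) (fun p => G.Adj v p)
    have hc : (A.filter fun p => G.Adj v p).card = t := (mem_fiberGraphs.1 hG).2
    rw [hc] at hc2
    rw [← hc2]; push_cast; ring
  have hcB : ∀ G ∈ fiberGraphs d A v t, ((B.filter fun q => G.Adj v q).card : ℝ) = s := by
    intro G hG
    rw [hXX] at hG
    exact_mod_cast (mem_fiberGraphs.1 hG).2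
  have hat : (A.card : ℝ) - t ≤ n ∧ 0 ≤ (A.card : ℝ) - t := by
    rw [← hcA G₀ hG₀]; exact ⟨card_le_real _, by positivity⟩
  have hsn : (s : ℝ) ≤ n := by
    rw [← hcB G₀ hG₀]; exact card_le_real _
  set X := fiberGraphs d A v t with hX
  set W : SimpleGraph (Fin n) → ℝ := fun G => ∑ p ∈ B.filter (fun p => G.Adj v p),
        ∑ q ∈ A.filter (fun q => ¬ G.Adj v q), 4 * (switchCount G p q : ℝ) with hW
  set e : SimpleGraph (Fin n) → ℝ := fun G => W G - (n * (B.filter fun q => G.Adj v q).card *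
    (A.filter fun q => ¬ G.Adj v q).card + (B.filter fun q => G.Adj v q).card *
      ∑ q ∈ A.filter (fun q => ¬ G.Adj v q), degExcess d q -
    (A.filter fun q => ¬ G.Adj v q).card * ∑ p ∈ B.filter (fun q => G.Adj v q),
        degExcess d p) with he
  have hmain := abs_sum_fiberGraphs_le hx hn hlog heven hd v A t e
    (M := x ^ 200) (E := 10 * x ^ 412) ?_ ?_ (by positivity) (by positivity)
  rotate_left
  · intro G hG
    refine (abs_sub _ _).trans ?_
    have h1 : |W G| ≤ n * (n * (4 * n)) := by
      refine abs_sum_sum_le _ _ _ fun p q => ?_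
      rw [abs_of_nonneg (by positivity)]
      linarith [switchCount_le G p q]
    have h2 : ∀ A B : Finset (Fin n), |(A.card : ℝ) * ∑ q ∈ B, degExcess d q| ≤
        n * (n * x ^ 101) := by
      intro A B
      rw [abs_mul, abs_of_nonneg (by positivity)]
      exact mul_le_mul (card_le_real A) (abs_sum_degExcess_le hd B) (abs_nonneg _) hn0.le
    have h3 := h2 (B.filter fun q => G.Adj v q) (A.filter fun q => ¬ G.Adj v q)
    have h4 := h2 (A.filter fun q => ¬ G.Adj v q) (B.filter fun q => G.Adj v q)
    have h5 : |(n : ℝ) * (B.filter fun q => G.Adj v q).card *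
      (A.filter fun q => ¬ G.Adj v q).card| ≤ n * n * n := by
      rw [abs_of_nonneg (by positivity)]
      exact mul_le_mul (mul_le_mul_of_nonneg_left (card_le_real _) hn0.le) (card_le_real _)
        (by positivity) (by positivity)
    refine (add_le_add h1 ((abs_sub _ _).trans (add_le_add ((abs_add_le _ _).trans
      (add_le_add h5 h3)) h4))).trans ?_
    rw [hn]
    have k2 : x ^ 200 * (x ^ 200) ^ 10 = x ^ 702 * x ^ 1498 := by ring
    have k3 : (1 : ℝ) ≤ x ^ 1498 := one_le_pow₀ hx1
    have k4 : x ^ 702 = x ^ 701 * x := by ring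
    have k5 : x ^ 200 * (x ^ 200 * (4 * x ^ 200)) + (x ^ 200 * x ^ 200 * x ^ 200 +
      x ^ 200 * (x ^ 200 * x ^ 101) + x ^ 200 * (x ^ 200 * x ^ 101)) =
          5 * x ^ 600 + 2 * x ^ 501 := by ring
    rw [k5, k2]
    have k6 : 10 * x ^ 701 ≤ x ^ 702 := by rw [k4]; nlinarith [pow_pos hx0 701]
    have k7 : x ^ 600 ≤ x ^ 701 := pow_le_pow_right₀ hx1 (by norm_num)
    have k8 : x ^ 501 ≤ x ^ 701 := pow_le_pow_right₀ hx1 (by norm_num)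
    nlinarith [pow_pos hx0 702, pow_pos hx0 701]
  · intro G hG hs
    refine (abs_sum_switchCount_sub_le (mem_fiberGraphs.1 hG).1 hs _ _).trans ?_
    rw [hn]
    have k1 : (x ^ 200) ^ 2 ≤ x ^ 412 := by
      rw [← pow_mul]; exact pow_le_pow_right₀ hx1 (by norm_num)
    linarith [pow_pos hx0 412]
  set r1 : SimpleGraph (Fin n) → ℝ := fun G =>
    (A.card : ℝ) * ∑ q ∈ A.filter (fun q => ¬ G.Adj v q), degExcess d q -
      (A.card - t) * ∑ q ∈ A, degExcess d q with hr1d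
  set r2 : SimpleGraph (Fin n) → ℝ := fun G =>
    (B.card : ℝ) * ∑ q ∈ B.filter (fun q => ¬ G.Adj v q), degExcess d q -
      (B.card - s) * ∑ q ∈ B, degExcess d q with hr2d
  have hdec : ∀ G ∈ X, W G = s * (A.card - t) * (n + (∑ w ∈ A, degExcess d w) / A.card -
        (∑ w ∈ B, degExcess d w) / B.card) + s / A.card * r1 G + (A.card - t) / B.card * r2 G +
            e G := by
    intro G hG
    simp only [he, hr1d, hr2d]
    rw [hcA G hG, hcB G hG]
    have hs := Finset.sum_filter_add_sum_filter_not B (fun p => G.Adj v p) (degExcess d)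
    rw [← eq_sub_iff_add_eq] at hs
    rw [hs]
    field_simp
    ring
  rw [Finset.sum_congr rfl hdec]
  simp only [Finset.sum_add_distrib, ← Finset.mul_sum, Finset.sum_const, nsmul_eq_mul]
  have hX0 : (0 : ℝ) ≤ X.card := by positivity
  have q1 : |(s : ℝ) / A.card * ∑ G ∈ X, r1 G| ≤ 2 * x * (x ^ 408 * X.card) := by
    rw [abs_mul, abs_of_nonneg (by positivity)]
    refine mul_le_mul ?_ hr1 (abs_nonneg _) (by positivity)
    rw [div_le_iff₀ ha0]; linarith
  have q2 : |((A.card : ℝ) - t) / B.card * ∑ G ∈ X, r2 G| ≤ 2 * x * (x ^ 408 * X.card) := by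
    rw [abs_mul, abs_of_nonneg (div_nonneg hat.2 hb0.le)]
    refine mul_le_mul ?_ hr2 (abs_nonneg _) (by positivity)
    rw [div_le_iff₀ hb0]; linarith
  have q3 : 2 * x * (x ^ 408 * X.card) + 2 * x * (x ^ 408 * X.card) + (10 * x ^ 412 + x ^ 200) *
      X.card ≤
      x ^ 413 * X.card :=
    balance_error_le hx hX0
  refine le_trans ?_ q3
  rw [abs_le] at q1 q2 hmain ⊢
  constructor <;> linarith [q1.1, q1.2, q2.1, q2.2, hmain.1, hmain.2]

/-- Approximate detailed balance between consecutive fibers. -/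
lemma abs_card_fiberGraphs_balance_le {n : ℕ} {x : ℝ} (hx : 10000 ≤ x)
    (hn : (n : ℝ) = x ^ 200)
    (hlog : Real.log n ≤ x) {d : Fin n → ℕ} (heven : Even (∑ w, d w))
    (hd : ∀ w, |degExcess d w| ≤ x ^ 101) {v : Fin n} {A B : Finset (Fin n)}
    (hdis : Disjoint A B) (hAB : A ∪ B = univ.erase v) (hA : (n : ℝ) ≤ 2 * x * A.card)
    (hB : (n : ℝ) ≤ 2 * x * B.card) {t s : ℕ} (hts : t + (s + 1) = d v) {r : ℝ}
    (hr : r = (∑ w ∈ A, degExcess d w) / A.card - (∑ w ∈ B, degExcess d w) / B.card) :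
    |((fiberGraphs d A v t).card : ℝ) * ((s + 1) * (A.card - t) * (n + r)) -
      (fiberGraphs d A v (t + 1)).card * ((t + 1) * (B.card - s) * (n - r))| ≤
      x ^ 413 * ((fiberGraphs d A v t).card + (fiberGraphs d A v (t + 1)).card) := by
  have hvA : ∀ p ∈ A, p ≠ v := fun p hp h => by
    have : p ∈ univ.erase v := hAB ▸ mem_union_left B hp
    simp [h] at this
  have hvB : ∀ p ∈ B, p ≠ v := fun p hp h => by
    have : p ∈ univ.erase v := hAB ▸ mem_union_right A hp
    simp [h] at this
  have h1 := abs_sum_fiberGraphs_switchCount_sub_le hx hn hlog heven hd hdis hAB hA hB hts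
  have h2 := abs_sum_fiberGraphs_switchCount_sub_le hx hn hlog heven hd hdis.symm
    ((union_comm _ _).trans hAB) hB hA (show s + (t + 1) = d v by omega)
  have hXX : fiberGraphs d A v (t + 1) = fiberGraphs d B v s :=
    fiberGraphs_compl hdis hAB (by omega)
  have h3 := sum_mul_card_switchings d A v t B A fun _ _ => 4
  have h4 := sum_mul_card_switchings d A v (t + 1) A B fun _ _ => 4
  have h5 : ∑ p ∈ B, ∑ q ∈ A, 4 * ((switchings d A v t p q).card : ℝ) =
      ∑ p ∈ A, ∑ q ∈ B, 4 * ((switchings d A v (t + 1) p q).card : ℝ) := by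
    rw [Finset.sum_comm]
    refine Finset.sum_congr rfl fun q hq => Finset.sum_congr rfl fun p hp => ?_
    have hpA : p ∉ A := fun h => Finset.disjoint_left.1 hdis h hp
    rw [card_switchings_eq d A v t (t + 1) p q (hvB p hp) (hvA q hq) (by simp [hq, hpA])]
  rw [← hXX, ← h4, ← h5, h3] at h2
  push_cast at h1 h2
  rw [abs_le] at h1 h2 ⊢
  subst hr
  constructor <;> linarith [h1.1, h1.2, h2.1, h2.2]

/-- A sub-probability sequence that nearly satisfies the detailed balance relation of a tilted
hypergeometric distribution. -/
def IsNearBalanced (n x a b r : ℝ) (D : ℕ) (p : ℕ → ℝ) : Prop :=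
  (∀ t ≤ D, 0 ≤ p t ∧ p t ≤ 1) ∧ ∀ t < D,
    |p t * (((D : ℝ) - t) * (a - t) * (n + r)) - p (t + 1) *
        ((t + 1) * (b - D + t + 1) * (n - r))| ≤
      x ^ 413 * (p t + p (t + 1))

lemma IsNearBalanced.reflect {n x a b r : ℝ} {D : ℕ} {p : ℕ → ℝ}
    (h : IsNearBalanced n x a b r D p) :
    IsNearBalanced n x b a (-r) D fun t => p (D - t) := by
  refine ⟨fun t _ => h.1 (D - t) (by omega), fun t ht => ?_⟩
  have h1 := h.2 (D - (t + 1)) (by omega)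
  have e1 : D - (t + 1) + 1 = D - t := by omega
  have e2 : ((D - (t + 1) : ℕ) : ℝ) = D - t - 1 := by
    rw [Nat.cast_sub (by omega)]; push_cast; ring
  rw [e1, e2, abs_sub_comm] at h1
  convert h1 using 2 <;> ring_nf

lemma add_le_exp_mul_of_gap {n u w e α β γ : ℝ} (hn : 0 < n) (hu0 : 0 ≤ u) (hun : u ≤ n)
    (hwu : 98 / 100 * u ≤ w) (he0 : 0 < e) (he : 100 * e ≤ n ^ 2 * u) (hα : 0 ≤ α) (hγ : γ ≤ α)
    (hα' : α ≤ n ^ 3 / 12) (hβ : α + w * n ^ 2 / 5 ≤ β) :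
    0 < β - e ∧ γ + e ≤ Real.exp (-(u / (8 * n))) * (β - e) := by
  have h1 : 0 ≤ u / (8 * n) := by positivity
  have hexp : Real.exp (u / (8 * n)) ≤ 1 + u / (4 * n) := by
    have h2 : u / (8 * n) ≤ 1 := by rw [div_le_one (by linarith)]; linarith
    have h3 := Real.abs_exp_sub_one_sub_id_le (x := u / (8 * n)) (by rwa [abs_of_nonneg h1])
    have h4 : u / (4 * n) = 2 * (u / (8 * n)) := by field_simp; ring
    rw [h4]
    rw [abs_le] at h3
    have h5 : (u / (8 * n)) ^ 2 ≤ u / (8 * n) := by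
      rw [sq]; exact mul_le_of_le_one_left h1 h2
    linarith [h3.2]
  have hn2 : 0 < n ^ 2 := by positivity
  have q5 : 98 / 100 * (n ^ 2 * u) ≤ w * n ^ 2 := by
    have := mul_le_mul_of_nonneg_right hwu hn2.le
    linarith
  refine ⟨by linarith, ?_⟩
  have hn3 : n ^ 2 * u ≤ n ^ 3 := by
    have := mul_le_mul_of_nonneg_left hun hn2.le
    linarith [show n ^ 2 * n = n ^ 3 by ring]
  rw [Real.exp_neg, ← div_eq_inv_mul, le_div_iff₀ (Real.exp_pos _)]
  have h6 : 0 ≤ u / (4 * n) := by positivity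
  calc _ ≤ (α + e) * Real.exp (u / (8 * n)) :=
        mul_le_mul_of_nonneg_right (by linarith) (Real.exp_pos _).le
    _ ≤ (α + e) * (1 + u / (4 * n)) := mul_le_mul_of_nonneg_left hexp (by linarith)
    _ = α + e + (α + e) * (u / (4 * n)) := by ring
    _ ≤ α + e + (n ^ 3 / 10) * (u / (4 * n)) := by
        have : (α + e) * (u / (4 * n)) ≤ (n ^ 3 / 10) * (u / (4 * n)) :=
          mul_le_mul_of_nonneg_right (by linarith) h6
        linarith
    _ = α + e + n ^ 2 * u / 40 := by field_simp; ring
    _ ≤ _ := by linarith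

lemma exists_rate_gap {n y A B w f g r β : ℝ} (hn : 0 < n) (hy0 : 0 < y) (hyn : 100 * y ≤ n)
    (hyw : y ≤ w) (hA : 0 ≤ A) (hB : 0 ≤ B) (hAB : A + B = n / 2) (hf0 : 0 < f) (hf : f ≤ B - w)
    (hg : g ≤ A - w) (hr1 : -y ≤ r) (hr2 : r ≤ y) (hβ : (A + w) * (B + w) * (n - y) ≤ β) :
    ∃ α, 0 ≤ α ∧ f * g * (n + r) ≤ α ∧ α ≤ n ^ 3 / 12 ∧ α + w * n ^ 2 / 5 ≤ β := by
  have hw0 : 0 < w := by linarith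
  have hwn : 0 < w * n ^ 2 := by positivity
  rcases le_or_gt g 0 with hg0 | hg0
  · refine ⟨0, le_rfl, ?_, by positivity, ?_⟩
    · apply mul_nonpos_of_nonpos_of_nonneg
      · exact mul_nonpos_of_nonneg_of_nonpos hf0.le hg0
      · linarith
    · have h1 : w * n / 2 ≤ (A + w) * (B + w) := by
        have e : (A + w) * (B + w) = A * B + w * (A + B) + w ^ 2 := by ring
        rw [e, hAB]
        have := mul_nonneg hA hB
        have := sq_nonneg w
        linarith
      have h2 : w * n / 2 * (n * (99 / 100)) ≤ (A + w) * (B + w) * (n - y) :=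
        mul_le_mul h1 (by linarith) (by positivity) (by positivity)
      have h3 : w * n / 2 * (n * (99 / 100)) = 99 / 200 * (w * n ^ 2) := by ring
      linarith
  · have hwA : 0 < A - w := by linarith
    have hwB : 0 < B - w := by linarith
    have c3 : f * g ≤ (B - w) * (A - w) := mul_le_mul hf hg hg0.le hwB.le
    have c4 : A * B ≤ n ^ 2 / 16 := by
      have h1 : n ^ 2 / 4 = (A + B) ^ 2 := by rw [hAB]; ring
      have := sq_nonneg (A - B)
      linarith [show (A + B) ^ 2 = (A - B) ^ 2 + 4 * (A * B) by ring]
    have c5 : w ^ 2 ≤ A * B := by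
      rw [sq]; exact mul_le_mul (by linarith) (by linarith) hw0.le hA
    have c6 : (B - w) * (A - w) ≤ A * B := by
      rw [mul_comm A B]; exact mul_le_mul (by linarith) (by linarith) hwA.le hB
    refine ⟨(B - w) * (A - w) * (n + y), by positivity, ?_, ?_, ?_⟩
    · exact mul_le_mul c3 (by linarith) (by linarith) (by positivity)
    · calc _ ≤ n ^ 2 / 16 * (n * (101 / 100)) := by
            apply mul_le_mul (c6.trans c4) (by linarith) (by linarith) (by positivity)
        _ = 101 / 1600 * n ^ 3 := by ring
        _ ≤ _ := by linarith [pow_pos hn 3]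
    · refine le_trans ?_ hβ
      have h2 : (A + w) * (B + w) * (n - y) - (B - w) * (A - w) * (n + y) =
          w * (2 * (A + B)) * n - y * (2 * (A * B) + 2 * w ^ 2) := by ring
      have h3 : y * (2 * (A * B) + 2 * w ^ 2) ≤ y * (n ^ 2 / 4) := by
        apply mul_le_mul_of_nonneg_left _ hy0.le; linarith
      rw [hAB, show w * (2 * (n / 2)) * n = w * n ^ 2 by ring] at h2
      have h4 : y * n ^ 2 ≤ w * n ^ 2 := mul_le_mul_of_nonneg_right hyw (sq_nonneg n)
      linarith

lemma balance_rates {x n h D t a b r u : ℝ} (hx : 10000 ≤ x) (hn : n = x ^ 200)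
    (hD : |2 * D - (n - 1)| ≤ x ^ 101) (ha : |a - h| ≤ x ^ 102) (hb : |b - (n - h)| ≤ x ^ 102)
    (hr : |r| ≤ x ^ 102) (h0 : 0 ≤ h) (hhn : h ≤ n) (ht0 : 0 ≤ t) (htD : t < D) (hu : u = t - h / 2)
    (hu1 : x ^ 120 / 2 ≤ u) :
    0 < (t + 1) * (b - D + t + 1) * (n - r) - x ^ 413 ∧
    ((D - t) * (a - t) * (n + r) + x ^ 413) ≤
      Real.exp (-(u / (8 * n))) * ((t + 1) * (b - D + t + 1) * (n - r) - x ^ 413) := by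
  have hx0 : 0 < x := by linarith
  have hx1 : 1 ≤ x := by linarith
  set y := x ^ 102 with hy
  have hy0 : 0 < y := by positivity
  have hn0 : 0 < n := by rw [hn]; positivity
  have hxy : x ^ 101 ≤ y := pow_le_pow_right₀ hx1 (by norm_num)
  have hy1 : 1 ≤ y := one_le_pow₀ hx1
  have hyu : 100 * y ≤ x ^ 120 / 2 := by
    have : x ^ 120 = y * x ^ 18 := by rw [hy]; ring
    have h2 : x ^ 1 ≤ x ^ 18 := pow_le_pow_right₀ hx1 (by norm_num)
    rw [this]; nlinarith
  have hyn : 100 * y ≤ n := by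
    have : n = y * x ^ 98 := by rw [hn, hy]; ring
    have h2 : x ^ 1 ≤ x ^ 98 := pow_le_pow_right₀ hx1 (by norm_num)
    rw [this]; nlinarith
  have he : 100 * x ^ 413 ≤ n ^ 2 * u := by
    have : n ^ 2 * (x ^ 120 / 2) = x ^ 413 * x ^ 107 / 2 := by rw [hn]; ring
    have h2 : x ^ 1 ≤ x ^ 107 := pow_le_pow_right₀ hx1 (by norm_num)
    have h3 : n ^ 2 * (x ^ 120 / 2) ≤ n ^ 2 * u := mul_le_mul_of_nonneg_left hu1 (by positivity)
    have h4 := pow_pos hx0 413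
    nlinarith
  have he0 : 0 < x ^ 413 := by positivity
  set e := x ^ 413 with hed
  clear_value e y
  rw [abs_le] at hD ha hb hr
  set w := u - 2 * y with hw
  have hw0 : 0 < w := by linarith
  have hwu : 98 / 100 * u ≤ w := by linarith
  set A := h / 2 with hA
  set B := (n - h) / 2 with hB
  have hA0 : 0 ≤ A := by linarith
  have hB0 : 0 ≤ B := by linarith
  have hAB : A + B = n / 2 := by rw [hA, hB]; ring
  have hun : u ≤ n := by linarith
  have k1 : (A + w) * (B + w) ≤ (t + 1) * (b - D + t + 1) := by
    apply mul_le_mul <;> linarith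
  have k2 : (A + w) * (B + w) * (n - y) ≤ (t + 1) * (b - D + t + 1) * (n - r) := by
    apply mul_le_mul k1 (by linarith) (by linarith)
    exact le_trans (by positivity) k1
  obtain ⟨α, q1, q2, q3, q4⟩ := exists_rate_gap hn0 hy0 hyn (by linarith) hA0 hB0 hAB
    (sub_pos.2 htD) (by linarith) (show a - t ≤ A - w by linarith) hr.1 hr.2 k2
  exact add_le_exp_mul_of_gap hn0 (by linarith) hun hwu he0 he q1 q2 q3 q4

lemma IsNearBalanced.upper_tail {x n h a b r : ℝ} {D : ℕ} {p : ℕ → ℝ}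
    (hp : IsNearBalanced n x a b r D p) (hx : 10000 ≤ x) (hn : n = x ^ 200)
    (hD : |2 * (D : ℝ) - (n - 1)| ≤ x ^ 101) (ha : |a - h| ≤ x ^ 102) (hb : |b - (n - h)| ≤ x ^ 102)
    (hr : |r| ≤ x ^ 102) (h0 : 0 ≤ h) (hhn : h ≤ n) {t : ℕ} (htD : t ≤ D)
    (ht : 9 / 10 * x ^ 120 ≤ (t : ℝ) - h / 2) :
    p t ≤ Real.exp (-((t : ℝ) - h / 2) ^ 2 / (32 * n)) := by
  have hx0 : 0 < x := by linarith
  have hx1 : 1 ≤ x := by linarith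
  have hn0 : 0 < n := by rw [hn]; positivity
  set z := x ^ 120 with hz
  have hz1 : 1000 ≤ z := by
    have : x ^ 1 ≤ z := pow_le_pow_right₀ hx1 (by norm_num)
    linarith
  set t0 : ℕ := ⌈h / 2 + z / 2⌉₊ with ht0
  have ht0' : h / 2 + z / 2 ≤ t0 := Nat.le_ceil _
  have ht0'' : (t0 : ℝ) < h / 2 + z / 2 + 1 := Nat.ceil_lt_add_one (by positivity)
  have htt : t0 ≤ t := by
    rw [ht0, Nat.ceil_le]; linarith
  have key : ∀ s, t0 ≤ s → s ≤ D → p s ≤ Real.exp (-((((s : ℝ) - h / 2) ^ 2 - (t0 - h / 2) ^ 2 -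
      (s - t0)) / (16 * n))) := by
    intro s hs
    induction s, hs using Nat.le_induction with
    | base => intro h1; simpa using (hp.1 t0 h1).2
    | succ s hs ih =>
      intro hsD
      have h1 := ih (by omega)
      have h2 := hp.2 s (by omega)
      have hsc : (t0 : ℝ) ≤ s := by exact_mod_cast hs
      obtain ⟨h3, h4⟩ := balance_rates (t := s) (u := s - h / 2) hx hn hD ha hb hr h0 hhn
        (by positivity) (by exact_mod_cast (show s < D by omega)) rfl (by linarith)
      have h5 := hp.1 s (by omega)
      rw [abs_le] at h2
      have h6 : p (s + 1) ≤ p s * Real.exp (-(((s : ℝ) - h / 2) / (8 * n))) := by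
        refine le_of_mul_le_mul_right ?_ h3
        rw [mul_assoc (p s)]
        refine le_trans ?_ (mul_le_mul_of_nonneg_left h4 h5.1)
        linarith
      refine h6.trans ((mul_le_mul_of_nonneg_right h1 (Real.exp_pos _).le).trans ?_)
      rw [← Real.exp_add]
      apply le_of_eq
      congr 1
      push_cast
      field_simp
      ring
  refine (key t htt htD).trans (Real.exp_le_exp.2 ?_)
  rw [neg_div, neg_le_neg_iff, div_le_div_iff₀ (by positivity) (by positivity)]
  set u := (t : ℝ) - h / 2 with hu
  have h1 : ((t0 : ℝ) - h / 2) ^ 2 ≤ (z / 2 + 1) ^ 2 := by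
    apply pow_le_pow_left₀ <;> linarith
  have h2 : (t : ℝ) - t0 ≤ u := by
    have : (0 : ℝ) ≤ z := by linarith
    linarith
  have h3 : u ^ 2 / 2 ≤ u ^ 2 - (t0 - h / 2) ^ 2 - (t - t0) := by nlinarith
  nlinarith

lemma IsNearBalanced.tail {x n h a b r : ℝ} {D : ℕ} {p : ℕ → ℝ}
    (hp : IsNearBalanced n x a b r D p) (hx : 10000 ≤ x) (hn : n = x ^ 200)
    (hD : |2 * (D : ℝ) - (n - 1)| ≤ x ^ 101) (ha : |a - h| ≤ x ^ 102) (hb : |b - (n - h)| ≤ x ^ 102)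
    (hr : |r| ≤ x ^ 102) (h0 : 0 ≤ h) (hhn : h ≤ n) {t : ℕ} (htD : t ≤ D)
    (ht : x ^ 120 < |(t : ℝ) - h / 2|) :
    p t ≤ Real.exp (-((t : ℝ) - h / 2) ^ 2 / (40 * n)) := by
  have hx0 : 0 < x := by linarith
  have hx1 : 1 ≤ x := by linarith
  have hn0 : 0 < n := by rw [hn]; positivity
  have hz0 : 0 < x ^ 120 := by positivity
  rcases lt_abs.1 ht with h1 | h1
  · refine (hp.upper_tail hx hn hD ha hb hr h0 hhn htD (by linarith)).trans (Real.exp_le_exp.2 ?_)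
    rw [neg_div, neg_div, neg_le_neg_iff]
    apply div_le_div_of_nonneg_left <;> nlinarith [sq_nonneg ((t : ℝ) - h / 2)]
  · have hc : ((D - t : ℕ) : ℝ) = D - t := Nat.cast_sub htD
    have h101 : x ^ 101 ≤ x ^ 120 / 1000 := by
      have : x ^ 120 = x ^ 101 * x ^ 19 := by ring
      have h2 : x ^ 1 ≤ x ^ 19 := pow_le_pow_right₀ hx1 (by norm_num)
      rw [this]
      nlinarith [pow_pos hx0 101]
    have h1' : (1 : ℝ) ≤ x ^ 101 := one_le_pow₀ hx1
    rw [abs_le] at hD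
    have e1 : 9 / 10 * x ^ 120 ≤ ((D - t : ℕ) : ℝ) - (n - h) / 2 := by
      rw [hc]; linarith
    have h2 := hp.reflect.upper_tail (h := n - h) hx hn (abs_le.2 hD) hb
      (by rwa [sub_sub_cancel]) (by rwa [abs_neg]) (by linarith) (by linarith) (Nat.sub_le D t) e1
    simp only [Nat.sub_sub_self htD] at h2
    refine h2.trans (Real.exp_le_exp.2 ?_)
    rw [neg_div, neg_div, neg_le_neg_iff, div_le_div_iff₀ (by positivity) (by positivity)]
    rw [hc]
    rw [hc] at e1
    have e2 : 95 / 100 * (-((t : ℝ) - h / 2)) ≤ D - t - (n - h) / 2 := by linarith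
    have e3 : (95 / 100 * (-((t : ℝ) - h / 2))) ^ 2 ≤ (D - t - (n - h) / 2) ^ 2 :=
      pow_le_pow_left₀ (by linarith) e2 2
    nlinarith

lemma perturbed_product_le {α₁ β₁ α₂ β₂ e κ : ℝ} (h1 : 0 < α₁) (h2 : 0 < β₁) (h3 : 0 < α₂)
    (h4 : 0 < β₂) (hκ : 0 < κ) (hκ1 : κ ≤ 1 / 100) (e1 : e ≤ κ * α₁) (e2 : e ≤ κ * β₁)
    (e3 : e ≤ κ * α₂) (e4 : e ≤ κ * β₂) (he : 0 ≤ e) (h : α₁ * β₂ - α₂ * β₁ ≤ κ * (α₂ * β₁)) :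
    (α₁ + e) * (β₂ + e) ≤ (1 + 10 * κ) * ((β₁ - e) * (α₂ - e)) := by
  have hp : 0 < α₂ * β₁ := by positivity
  calc (α₁ + e) * (β₂ + e) ≤ ((1 + κ) * α₁) * ((1 + κ) * β₂) := by
        exact mul_le_mul (by linarith) (by linarith) (by linarith) (by positivity)
    _ = (1 + κ) ^ 2 * (α₁ * β₂) := by ring
    _ ≤ (1 + κ) ^ 2 * ((1 + κ) * (α₂ * β₁)) :=
        mul_le_mul_of_nonneg_left (by linarith) (by positivity)
    _ = (1 + κ) ^ 3 * (α₂ * β₁) := by ring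
    _ ≤ ((1 + 10 * κ) * (1 - κ) ^ 2) * (α₂ * β₁) := by
        apply mul_le_mul_of_nonneg_right _ hp.le
        nlinarith [mul_pos hκ hκ, mul_pos (mul_pos hκ hκ) hκ]
    _ = (1 + 10 * κ) * (((1 - κ) * β₁) * ((1 - κ) * α₂)) := by ring
    _ ≤ _ := by
        apply mul_le_mul_of_nonneg_left _ (by linarith)
        have q1 : 0 < (1 - κ) * β₁ := mul_pos (by linarith) h2
        have q2 : 0 < (1 - κ) * α₂ := mul_pos (by linarith) h3
        apply mul_le_mul <;> linarith

set_option maxHeartbeats 1000000 in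
lemma abs_cross_le {x n h X Y Δ r D : ℝ} (hx : 10000 ≤ x) (hn : n = x ^ 200)
    (hD : |2 * D - (n - 1)| ≤ x ^ 101) (hr : |r| ≤ x ^ 102) (h0 : 0 ≤ h) (hhn : h ≤ n)
    (hX : |X - h / 2| ≤ 2 * x ^ 120) (hY : |Y - (n - h) / 2| ≤ 2 * x ^ 120) (hXY : X + Y = n - D)
    (hΔ : |Δ - r * (h * (n - h)) / n ^ 2| ≤ 2) :
    |X * (Y - Δ) * (n + r) - Y * (X + Δ) * (n - r)| ≤ x ^ 423 := by
  have hx0 : 0 < x := by linarith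
  have hx1 : 1 ≤ x := by linarith
  have hn0 : 0 < n := by rw [hn]; positivity
  have hn1 : 1 ≤ n := by rw [hn]; exact one_le_pow₀ hx1
  have hh : h * (n - h) ≤ n ^ 2 / 4 := by nlinarith [sq_nonneg (2 * h - n)]
  have hh0 : 0 ≤ h * (n - h) := mul_nonneg h0 (by linarith)
  set δ := Δ - r * (h * (n - h)) / n ^ 2 with hδ
  set s := n - D - n / 2 with hs
  have hs1 : |s| ≤ x ^ 101 := by
    have h1 : (1 : ℝ) ≤ x ^ 101 := one_le_pow₀ hx1
    rw [abs_le] at hD ⊢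
    constructor <;> linarith
  set ξ := X - h / 2 with hξ
  set υ := Y - (n - h) / 2 with hυ
  have e1 : X * (Y - Δ) * (n + r) - Y * (X + Δ) * (n - r) =
      2 * r * (ξ * υ + ξ * ((n - h) / 2) + υ * (h / 2)) - n * δ * (n / 2 + s) -
        r * (h * (n - h)) / n * s - r * Δ * (X - Y) := by
    have : Y = (n - h) / 2 + υ := by rw [hυ]; ring
    have h3 : X = h / 2 + ξ := by rw [hξ]; ring
    have h2 : Δ = δ + r * (h * (n - h)) / n ^ 2 := by rw [hδ]; ring
    have h4 : ξ = s - υ := by rw [hξ, hs, hυ]; linarith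
    rw [h2, this, h3, h4]
    field_simp
    ring
  have b0 : (1 : ℝ) ≤ x ^ 102 := one_le_pow₀ hx1
  have b1 : |ξ * υ + ξ * ((n - h) / 2) + υ * (h / 2)| ≤ 4 * x ^ 320 := by
    have q1 : |ξ * υ| ≤ (2 * x ^ 120) * (2 * x ^ 120) := by
      rw [abs_mul]; exact mul_le_mul hX hY (abs_nonneg _) (by positivity)
    have q2 : |ξ * ((n - h) / 2)| ≤ (2 * x ^ 120) * (n / 2) := by
      rw [abs_mul, abs_of_nonneg (show 0 ≤ (n - h) / 2 by linarith)]
      exact mul_le_mul hX (by linarith) (by linarith) (by positivity)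
    have q3 : |υ * (h / 2)| ≤ (2 * x ^ 120) * (n / 2) := by
      rw [abs_mul, abs_of_nonneg (show 0 ≤ h / 2 by linarith)]
      exact mul_le_mul hY (by linarith) (by linarith) (by positivity)
    refine (abs_add_le _ _).trans ((add_le_add
        ((abs_add_le _ _).trans (add_le_add q1 q2)) q3).trans ?_)
    rw [hn]
    have k1 : 4 * x ^ 240 ≤ x ^ 320 := by
      have : x ^ 320 = x ^ 240 * x ^ 80 := by ring
      have h2 : x ^ 1 ≤ x ^ 80 := pow_le_pow_right₀ hx1 (by norm_num)
      rw [this]; nlinarith [pow_pos hx0 240]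
    have k2 : 2 * x ^ 120 * (2 * x ^ 120) + 2 * x ^ 120 * (x ^ 200 / 2) + 2 * x ^ 120 *
        (x ^ 200 / 2) =
      4 * x ^ 240 + 2 * x ^ 320 := by ring
    rw [k2]
    linarith [pow_pos hx0 320]
  have b2 : |2 * r * (ξ * υ + ξ * ((n - h) / 2) + υ * (h / 2))| ≤ 8 * x ^ 422 := by
    rw [abs_mul, abs_mul, abs_two]
    have := mul_le_mul hr b1 (abs_nonneg _) (by positivity)
    have e : x ^ 102 * (4 * x ^ 320) = 4 * x ^ 422 := by ring
    rw [e] at this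
    linarith
  have hs2 : x ^ 101 ≤ n / 2 := by
    have : n = x ^ 101 * x ^ 99 := by rw [hn]; ring
    have h2 : x ^ 1 ≤ x ^ 99 := pow_le_pow_right₀ hx1 (by norm_num)
    rw [this]; nlinarith [pow_pos hx0 101]
  have b3 : |n * δ * (n / 2 + s)| ≤ 2 * x ^ 400 := by
    rw [abs_mul, abs_mul, abs_of_pos hn0]
    have q1 : |n / 2 + s| ≤ n := by
      rw [abs_le] at hs1 ⊢
      constructor <;> linarith
    have := mul_le_mul (mul_le_mul_of_nonneg_left hΔ hn0.le) q1 (abs_nonneg _) (by positivity)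
    refine this.trans (le_of_eq ?_)
    rw [hn]; ring
  have b4' : |r * (h * (n - h)) / n| ≤ x ^ 302 := by
    rw [abs_div, abs_mul, abs_of_pos hn0, abs_of_nonneg hh0, div_le_iff₀ hn0]
    have := mul_le_mul hr hh hh0 (by positivity)
    refine this.trans ?_
    rw [hn]
    have : x ^ 302 * x ^ 200 = x ^ 502 := by ring
    rw [this, show x ^ 102 * ((x ^ 200) ^ 2 / 4) = x ^ 502 / 4 by ring]
    linarith [pow_pos hx0 502]
  have b4 : |r * (h * (n - h)) / n * s| ≤ x ^ 403 := by
    rw [abs_mul]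
    refine (mul_le_mul b4' hs1 (abs_nonneg _) (by positivity)).trans (le_of_eq (by ring))
  have b5' : |Δ| ≤ 3 * x ^ 102 := by
    have q1 : |r * (h * (n - h)) / n ^ 2| ≤ x ^ 102 := by
      rw [abs_div, abs_mul, abs_of_pos (show 0 < n ^ 2 by positivity), abs_of_nonneg hh0,
        div_le_iff₀ (by positivity)]
      exact mul_le_mul hr (hh.trans (by linarith [sq_nonneg n])) hh0 (by positivity)
    have : Δ = δ + r * (h * (n - h)) / n ^ 2 := by rw [hδ]; ring
    rw [this]
    refine (abs_add_le _ _).trans ?_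
    linarith
  have b5 : |r * Δ * (X - Y)| ≤ 6 * x ^ 404 := by
    have q1 : |X - Y| ≤ 2 * n := by
      have z : 2 * x ^ 120 ≤ n / 2 := by
        have : n = x ^ 120 * x ^ 80 := by rw [hn]; ring
        have h2 : x ^ 1 ≤ x ^ 80 := pow_le_pow_right₀ hx1 (by norm_num)
        have h3 := mul_le_mul_of_nonneg_left (show (4 : ℝ) ≤ x ^ 80 by linarith)
            (pow_pos hx0 120).le
        rw [← this] at h3
        linarith only [h3]
      have : X - Y = (h - n / 2) + ξ - υ := by rw [hξ, hυ]; ring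
      rw [this]
      clear_value ξ υ
      rw [abs_le] at hX hY ⊢
      obtain ⟨hX1, hX2⟩ := hX
      obtain ⟨hY1, hY2⟩ := hY
      constructor
      · linarith only [hX1, hY2, z, h0, hhn, hn0]
      · linarith only [hX2, hY1, z, h0, hhn, hn0]
    rw [abs_mul, abs_mul]
    refine (mul_le_mul (mul_le_mul hr b5' (abs_nonneg _) (by positivity)) q1 (abs_nonneg _)
      (by positivity)).trans (le_of_eq ?_)
    rw [hn]; ring
  rw [e1]
  refine (abs_sub _ _).trans ((add_le_add ((abs_sub _ _).trans (add_le_add ((abs_sub _ _).trans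
    (add_le_add b2 b3)) b4)) b5).trans ?_)
  have k1 : x ^ 400 ≤ x ^ 422 := pow_le_pow_right₀ hx1 (by norm_num)
  have k2 : x ^ 403 ≤ x ^ 422 := pow_le_pow_right₀ hx1 (by norm_num)
  have k3 : x ^ 404 ≤ x ^ 422 := pow_le_pow_right₀ hx1 (by norm_num)
  have k4 : x ^ 423 = x ^ 422 * x := by ring
  rw [k4]
  have k5 := mul_le_mul_of_nonneg_left hx (pow_pos hx0 422).le
  linarith only [k1, k2, k3, k5, pow_pos hx0 422]

/-- Abstract comparison of two probability vectors whose ratio is nearly constant on a window. -/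
lemma compare_of_ratio {ι : Type*} [DecidableEq ι] (I W : Finset ι) (hW : W ⊆ I)
    (p q : ι → ℝ) {M τ : ℝ}
    (hM : 0 ≤ M)
    (hp : ∑ i ∈ I, p i = 1) (hq : ∑ i ∈ I, q i ≤ 1) (hq0 : ∀ i ∈ I, 0 ≤ q i)
        (hp0 : ∀ i ∈ I, 0 ≤ p i)
    (hτ : ∑ i ∈ I \ W, p i ≤ τ) (hr : ∀ s ∈ W, ∀ t ∈ W, p s * q t ≤ M * (p t * q s)) (t : ι)
    (ht : t ∈ W) : (1 - τ) * q t ≤ M * p t := by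
  have h1 := Finset.sum_sdiff hW (f := p)
  have h2 := Finset.sum_sdiff hW (f := q)
  have h3 : 0 ≤ ∑ i ∈ I \ W, q i := Finset.sum_nonneg fun i hi => hq0 i (mem_sdiff.1 hi).1
  have h4 := Finset.sum_le_sum fun s hs => hr s hs t ht
  rw [← Finset.sum_mul, ← Finset.mul_sum, ← Finset.mul_sum] at h4
  calc (1 - τ) * q t ≤ (∑ i ∈ W, p i) * q t :=
        mul_le_mul_of_nonneg_right (by linarith) (hq0 t (hW ht))
    _ ≤ _ := h4
    _ ≤ M * (p t * 1) := mul_le_mul_of_nonneg_left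
        (mul_le_mul_of_nonneg_left (by linarith) (hp0 t (hW ht))) hM
    _ = _ := by ring

lemma ratio_le_of_step {ρ : ℕ → ℝ} {M ε : ℝ} (s t : ℕ) (hε : 0 ≤ ε) (hst : s ≤ t)
    (hρ : ∀ i, 0 ≤ ρ i)
    (h : ∀ i, s ≤ i → i < t → ρ (i + 1) ≤ (1 + ε) * ρ i ∧ ρ i ≤ (1 + ε) * ρ (i + 1))
    (hM : Real.exp (ε * (t - s)) ≤ M) : ρ t ≤ M * ρ s ∧ ρ s ≤ M * ρ t := by
  suffices ρ t ≤ Real.exp (ε * (t - s)) * ρ s ∧ ρ s ≤ Real.exp (ε * (t - s)) * ρ t from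
    ⟨this.1.trans (mul_le_mul_of_nonneg_right hM (hρ _)),
      this.2.trans (mul_le_mul_of_nonneg_right hM (hρ _))⟩
  clear hM
  induction t, hst using Nat.le_induction with
  | base => simp
  | succ t hst ih =>
    have h1 := ih fun i hi hit => h i hi (by omega)
    have h2 := h t hst (by omega)
    have h3 : (1 + ε) * Real.exp (ε * (t - s)) ≤ Real.exp (ε * ((t + 1 : ℕ) - s)) := by
      have : ε * ((t + 1 : ℕ) - s) = ε + ε * (t - s) := by push_cast; ring
      rw [this, Real.exp_add]
      apply mul_le_mul_of_nonneg_right _ (Real.exp_pos _).le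
      linarith [Real.add_one_le_exp ε]
    constructor
    · calc ρ (t + 1) ≤ (1 + ε) * ρ t := h2.1
        _ ≤ (1 + ε) * (Real.exp (ε * (t - s)) * ρ s) := mul_le_mul_of_nonneg_left h1.1 (by linarith)
        _ = (1 + ε) * Real.exp (ε * (t - s)) * ρ s := by ring
        _ ≤ _ := mul_le_mul_of_nonneg_right h3 (hρ _)
    · calc ρ s ≤ Real.exp (ε * (t - s)) * ρ t := h1.2
        _ ≤ Real.exp (ε * (t - s)) * ((1 + ε) * ρ (t + 1)) :=
          mul_le_mul_of_nonneg_left h2.2 (Real.exp_pos _).le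
        _ = (1 + ε) * Real.exp (ε * (t - s)) * ρ (t + 1) := by ring
        _ ≤ _ := mul_le_mul_of_nonneg_right h3 (hρ _)

lemma ratio_step {p p' q q' α₁ β₁ α₂ β₂ e κ : ℝ} (h1 : 0 < α₁) (h2 : 0 < β₁) (h3 : 0 < α₂)
    (h4 : 0 < β₂) (hκ : 0 < κ) (hκ1 : κ ≤ 1 / 100) (e1 : e ≤ κ * α₁) (e2 : e ≤ κ * β₁)
    (e3 : e ≤ κ * α₂) (e4 : e ≤ κ * β₂) (he : 0 ≤ e) (h : α₁ * β₂ - α₂ * β₁ ≤ κ * (α₂ * β₁))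
    (hp : 0 ≤ p) (hq : 0 < q) (hq' : 0 < q')
    (hpb : p' * (β₁ - e) ≤ p * (α₁ + e)) (hqb : q * (α₂ - e) ≤ q' * (β₂ + e)) :
    p' / q' ≤ (1 + 10 * κ) * (p / q) := by
  have key := perturbed_product_le h1 h2 h3 h4 hκ hκ1 e1 e2 e3 e4 he h
  have t1 : 0 < β₁ - e := by nlinarith
  have t2 : 0 < α₂ - e := by nlinarith
  rw [← mul_div_assoc, div_le_div_iff₀ hq' hq]
  have hpos : 0 < (β₁ - e) * (α₂ - e) := mul_pos t1 t2
  refine le_of_mul_le_mul_right ?_ hpos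
  calc p' * q * ((β₁ - e) * (α₂ - e)) = (p' * (β₁ - e)) * (q * (α₂ - e)) := by ring
    _ ≤ (p * (α₁ + e)) * (q' * (β₂ + e)) :=
        mul_le_mul hpb hqb (mul_nonneg hq.le t2.le) (mul_nonneg hp (by linarith))
    _ = (p * q') * ((α₁ + e) * (β₂ + e)) := by ring
    _ ≤ (p * q') * ((1 + 10 * κ) * ((β₁ - e) * (α₂ - e))) :=
        mul_le_mul_of_nonneg_left key (mul_nonneg hp hq'.le)
    _ = _ := by ring

lemma cross_le_of_bracket {L n A T X Y a b r κ : ℝ} (hA : 0 ≤ A) (hT : 0 ≤ T)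
    (hn : 0 ≤ n) (hbr : |X * b * (n + r) - Y * a * (n - r)| ≤ L) (hL1 : L ≤ κ * (a * Y * (n - r)))
    (hL2 : L ≤ κ * (X * b * (n + r))) :
    (A * X * (n + r)) * (T * b * n) - (A * a * n) * (T * Y * (n - r)) ≤
        κ * ((A * a * n) * (T * Y * (n - r))) ∧
      (T * Y * (n - r)) * (A * a * n) - (T * b * n) * (A * X * (n + r)) ≤
        κ * ((T * b * n) * (A * X * (n + r))) := by
  have hz : 0 ≤ A * T * n := by positivity
  have h1 := mul_le_mul_of_nonneg_left ((le_abs_self _).trans (hbr.trans hL1)) hz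
  have h2 := mul_le_mul_of_nonneg_left ((neg_le_abs _).trans (hbr.trans hL2)) hz
  constructor
  · exact (le_of_eq (by ring)).trans (h1.trans (le_of_eq (by ring)))
  · exact (le_of_eq (by ring)).trans (h2.trans (le_of_eq (by ring)))

lemma prod_lower {x A B c n : ℝ} (hx : 10000 ≤ x) (hn : n = x ^ 200) (hA : x ^ 199 / 4 ≤ A)
    (hB : x ^ 199 / 4 ≤ B) (hc : n / 2 ≤ c) :
    0 < A * B * c ∧ x ^ 423 ≤ (x ^ 173)⁻¹ * (A * B * c) ∧ x ^ 413 ≤ (x ^ 173)⁻¹ * (A * B * c) := by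
  have hx0 : 0 < x := by linarith
  have hx1 : 1 ≤ x := by linarith
  have hn0 : 0 < n := by rw [hn]; positivity
  have h1 : x ^ 598 / 32 ≤ A * B * c := by
    have hz : 0 < x ^ 199 / 4 := by positivity
    have := mul_le_mul (mul_le_mul hA hB hz.le (by linarith)) hc (by linarith)
      (mul_nonneg (by linarith) (by linarith))
    refine le_trans (le_of_eq ?_) this
    rw [hn]; ring
  have h2 : x ^ 423 ≤ (x ^ 173)⁻¹ * (A * B * c) := by
    rw [← div_eq_inv_mul, le_div_iff₀ (by positivity)]
    refine le_trans ?_ h1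
    have e1 : x ^ 423 * x ^ 173 = x ^ 596 := by ring
    have e2 : x ^ 598 = x ^ 596 * x ^ 2 := by ring
    rw [e1, e2]
    have : (32 : ℝ) ≤ x ^ 2 := by nlinarith
    have := mul_le_mul_of_nonneg_left this (pow_pos hx0 596).le
    linarith
  refine ⟨lt_of_lt_of_le (by positivity) h1, h2, le_trans ?_ h2⟩
  exact pow_le_pow_right₀ hx1 (by norm_num)

lemma window_step {n x h h0 h1 a b r : ℝ} {D : ℕ} {p q : ℕ → ℝ}
    (hp : IsNearBalanced n x h0 h1 r D p) (hq : IsNearBalanced n x a b 0 D q)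
    (hx : 10000 ≤ x) (hn : n = x ^ 200) (hD : |2 * (D : ℝ) - (n - 1)| ≤ x ^ 101)
    (hr : |r| ≤ x ^ 102) (hh : x ^ 199 ≤ h) (hh' : x ^ 199 ≤ n - h) (h01 : h0 + h1 = n - 1)
    (hab : a + b = n - 1) (hh0 : |h0 - h| ≤ 1)
    (ha : |a - h - r * (h * (n - h)) / n ^ 2| ≤ 1) (ha' : |a - h| ≤ x ^ 102 + 1) {t : ℕ}
        (htD : t < D)
    (ht : |(t : ℝ) - h / 2| ≤ x ^ 120) (hqt : 0 < q t) (hqt' : 0 < q (t + 1)) :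
    p (t + 1) / q (t + 1) ≤ (1 + 10 * (x ^ 173)⁻¹) * (p t / q t) ∧
      p t / q t ≤ (1 + 10 * (x ^ 173)⁻¹) * (p (t + 1) / q (t + 1)) := by
  have hx0 : 0 < x := by linarith
  have hx1 : 1 ≤ x := by linarith
  have hb := hp.2 t htD
  have hb' := hq.2 t htD
  have p0 := (hp.1 t htD.le).1
  have p1 := (hp.1 (t + 1) htD).1
  clear hp hq
  have c0 : (10 : ℝ) ≤ x ^ 101 := by
    have : x ^ 1 ≤ x ^ 101 := pow_le_pow_right₀ hx1 (by norm_num)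
    linarith
  have c1 : x ^ 101 ≤ x ^ 120 := pow_le_pow_right₀ hx1 (by norm_num)
  have c2 : x ^ 102 ≤ x ^ 120 := pow_le_pow_right₀ hx1 (by norm_num)
  have c3 : 100 * x ^ 120 ≤ x ^ 199 := by
    have e : x ^ 199 = x ^ 120 * x ^ 79 := by ring
    have h2 : x ^ 1 ≤ x ^ 79 := pow_le_pow_right₀ hx1 (by norm_num)
    have := mul_le_mul_of_nonneg_left (show (100 : ℝ) ≤ x ^ 79 by linarith) (pow_pos hx0 120).le
    rw [e]; linarith
  have c4 : x ^ 102 ≤ n / 2 := by linarith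
  have hn0 : 0 < n := by linarith [pow_pos hx0 199]
  have hbr := abs_cross_le (X := h0 - t) (Y := h1 - D + t + 1) (Δ := a - h0) (r := r) (D := D)
    (h := h) hx hn hD hr (by linarith [pow_pos hx0 199]) (by linarith [pow_pos hx0 199])
    (by
      rw [abs_le] at *
      constructor <;> linarith only [hh0.1, hh0.2, ht.1, ht.2, c0, c1])
    (by
      rw [abs_le] at *
      constructor <;> linarith only [hh0.1, hh0.2, ht.1, ht.2, c0, c1, hD.1, hD.2, h01])
    (by linarith only [h01])
    (by
      rw [abs_le] at *
      constructor <;> linarith only [hh0.1, hh0.2, ha.1, ha.2])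
  rw [show h1 - D + t + 1 - (a - h0) = b - D + t + 1 by linarith,
    show h0 - t + (a - h0) = a - t by ring] at hbr
  rw [abs_le] at hD hr hh0 ha' ht
  have l1 : x ^ 199 / 4 ≤ (D : ℝ) - t := by linarith only [hD.1, ht.2, c0, c1, c3, hh']
  have l2 : x ^ 199 / 4 ≤ (t : ℝ) + 1 := by linarith only [ht.1, c0, c1, c3, hh]
  have l3 : x ^ 199 / 4 ≤ h0 - t := by linarith only [ht.2, hh0.1, c0, c1, c3, hh]
  have l4 : x ^ 199 / 4 ≤ h1 - D + t + 1 := by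
    linarith only [ht.1, hh0.2, h01, hD.2, c0, c1, c3, hh']
  have l5 : x ^ 199 / 4 ≤ a - t := by linarith only [ht.2, ha'.1, c0, c1, c2, c3, hh]
  have l6 : x ^ 199 / 4 ≤ b - D + t + 1 := by
    linarith only [ht.1, ha'.2, hab, hD.2, c0, c1, c2, c3, hh']
  have r1 : n / 2 ≤ n + r := by linarith only [hr.1, c4]
  have r2 : n / 2 ≤ n - r := by linarith only [hr.2, c4]
  have r3 : n / 2 ≤ n := by linarith only [hn0]
  obtain ⟨a1, -, a1'⟩ := prod_lower hx hn l1 l3 r1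
  obtain ⟨a2, -, a2'⟩ := prod_lower hx hn l2 l4 r2
  obtain ⟨a3, -, a3'⟩ := prod_lower hx hn l1 l5 r3
  obtain ⟨a4, -, a4'⟩ := prod_lower hx hn l2 l6 r3
  obtain ⟨-, b1, -⟩ := prod_lower hx hn l5 l4 r2
  obtain ⟨-, b2, -⟩ := prod_lower hx hn l3 l6 r1
  have lp : 0 < x ^ 199 / 4 := by positivity
  obtain ⟨k1, k2⟩ := cross_le_of_bracket (lp.le.trans l1) (lp.le.trans l2) hn0.le hbr b1 b2
  have hκ : 0 < (x ^ 173)⁻¹ := by positivity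
  have hκ1 : (x ^ 173)⁻¹ ≤ 1 / 100 := by
    rw [inv_le_comm₀ (by positivity) (by norm_num)]
    have : x ^ 1 ≤ x ^ 173 := pow_le_pow_right₀ hx1 (by norm_num)
    linarith
  have he : (0 : ℝ) ≤ x ^ 413 := by positivity
  rw [add_zero, sub_zero] at hb'
  rw [abs_le] at hb hb'
  obtain ⟨u1, u2⟩ := hb
  obtain ⟨u3, u4⟩ := hb'
  constructor
  · exact ratio_step a1 a2 a3 a4 hκ hκ1 a1' a2' a3' a4' he k1 p0 hqt hqt'
      (by linarith only [u1]) (by linarith only [u4])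
  · exact ratio_step a2 a1 a4 a3 hκ hκ1 a2' a1' a4' a3' he k2 p1 hqt' hqt
      (by linarith only [u2]) (by linarith only [u3])

lemma exp_neg_pow_le {x : ℝ} (hx : 10000 ≤ x) : x ^ 200 * Real.exp (-(x ^ 40 / 40)) ≤
    (x ^ 40)⁻¹ := by
  have hx0 : 0 < x := by linarith
  have hx1 : 1 ≤ x := by linarith
  rw [Real.exp_neg, ← div_eq_mul_inv, div_le_iff₀ (Real.exp_pos _), ← div_eq_inv_mul,
    le_div_iff₀ (by positivity)]
  have h1 : x ^ 240 ≤ Real.exp x ^ 240 :=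
    pow_le_pow_left₀ hx0.le (by linarith [Real.add_one_le_exp x]) _
  rw [← Real.exp_nat_mul] at h1
  have h2 : ((240 : ℕ) : ℝ) * x ≤ x ^ 40 / 40 := by
    have h2 : x ^ 1 ≤ x ^ 39 := pow_le_pow_right₀ hx1 (by norm_num)
    have h3 := mul_le_mul_of_nonneg_right (show (9600 : ℝ) ≤ x ^ 39 by linarith) hx0.le
    have e : x ^ 40 = x ^ 39 * x := by ring
    rw [e]; push_cast; linarith
  calc x ^ 200 * x ^ 40 = x ^ 240 := by ring
    _ ≤ _ := h1
    _ ≤ _ := Real.exp_le_exp.2 h2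

lemma window_mul_le {n x h h0 h1 a b r : ℝ} {D : ℕ} {p q : ℕ → ℝ}
    (hp : IsNearBalanced n x h0 h1 r D p) (hq : IsNearBalanced n x a b 0 D q)
    (hx : 10000 ≤ x) (hn : n = x ^ 200) (hD : |2 * (D : ℝ) - (n - 1)| ≤ x ^ 101)
    (hr : |r| ≤ x ^ 102) (hh : x ^ 199 ≤ h) (hh' : x ^ 199 ≤ n - h) (h01 : h0 + h1 = n - 1)
    (hab : a + b = n - 1) (hh0 : |h0 - h| ≤ 1)
    (ha : |a - h - r * (h * (n - h)) / n ^ 2| ≤ 1) (ha' : |a - h| ≤ x ^ 102 + 1)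
    (hq0 : ∀ t ≤ D, |(t : ℝ) - h / 2| ≤ x ^ 120 → 0 < q t)
    (hp' : ∀ t, 0 ≤ p t) (hq' : ∀ t, 0 ≤ q t) {s t : ℕ}
    (hs : s ≤ D) (hs' : |(s : ℝ) - h / 2| ≤ x ^ 120) (ht : t ≤ D)
        (ht' : |(t : ℝ) - h / 2| ≤ x ^ 120) :
    p s * q t ≤ Real.exp ((x ^ 50)⁻¹) * (p t * q s) := by
  have hx0 : 0 < x := by linarith
  have hx1 : 1 ≤ x := by linarith
  suffices p s / q s ≤ Real.exp ((x ^ 50)⁻¹) * (p t / q t) by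
    have a1 := hq0 s hs hs'
    have a2 := hq0 t ht ht'
    rw [← mul_div_assoc, div_le_div_iff₀ a1 a2] at this
    linarith
  have key : ∀ s t : ℕ, s ≤ D → |(s : ℝ) - h / 2| ≤ x ^ 120 → t ≤ D → |(t : ℝ) - h / 2| ≤ x ^ 120 →
      s ≤ t → p t / q t ≤ Real.exp ((x ^ 50)⁻¹) * (p s / q s) ∧
        p s / q s ≤ Real.exp ((x ^ 50)⁻¹) * (p t / q t) := by
    intro s t hs hs' ht ht' hst
    rw [abs_le] at hs' ht'
    have hin : ∀ i, s ≤ i → i ≤ t → |(i : ℝ) - h / 2| ≤ x ^ 120 := by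
      intro i hi hit
      have h1 : (s : ℝ) ≤ i := by exact_mod_cast hi
      have h2 : (i : ℝ) ≤ t := by exact_mod_cast hit
      rw [abs_le]
      constructor <;> linarith only [h1, h2, hs', ht']
    refine ratio_le_of_step (ρ := fun i => p i / q i) (ε := 10 * (x ^ 173)⁻¹) s t
        (by positivity) hst
      (fun i => div_nonneg (hp' i) (hq' i)) (fun i hi hit => ?_) ?_
    · exact window_step hp hq hx hn hD hr hh hh' h01 hab hh0 ha ha' (by omega) (hin i hi hit.le)
        (hq0 i (by omega) (hin i hi hit.le)) (hq0 (i + 1) (by omega) (hin _ (by omega) (by omega)))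
    · rw [Real.exp_le_exp]
      have h1 : (t : ℝ) - s ≤ 2 * x ^ 120 := by linarith only [hs'.1, ht'.2]
      calc 10 * (x ^ 173)⁻¹ * ((t : ℝ) - s) ≤ 10 * (x ^ 173)⁻¹ * (2 * x ^ 120) :=
            mul_le_mul_of_nonneg_left h1 (by positivity)
        _ = 20 / x ^ 53 := by field_simp; ring
        _ ≤ (x ^ 50)⁻¹ := by
            rw [inv_eq_one_div, div_le_div_iff₀ (by positivity) (by positivity)]
            have e : x ^ 53 = x ^ 50 * x ^ 3 := by ring
            have h2 : x ^ 1 ≤ x ^ 3 := pow_le_pow_right₀ hx1 (by norm_num)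
            have := mul_le_mul_of_nonneg_left (show (20 : ℝ) ≤ x ^ 3 by linarith)
                (pow_pos hx0 50).le
            linarith
  rcases le_total s t with hst | hst
  · exact (key s t hs hs' ht ht' hst).2
  · exact (key t s ht ht' hs hs' hst).1

lemma IsNearBalanced.sum_tail_le {n x a b r h : ℝ} {D : ℕ} {p : ℕ → ℝ}
    (hp : IsNearBalanced n x a b r D p)
    (hx : 10000 ≤ x) (hn : n = x ^ 200) (hD : |2 * (D : ℝ) - (n - 1)| ≤ x ^ 101)
    (ha : |a - h| ≤ x ^ 102) (hb : |b - (n - h)| ≤ x ^ 102) (hr : |r| ≤ x ^ 102) (h0 : 0 ≤ h)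
    (hhn : h ≤ n) :
    ∑ t ∈ range (D + 1) \ (range (D + 1)).filter (fun t : ℕ => |(t : ℝ) - h / 2| ≤ x ^ 120), p t ≤
      (x ^ 40)⁻¹ := by
  have hx0 : 0 < x := by linarith
  have hx1 : 1 ≤ x := by linarith
  refine le_trans ?_ (exp_neg_pow_le hx)
  refine (Finset.sum_le_card_nsmul _ _ (Real.exp (-(x ^ 40 / 40))) fun t ht => ?_).trans ?_
  · simp only [mem_sdiff, mem_filter, mem_range, not_and, not_le] at ht
    have h1 := ht.2 ht.1
    refine (hp.tail hx hn hD ha hb hr h0 hhn (by omega) h1).trans ?_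
    rw [Real.exp_le_exp, neg_div, neg_le_neg_iff, hn, ← sq_abs, div_le_div_iff₀ (by norm_num)
        (by positivity)]
    have h2 : (x ^ 120) ^ 2 ≤ |(t : ℝ) - h / 2| ^ 2 := pow_le_pow_left₀ (by positivity) h1.le 2
    have e : x ^ 40 * (40 * x ^ 200) = (x ^ 120) ^ 2 * 40 := by ring
    rw [e]; linarith
  · rw [nsmul_eq_mul]
    apply mul_le_mul_of_nonneg_right _ (Real.exp_pos _).le
    have h1 : ((range (D + 1) \ (range (D + 1)).filter
        (fun t : ℕ => |(t : ℝ) - h / 2| ≤ x ^ 120)).card : ℝ) ≤ (D + 1 : ℕ) := by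
      have := Finset.card_le_card (Finset.sdiff_subset (s := range (D + 1))
          (t := (range (D + 1)).filter (fun t : ℕ => |(t : ℝ) - h / 2| ≤ x ^ 120)))
      rw [card_range] at this
      exact_mod_cast this
    refine h1.trans ?_
    rw [abs_le] at hD
    push_cast
    have c1 : x ^ 101 + 2 ≤ x ^ 200 := by
      have e : x ^ 200 = x ^ 101 * x ^ 99 := by ring
      have h2 : x ^ 1 ≤ x ^ 99 := pow_le_pow_right₀ hx1 (by norm_num)
      have h3 : (1 : ℝ) ≤ x ^ 101 := one_le_pow₀ hx1
      have := mul_le_mul_of_nonneg_left (show (3 : ℝ) ≤ x ^ 99 by linarith) (pow_pos hx0 101).le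
      rw [e]; linarith
    linarith [hD.2]

lemma window_compare {n x h h0 h1 a b r : ℝ} {D : ℕ} {p q : ℕ → ℝ}
    (hp : IsNearBalanced n x h0 h1 r D p) (hq : IsNearBalanced n x a b 0 D q)
    (hx : 10000 ≤ x) (hn : n = x ^ 200) (hD : |2 * (D : ℝ) - (n - 1)| ≤ x ^ 101)
    (hr : |r| ≤ 2 * x ^ 101) (hh : x ^ 199 ≤ h) (hh' : x ^ 199 ≤ n - h) (h01 : h0 + h1 = n - 1)
    (hab : a + b = n - 1) (hh0 : |h0 - h| ≤ 1)
    (ha : |a - h - r * (h * (n - h)) / n ^ 2| ≤ 1)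
    (hq0 : ∀ t ≤ D, |(t : ℝ) - h / 2| ≤ x ^ 120 → 0 < q t)
    (hp' : ∀ t, 0 ≤ p t) (hq' : ∀ t, 0 ≤ q t) (hps : ∑ t ∈ range (D + 1), p t = 1)
    (hqs : ∑ t ∈ range (D + 1), q t = 1) {t : ℕ} (ht : t ≤ D) (ht' : |(t : ℝ) - h / 2| ≤ x ^ 120) :
    |p t - q t| ≤ (x ^ 30)⁻¹ * q t := by
  have hx0 : 0 < x := by linarith
  have hx1 : 1 ≤ x := by linarith
  have hl : 0 < x ^ 199 := by positivity
  have hn0 : 0 < n := by linarith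
  have c1 : 100 * x ^ 101 ≤ x ^ 102 := by
    have := mul_le_mul_of_nonneg_left (show (100 : ℝ) ≤ x by linarith) (pow_pos hx0 101).le
    have e : x ^ 102 = x ^ 101 * x := by ring
    linarith
  have c2 : (1 : ℝ) ≤ x ^ 101 := one_le_pow₀ hx1
  have ha' : |a - h| ≤ 2 * x ^ 101 + 1 := by
    have : |r * (h * (n - h)) / n ^ 2| ≤ 2 * x ^ 101 := by
      have hz : 0 ≤ h * (n - h) := mul_nonneg (by linarith) (by linarith)
      rw [abs_div, abs_mul, abs_of_pos (show 0 < n ^ 2 by positivity), abs_of_nonneg hz,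
        div_le_iff₀ (by positivity)]
      exact mul_le_mul hr (by nlinarith) hz (by positivity)
    have h2 := abs_add_le (a - h - r * (h * (n - h)) / n ^ 2) (r * (h * (n - h)) / n ^ 2)
    rw [sub_add_cancel] at h2
    linarith
  have hr' : |r| ≤ x ^ 102 := by linarith
  have hmul := fun (s t : ℕ) => window_mul_le (s := s)
      (t := t) hp hq hx hn hD hr' hh hh' h01 hab hh0 ha
    (by linarith) hq0 hp' hq'
  have tp := hp.sum_tail_le (h := h) hx hn hD (by linarith) (by
    rw [abs_le] at *; constructor <;> linarith) hr' (by linarith) (by linarith)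
  have tq := hq.sum_tail_le (h := h) hx hn hD (by linarith) (by
    rw [abs_le] at *; constructor <;> linarith) (by rw [abs_zero]; positivity) (by linarith)
        (by linarith)
  have key1 := compare_of_ratio (range (D + 1)) _ (filter_subset _ _) p q
      (M := Real.exp ((x ^ 50)⁻¹))
    (Real.exp_pos _).le hps hqs.le (fun i _ => hq' i) (fun i _ => hp' i) tp (by
      intro s hs t ht
      simp only [mem_filter, mem_range] at hs ht
      exact hmul s t (by omega) hs.2 (by omega) ht.2) t (by simp [ht, ht'])
  have key2 := compare_of_ratio (range (D + 1)) _ (filter_subset _ _) q p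
      (M := Real.exp ((x ^ 50)⁻¹))
    (Real.exp_pos _).le hqs hps.le (fun i _ => hp' i) (fun i _ => hq' i) tq (by
      intro s hs t ht
      simp only [mem_filter, mem_range] at hs ht
      have := hmul t s (by omega) ht.2 (by omega) hs.2
      linarith) t (by simp [ht, ht'])
  clear tp tq hmul hp hq hps hqs ha ha' hh0 hab h01 hr hr' hD
  have hqt := hq' t
  have hpt := hp' t
  have s1 : (x ^ 40)⁻¹ ≤ (x ^ 30)⁻¹ / 100 := by
    rw [← one_div, ← one_div, div_div, one_div_le_one_div (by positivity) (by positivity)]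
    have h2 : x ^ 1 ≤ x ^ 10 := pow_le_pow_right₀ hx1 (by norm_num)
    have := mul_le_mul_of_nonneg_left (show (100 : ℝ) ≤ x ^ 10 by linarith) (pow_pos hx0 30).le
    linarith [show x ^ 40 = x ^ 30 * x ^ 10 by ring]
  have s2 : (x ^ 50)⁻¹ ≤ (x ^ 40)⁻¹ :=
    inv_anti₀ (by positivity) (pow_le_pow_right₀ hx1 (by norm_num))
  have s3 : (x ^ 30)⁻¹ ≤ 1 := inv_le_one_of_one_le₀ (one_le_pow₀ hx1)
  have s4 : 0 < (x ^ 50)⁻¹ := by positivity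
  have s5 : Real.exp ((x ^ 50)⁻¹) ≤ 1 + (x ^ 30)⁻¹ / 50 := by
    have := Real.abs_exp_sub_one_sub_id_le (x := (x ^ 50)⁻¹) (by rw [abs_of_pos s4]; linarith)
    rw [abs_le] at this
    nlinarith
  generalize (x ^ 30)⁻¹ = y at *
  generalize (x ^ 40)⁻¹ = z at *
  generalize Real.exp ((x ^ 50)⁻¹) = M at *
  have u1 : (1 - y / 100) * q t ≤ (1 + y / 50) * p t :=
    (mul_le_mul_of_nonneg_right (by linarith) hqt).trans
      (key1.trans (mul_le_mul_of_nonneg_right s5 hpt))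
  have u2 : (1 - y / 100) * p t ≤ (1 + y / 50) * q t :=
    (mul_le_mul_of_nonneg_right (by linarith) hpt).trans
      (key2.trans (mul_le_mul_of_nonneg_right s5 hqt))
  have y0 : 0 < y := by linarith
  generalize q t = Q at *
  generalize p t = P at *
  have u3 : P ≤ (1 + y) * Q := by
    refine le_of_mul_le_mul_left ?_ (show 0 < 1 - y / 100 by linarith)
    refine u2.trans ?_
    rw [← mul_assoc]
    apply mul_le_mul_of_nonneg_right _ hqt
    nlinarith
  have u4 : (1 - y) * Q ≤ P := by
    refine le_of_mul_le_mul_left ?_ (show 0 < 1 + y / 50 by linarith)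
    refine le_trans ?_ u1
    rw [← mul_assoc]
    apply mul_le_mul_of_nonneg_right _ hqt
    nlinarith
  rw [abs_le]
  constructor <;> linarith

/-- `a` is bounded in absolute value by the integer power `x ^ k`. -/
def PowBd (x : ℝ) (k : ℤ) (a : ℝ) : Prop := |a| ≤ x ^ k

namespace PowBd

variable {x a b : ℝ} {i j k : ℤ}

lemma mono (hx : 10000 ≤ x) (h : PowBd x i a) (hij : i ≤ j) : PowBd x j a :=
  h.trans (zpow_le_zpow_right₀ (by linarith) hij)

lemma mul' (hx : 10000 ≤ x) (ha : PowBd x i a) (hb : PowBd x j b) : PowBd x (i + j) (a * b) := by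
  rw [PowBd, abs_mul, zpow_add₀ (by linarith)]
  exact mul_le_mul ha hb (abs_nonneg _) (by have : 0 < x := by linarith
                                            positivity)

lemma mul (hx : 10000 ≤ x) (ha : PowBd x i a) (hb : PowBd x j b) (hk : i + j ≤ k) :
    PowBd x k (a * b) :=
  (ha.mul' hx hb).mono hx hk

lemma const (hx : 10000 ≤ x) (ha : |a| ≤ 10000) : PowBd x 1 a := by
  rw [PowBd, zpow_one]; linarith

lemma add (hx : 10000 ≤ x) (ha : PowBd x i a) (hb : PowBd x j b) (hi : i + 1 ≤ k) (hj : j + 1 ≤ k) :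
    PowBd x k (a + b) := by
  have h1 := ha.mono hx (show i ≤ k - 1 by omega)
  have h2 := hb.mono hx (show j ≤ k - 1 by omega)
  have hx0 : 0 < x := by linarith
  have h3 : x ^ k = x ^ (k - 1) * x := by rw [← zpow_add_one₀ hx0.ne', sub_add_cancel]
  have h4 : 0 < x ^ (k - 1) := by positivity
  rw [PowBd] at *
  refine (abs_add_le _ _).trans ?_
  have := mul_le_mul_of_nonneg_left (show (2 : ℝ) ≤ x by linarith) h4.le
  linarith

lemma neg (ha : PowBd x i a) : PowBd x i (-a) := by
  rwa [PowBd, abs_neg]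

lemma sub (hx : 10000 ≤ x) (ha : PowBd x i a) (hb : PowBd x j b) (hi : i + 1 ≤ k) (hj : j + 1 ≤ k) :
    PowBd x k (a - b) := by
  rw [sub_eq_add_neg]; exact ha.add hx hb.neg hi hj

lemma inv (hx : 10000 ≤ x) (ha : x ^ (-k) ≤ a) : PowBd x k a⁻¹ := by
  have hx0 : 0 < x := by linarith
  have h1 : 0 < x ^ (-k) := by positivity
  rw [PowBd, abs_of_pos (inv_pos.2 (h1.trans_le ha)), inv_le_comm₀ (h1.trans_le ha) (by positivity),
    ← zpow_neg]
  exact ha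

lemma of_pow {m : ℕ} (ha : |a| ≤ x ^ m) : PowBd x m a := by
  rw [PowBd, zpow_natCast]; exact ha

lemma le_inv {m : ℕ} (ha : PowBd x (-m) a) : |a| ≤ (x ^ m)⁻¹ := by
  rw [PowBd, zpow_neg, zpow_natCast] at ha; exact ha

end PowBd

lemma shift_quotient_bd {x n h h0 : ℝ} (hx : 10000 ≤ x) (hn : n = x ^ 200)
    (hh : x ^ 199 ≤ h) (hhn : h ≤ n) (hh0 : |h0 - h| ≤ 1) :
    PowBd x (-397) (h0 / (h * (n - 1)) - 1 / n) := by
  have hx0 : 0 < x := by linarith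
  have hh1 : 0 < h := lt_of_lt_of_le (by positivity) hh
  have hn0 : 0 < n := by linarith
  have hl : (10000 : ℝ) ≤ x ^ 199 := by
    have : x ^ 1 ≤ x ^ 199 := pow_le_pow_right₀ (by linarith) (by norm_num)
    linarith
  have hN : 0 < n - 1 := by linarith
  have e : h0 / (h * (n - 1)) - 1 / n = (h0 - h + h / n) * (h⁻¹ * (n - 1)⁻¹) := by
    field_simp; ring
  rw [e]
  have b1 : PowBd x 1 (h0 - h + h / n) := by
    apply PowBd.const hx
    have : |h / n| ≤ 1 := by rw [abs_of_pos (by positivity), div_le_one hn0]; exact hhn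
    refine (abs_add_le _ _).trans ?_
    linarith
  have b2 : PowBd x (-199) h⁻¹ := PowBd.inv hx (by simpa using hh)
  have b3 : PowBd x (-199) (n - 1)⁻¹ := PowBd.inv hx (by
    have : x ^ (199 : ℤ) = x ^ 199 := by norm_cast
    rw [neg_neg, this, hn, show x ^ 200 = x ^ 199 * x by ring]
    nlinarith)
  exact b1.mul hx (b2.mul hx b3 (show _ ≤ -398 by norm_num)) (by norm_num)

lemma inv_pred_sub_bd {x n : ℝ} (hx : 10000 ≤ x) (hn : n = x ^ 200) :
    PowBd x (-399) (1 / (n - 1) - 1 / n) := by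
  have hx0 : 0 < x := by linarith
  have hl : (10000 : ℝ) ≤ x ^ 199 := by
    have : x ^ 1 ≤ x ^ 199 := pow_le_pow_right₀ (by linarith) (by norm_num)
    linarith
  have b3 : x ^ 199 ≤ n - 1 := by
    rw [hn, show x ^ 200 = x ^ 199 * x by ring]
    nlinarith
  have hN : 0 < n - 1 := by linarith
  have hn0 : 0 < n := by linarith
  have e : 1 / (n - 1) - 1 / n = n⁻¹ * (n - 1)⁻¹ := by field_simp; ring
  rw [e]
  have q1 : PowBd x (-200) n⁻¹ := PowBd.inv hx (by rw [hn]; norm_cast)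
  have q2 : PowBd x (-199) (n - 1)⁻¹ := PowBd.inv hx (by
    have : x ^ (199 : ℤ) = x ^ 199 := by norm_cast
    rw [neg_neg, this]; exact b3)
  exact q1.mul hx q2 (by norm_num)

lemma first_term_bd {x n h h' E0 E1 σ0 σ1 δ ν : ℝ} (hx : 10000 ≤ x) (hn0 : 0 < n)
    (bn : PowBd x 200 n) (bni : PowBd x (-200) n⁻¹) (bh : PowBd x 200 h) (bh' : PowBd x 200 h')
    (bE0 : PowBd x 101 E0) (bE1 : PowBd x 101 E1) (bσ0 : PowBd x 1 σ0) (bσ1 : PowBd x 1 σ1)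
    (bδ : PowBd x 101 δ) (bν : PowBd x (-399) ν) :
    PowBd x (-150) (((h + σ0) * E0 + (h' + σ1) * E1 + δ) *
      ((h + σ0) * E0 + (h' + σ1) * E1 + δ - 2 * n * δ) * (1 / n + ν) / (2 * n ^ 2) -
      (h * E0 + h' * E1) * (h * E0 + h' * E1 - 2 * n * δ) / (2 * n ^ 3)) := by
  set M := h * E0 + h' * E1 with hM
  set s := σ0 * E0 + σ1 * E1 + δ with hs
  have e : ((h + σ0) * E0 + (h' + σ1) * E1 + δ) *
      ((h + σ0) * E0 + (h' + σ1) * E1 + δ - 2 * n * δ) * (1 / n + ν) / (2 * n ^ 2) -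
      M * (M - 2 * n * δ) / (2 * n ^ 3) =
      (M + s) * (M + s - 2 * (n * δ)) * ν * (n⁻¹ * n⁻¹ * (1 / 2)) +
        s * (M + M + s - 2 * (n * δ)) * (n⁻¹ * n⁻¹ * n⁻¹ * (1 / 2)) := by
    rw [hM, hs]; field_simp; ring
  rw [e]
  have b2 : PowBd x 1 (2 : ℝ) := PowBd.const hx (by norm_num)
  have b2' : PowBd x 1 (1 / 2 : ℝ) := PowBd.const hx (by norm_num [abs_of_pos])
  have bM : PowBd x 302 M := (bh.mul' hx bE0).add hx (bh'.mul' hx bE1) (by norm_num) (by norm_num)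
  have bs : PowBd x 104 s :=
    ((bσ0.mul' hx bE0).add hx (bσ1.mul' hx bE1) (k := 103) (by norm_num) (by norm_num)).add hx bδ
      (by norm_num) (by norm_num)
  have bnδ : PowBd x 302 (2 * (n * δ)) := b2.mul hx (bn.mul' hx bδ) (by norm_num)
  have bMs : PowBd x 303 (M + s) := bM.add hx bs (by norm_num) (by norm_num)
  have bMM : PowBd x 304 (M + M + s) :=
    (bM.add hx bM (k := 303) (by norm_num) (by norm_num)).add hx bs (by norm_num) (by norm_num)
  have k1 : PowBd x 304 (M + s - 2 * (n * δ)) := bMs.sub hx bnδ (by norm_num) (by norm_num)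
  have k2 : PowBd x 305 (M + M + s - 2 * (n * δ)) := bMM.sub hx bnδ (by norm_num) (by norm_num)
  have t1 := ((bMs.mul' hx k1).mul' hx bν).mul' hx ((bni.mul' hx bni).mul' hx b2')
  have t2 := (bs.mul' hx k2).mul' hx (((bni.mul' hx bni).mul' hx bni).mul' hx b2')
  exact t1.add hx t2 (by norm_num) (by norm_num)

lemma second_term_bd {x n E0 E1 δ u η0 η1 : ℝ} (hx : 10000 ≤ x)
    (bni : PowBd x (-200) n⁻¹)
    (bE0 : PowBd x 101 E0) (bE1 : PowBd x 101 E1) (bu : PowBd x 120 u)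
    (bδ : PowBd x 101 δ) (bη0 : PowBd x (-397) η0) (bη1 : PowBd x (-397) η1) :
    PowBd x (-90) (-(-(2 * u) * E0 * (1 / n + η0) + (2 * u - δ + 1) * E1 * (1 / n + η1)) -
      (2 * u * (E0 - E1) + δ * E1) / n) := by
  have e : -(-(2 * u) * E0 * (1 / n + η0) + (2 * u - δ + 1) * E1 * (1 / n + η1)) -
      (2 * u * (E0 - E1) + δ * E1) / n =
      2 * u * E0 * η0 - (2 * u - δ + 1) * E1 * η1 - E1 * n⁻¹ := by
    ring
  rw [e]
  have b1 : PowBd x 1 (1 : ℝ) := PowBd.const hx (by norm_num)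
  have b2 : PowBd x 1 (2 : ℝ) := PowBd.const hx (by norm_num)
  have k1 : PowBd x 123 (2 * u - δ + 1) :=
    ((b2.mul' hx bu).sub hx bδ (k := 122) (by norm_num) (by norm_num)).add hx b1 (by norm_num)
      (by norm_num)
  exact ((((b2.mul' hx bu).mul' hx bE0).mul' hx bη0).sub hx ((k1.mul' hx bE1).mul' hx bη1)
      (k := -92)
    (by norm_num) (by norm_num)).sub hx (bE1.mul' hx bni) (by norm_num) (by norm_num)

lemma third_term_bd {x n h E σ Q η ν : ℝ} (hx : 10000 ≤ x) (bni : PowBd x (-200) n⁻¹)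
    (bh : PowBd x 200 h) (bE : PowBd x 101 E) (bσ : PowBd x 1 σ) (bQ : PowBd x 402 Q)
    (bη : PowBd x (-397) η) (bν : PowBd x (-399) ν) :
    PowBd x (-150) (Q / 2 * ((1 / n + η) / n - (1 / n + ν) ^ 2) -
      (h + σ) * E ^ 2 * (1 / n + η) / (2 * n) + h * E ^ 2 / (2 * n ^ 2)) := by
  have e : Q / 2 * ((1 / n + η) / n - (1 / n + ν) ^ 2) -
      (h + σ) * E ^ 2 * (1 / n + η) / (2 * n) + h * E ^ 2 / (2 * n ^ 2) =
      Q * (1 / 2) * (η * n⁻¹ - ν * (2 * n⁻¹ + ν)) -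
        (h + σ) * (E * E) * (η * n⁻¹) * (1 / 2) - σ * (E * E) * (n⁻¹ * n⁻¹) * (1 / 2) := by
    ring
  rw [e]
  have b2 : PowBd x 1 (2 : ℝ) := PowBd.const hx (by norm_num)
  have b2' : PowBd x 1 (1 / 2 : ℝ) := PowBd.const hx (by norm_num [abs_of_pos])
  have k1 : PowBd x (-595) (η * n⁻¹ - ν * (2 * n⁻¹ + ν)) :=
    (bη.mul' hx bni).sub hx (bν.mul' hx ((b2.mul' hx bni).add hx bν (k := -198) (by norm_num)
      (by norm_num))) (by norm_num) (by norm_num)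
  have k2 : PowBd x 201 (h + σ) := bh.add hx bσ (by norm_num) (by norm_num)
  have t1 := (bQ.mul' hx b2').mul' hx k1
  have t2 := ((k2.mul' hx (bE.mul' hx bE)).mul' hx (bη.mul' hx bni)).mul' hx b2'
  have t3 := ((bσ.mul' hx (bE.mul' hx bE)).mul' hx (bni.mul' hx bni)).mul' hx b2'
  exact (t1.sub hx t2 (k := -155) (by norm_num) (by norm_num)).sub hx t3 (by norm_num) (by norm_num)

lemma lambda_bd {x n h h0 h1 E0 E1 Q0 Q1 δ u : ℝ} (hx : 10000 ≤ x) (hn : n = x ^ 200)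
    (hh : x ^ 199 ≤ h) (hh' : x ^ 199 ≤ n - h) (hh0 : |h0 - h| ≤ 1) (hh1 : |h1 - (n - h)| ≤ 1)
    (bE0 : PowBd x 101 E0) (bE1 : PowBd x 101 E1) (bQ0 : PowBd x 402 Q0) (bQ1 : PowBd x 402 Q1)
    (bδ : PowBd x 101 δ) (bu : PowBd x 120 u) :
    PowBd x (-80) ((h0 * E0 + h1 * E1 + δ) * (h0 * E0 + h1 * E1 + δ - 2 * n * δ) /
        (2 * n ^ 2 * (n - 1)) -
      (-(2 * u) * (h0 * E0) / (h * (n - 1)) +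
        (2 * u - δ + 1) * (h1 * E1) / ((n - h) * (n - 1))) -
      (Q0 + Q1) / (2 * (n - 1) ^ 2) +
      ((h0 * Q0 - (h0 * E0) ^ 2) / (2 * n * h * (n - 1)) +
        (h1 * Q1 - (h1 * E1) ^ 2) / (2 * n * (n - h) * (n - 1))) -
      (2 * (E0 - E1) * u / n - (E0 - E1) * h * δ / n ^ 2 -
        (E0 - E1) ^ 2 * (h * (n - h)) / (2 * n ^ 3))) := by
  have hx0 : 0 < x := by linarith
  have hl : (10000 : ℝ) ≤ x ^ 199 := by
    have : x ^ 1 ≤ x ^ 199 := pow_le_pow_right₀ (by linarith) (by norm_num)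
    linarith
  have hh2 : 0 < h := by linarith
  have hh3 : 0 < n - h := by linarith
  have hn0 : 0 < n := by linarith
  have hN : 0 < n - 1 := by linarith
  have bη0 := shift_quotient_bd hx hn hh (by linarith) hh0
  have bη1 := shift_quotient_bd hx hn hh' (by linarith) hh1
  have bν := inv_pred_sub_bd hx hn
  have zn : x ^ (200 : ℤ) = n := by rw [hn]; norm_cast
  have bni : PowBd x (-200) n⁻¹ := PowBd.inv hx (by rw [neg_neg, zn])
  have bn : PowBd x 200 n := by rw [PowBd, zn, abs_of_pos hn0]
  have bh : PowBd x 200 h := by rw [PowBd, zn, abs_of_pos hh2]; linarith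
  have bh' : PowBd x 200 (n - h) := by rw [PowBd, zn, abs_of_pos hh3]; linarith
  have bσ0 : PowBd x 1 (h0 - h) := PowBd.const hx (by linarith)
  have bσ1 : PowBd x 1 (h1 - (n - h)) := PowBd.const hx (by linarith)
  have T1 := first_term_bd hx hn0 bn bni bh bh' bE0 bE1 bσ0 bσ1 bδ bν
  have T2 := second_term_bd hx bni bE0 bE1 bu bδ bη0 bη1
  have T3 := third_term_bd hx bni bh bE0 bσ0 bQ0 bη0 bν
  have T4 := third_term_bd hx bni bh' bE1 bσ1 bQ1 bη1 bν
  have T := ((T1.add hx T2 (k := -89) (by norm_num) (by norm_num)).add hx T3 (k := -88)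
      (by norm_num)
    (by norm_num)).add hx T4 (k := -80) (by norm_num) (by norm_num)
  convert T using 1
  simp only [add_sub_cancel]
  field_simp
  ring

lemma abs_log_one_add_sub_le {z : ℝ} (hz : |z| ≤ 1 / 2) : |Real.log (1 + z) - z| ≤ 2 * z ^ 2 := by
  rw [abs_le] at hz
  have h0 : 0 < 1 + z := by linarith
  have h1 := Real.log_le_sub_one_of_pos h0
  have h2 := Real.one_sub_inv_le_log_of_pos h0
  have h3 : 1 - (1 + z)⁻¹ = z - z ^ 2 / (1 + z) := by field_simp; ring
  have h4 : z ^ 2 / (1 + z) ≤ 2 * z ^ 2 := by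
    rw [div_le_iff₀ h0]; nlinarith [sq_nonneg z]
  rw [abs_le]
  constructor <;> nlinarith [sq_nonneg z]

lemma abs_sub_le_of_step {g : ℕ → ℝ} {ε : ℝ} {s t : ℕ} (hst : s ≤ t)
    (h : ∀ i, s ≤ i → i < t → |g (i + 1) - g i| ≤ ε) : |g t - g s| ≤ ε * |(t : ℝ) - s| := by
  have : |g t - g s| ≤ ε * ((t : ℝ) - s) := by
    induction t, hst using Nat.le_induction with
    | base => simp
    | succ t hst ih =>
      have h1 := ih fun i hi hit => h i hi (by omega)
      have h2 := h t hst (by omega)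
      have := abs_add_le (g (t + 1) - g t) (g t - g s)
      rw [sub_add_sub_cancel] at this
      push_cast
      linarith
  rwa [abs_of_nonneg (a := (t : ℝ) - s) (by
    have : (s : ℝ) ≤ t := by exact_mod_cast hst
    linarith)]

lemma log_choose_succ_bd {x : ℝ} {h m t : ℕ} (hx : 10000 ≤ x) (hh : x ^ 198 ≤ (h : ℝ))
    (hu : |(t : ℝ) - h / 2| ≤ 2 * x ^ 120) (hm : |(m : ℝ) - h| ≤ 2 * x ^ 102) :
    0 < m.choose t ∧ PowBd x (-145) (Real.log ((m + 1).choose t) - Real.log (m.choose t) -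
      (Real.log 2 - ((m : ℝ) + 1 - h - 2 * (t - h / 2)) / h)) := by
  have hx0 : 0 < x := by linarith
  have hx1 : 1 ≤ x := by linarith
  have c1 : (10000 : ℝ) * x ^ 120 ≤ h := by
    have e : x ^ 198 = x ^ 120 * x ^ 78 := by ring
    have h2 : x ^ 1 ≤ x ^ 78 := pow_le_pow_right₀ hx1 (by norm_num)
    have := mul_le_mul_of_nonneg_left (show (10000 : ℝ) ≤ x ^ 78 by linarith) (pow_pos hx0 120).le
    linarith
  have c2 : x ^ 102 ≤ x ^ 120 := pow_le_pow_right₀ hx1 (by norm_num)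
  have c3 : (1 : ℝ) ≤ x ^ 120 := one_le_pow₀ hx1
  have hh0 : 0 < (h : ℝ) := by linarith
  have b2 : PowBd x 1 (2 : ℝ) := PowBd.const hx (by norm_num)
  have b1 : PowBd x 1 (1 : ℝ) := PowBd.const hx (by norm_num)
  have bu : PowBd x 121 ((t : ℝ) - h / 2) := by
    have : PowBd x (121 : ℕ) ((t : ℝ) - h / 2) := PowBd.of_pow (hu.trans (by
      rw [show x ^ 121 = x ^ 120 * x by ring]; nlinarith))
    exact_mod_cast this
  have bm : PowBd x 103 ((m : ℝ) - h) := by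
    have : PowBd x (103 : ℕ) ((m : ℝ) - h) := PowBd.of_pow (hm.trans (by
      rw [show x ^ 103 = x ^ 102 * x by ring]; nlinarith [pow_pos hx0 102]))
    exact_mod_cast this
  rw [abs_le] at hu hm
  have hmt : t ≤ m := by
    have : (t : ℝ) ≤ m := by linarith [hu.2, hm.1]
    exact_mod_cast this
  have hpos : 0 < m.choose t := Nat.choose_pos hmt
  refine ⟨hpos, ?_⟩
  have hpos' : 0 < (m + 1).choose t := Nat.choose_pos (by omega)
  have hrec : ((m + 1).choose t : ℝ) * ((m : ℝ) + 1 - t) = m.choose t * ((m : ℝ) + 1) := by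
    have := Nat.choose_mul_succ_eq m t
    have h2 : ((m + 1 - t : ℕ) : ℝ) = (m : ℝ) + 1 - t := by
      rw [Nat.cast_sub (by omega)]; push_cast; ring
    rw [← h2]
    exact_mod_cast this.symm
  have hm1 : (0 : ℝ) < (m : ℝ) + 1 := by positivity
  have hmt' : (0 : ℝ) < (m : ℝ) + 1 - t := by
    have : (t : ℝ) ≤ m := by exact_mod_cast hmt
    linarith
  set w := (m : ℝ) + 1 - h - 2 * (t - h / 2) with hw
  have e1 : Real.log ((m + 1).choose t) - Real.log (m.choose t) =
      Real.log 2 - Real.log (1 + w * ((m : ℝ) + 1)⁻¹) := by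
    have p1 : (0 : ℝ) < m.choose t := by exact_mod_cast hpos
    have p2 : (0 : ℝ) < (m + 1).choose t := by exact_mod_cast hpos'
    have e2 : 1 + w * ((m : ℝ) + 1)⁻¹ = 2 * ((m : ℝ) + 1 - t) / (m + 1) := by
      rw [hw]; field_simp; ring
    rw [e2, Real.log_div (by positivity) hm1.ne', Real.log_mul (by norm_num) hmt'.ne']
    have := congrArg Real.log hrec
    rw [Real.log_mul p2.ne' hmt'.ne', Real.log_mul p1.ne' hm1.ne'] at this
    linarith
  have bw : PowBd x 123 w := by
    have := ((bm.add hx b1 (k := 121) (by norm_num) (by norm_num)).sub hx (b2.mul' hx bu)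
      (k := 123) (by norm_num) (by norm_num))
    convert this using 1
    rw [hw]; ring
  have zz : x ^ (197 : ℤ) = x ^ 197 := by norm_cast
  have e3 : x ^ 197 ≤ x ^ 198 / 2 := by
    rw [show x ^ 198 = x ^ 197 * x by ring]; nlinarith [pow_pos hx0 197]
  have bi : PowBd x (-197) ((m : ℝ) + 1)⁻¹ := PowBd.inv hx (by
    rw [neg_neg, zz]; linarith [hm.1])
  have bhi : PowBd x (-197) (h : ℝ)⁻¹ := PowBd.inv hx (by
    rw [neg_neg, zz]; linarith)
  have bz : PowBd x (-74) (w * ((m : ℝ) + 1)⁻¹) := bw.mul hx bi (by norm_num)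
  have hz : |w * ((m : ℝ) + 1)⁻¹| ≤ 1 / 2 := by
    have : |w * ((m : ℝ) + 1)⁻¹| ≤ (x ^ 1)⁻¹ :=
        (bz.mono hx (show (-74 : ℤ) ≤ -(1 : ℕ) by norm_num)).le_inv
    refine this.trans ?_
    rw [pow_one, inv_le_comm₀ hx0 (by norm_num)]
    linarith
  have hlog := abs_log_one_add_sub_le hz
  have blog : PowBd x (-147) (Real.log (1 + w * ((m : ℝ) + 1)⁻¹) - w * ((m : ℝ) + 1)⁻¹) := by
    have h2 : PowBd x (-147) (2 * ((w * ((m : ℝ) + 1)⁻¹) * (w * ((m : ℝ) + 1)⁻¹))) :=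
      b2.mul hx (bz.mul' hx bz) (by norm_num)
    refine le_trans (hlog.trans ?_) h2
    rw [← sq]
    exact le_abs_self _
  have blast : PowBd x (-160) (w * ((m : ℝ) - h + 1) * (((m : ℝ) + 1)⁻¹ * (h : ℝ)⁻¹)) :=
    (bw.mul' hx (bm.add hx b1 (k := 104) (by norm_num) (by norm_num))).mul hx (bi.mul' hx bhi)
      (by norm_num)
  have := (blast.sub hx blog (k := -145) (by norm_num) (by norm_num))
  rw [e1]
  convert this using 1
  field_simp
  ring

lemma log_choose_sub_bd {x : ℝ} {h a t : ℕ} (hx : 10000 ≤ x) (hh : x ^ 198 ≤ (h : ℝ))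
    (hu : |(t : ℝ) - h / 2| ≤ 2 * x ^ 120) (ha : |(a : ℝ) - h| ≤ x ^ 102) :
    PowBd x (-42) (Real.log (a.choose t) - Real.log (h.choose t) -
      (((a : ℝ) - h) * Real.log 2 +
        (2 * (t - h / 2) * (a - h) - ((a : ℝ) - h) * (a - h + 1) / 2) / h)) := by
  have hx0 : 0 < x := by linarith
  have hh0 : 0 < (h : ℝ) := lt_of_lt_of_le (by positivity) hh
  set g : ℕ → ℝ := fun m => Real.log (m.choose t) -
    (((m : ℝ) - h) * Real.log 2 +
        (2 * (t - h / 2) * (m - h) - ((m : ℝ) - h) * (m - h + 1) / 2) / h) with hg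
  have hstep : ∀ m : ℕ, |(m : ℝ) - h| ≤ 2 * x ^ 102 → |g (m + 1) - g m| ≤ x ^ (-145 : ℤ) := by
    intro m hm
    have := (log_choose_succ_bd hx hh hu hm).2
    rw [PowBd] at this
    convert this using 2
    rw [hg]
    push_cast
    field_simp
    ring
  have key : |g a - g h| ≤ x ^ (-145 : ℤ) * |(a : ℝ) - h| := by
    rw [abs_le] at ha
    have hp := pow_pos hx0 102
    rcases le_total h a with hle | hle
    · refine abs_sub_le_of_step hle fun i hi hia => hstep i ?_
      have h1 : (h : ℝ) ≤ i := by exact_mod_cast hi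
      have h2 : (i : ℝ) ≤ a := by exact_mod_cast hia.le
      rw [abs_le]
      constructor <;> linarith
    · rw [abs_sub_comm, abs_sub_comm (a : ℝ)]
      refine abs_sub_le_of_step hle fun i hi hia => hstep i ?_
      have h1 : (a : ℝ) ≤ i := by exact_mod_cast hi
      have h2 : (i : ℝ) ≤ h := by exact_mod_cast hia.le
      rw [abs_le]
      constructor <;> linarith
  have h3 : PowBd x (-145) (x ^ (-145 : ℤ)) := le_of_eq (abs_of_pos (by positivity))
  have h4 : PowBd x 102 ((a : ℝ) - h) := by
    have : PowBd x (102 : ℕ) ((a : ℝ) - h) := PowBd.of_pow ha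
    exact_mod_cast this
  have h5 := h3.mul hx h4 (show (-145 : ℤ) + 102 ≤ -42 by norm_num)
  have h6 : PowBd x (-42) (g a - g h) := by
    refine le_trans (key.trans (le_of_eq ?_)) h5
    rw [abs_mul, abs_of_pos (show 0 < x ^ (-145 : ℤ) by positivity)]
  convert h6 using 1
  rw [hg]
  simp
  ring

lemma shifted_main_term_bd {x n h r δ u Δ μ ρ ε : ℝ} (hx : 10000 ≤ x) (hh : 0 < h) (hh' : 0 < n - h)
    (hn : 0 < n) (hρ : ρ = r * (h * (n - h)) / n ^ 2) (hΔ : Δ = ρ + ε) (bε : PowBd x 1 ε)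
    (bu : PowBd x 121 u) (bδ : PowBd x 102 δ) (bΔ : PowBd x 103 Δ) (bρ : PowBd x 103 ρ)
    (bh : PowBd x (-199) h⁻¹) (bh' : PowBd x (-199) (n - h)⁻¹) (bμ : PowBd x (-397) μ) :
    PowBd x (-50) ((2 * u * Δ - Δ * (Δ + 1) / 2) / h +
      (2 * (δ / 2 - u) * (-Δ) - (-Δ) * (-Δ + 1) / 2) * ((n - h)⁻¹ + μ) -
      (2 * r * u / n - r * h * δ / n ^ 2 - r ^ 2 * (h * (n - h)) / (2 * n ^ 3))) := by
  have b2 : PowBd x 1 (2 : ℝ) := PowBd.const hx (by norm_num)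
  have b1 : PowBd x 1 (1 : ℝ) := PowBd.const hx (by norm_num)
  have b2' : PowBd x 1 (1 / 2 : ℝ) := PowBd.const hx (by norm_num [abs_of_pos])
  have e : (2 * u * Δ - Δ * (Δ + 1) / 2) / h +
      (2 * (δ / 2 - u) * (-Δ) - (-Δ) * (-Δ + 1) / 2) * ((n - h)⁻¹ + μ) -
      (2 * r * u / n - r * h * δ / n ^ 2 - r ^ 2 * (h * (n - h)) / (2 * n ^ 3)) =
      (2 * u * ε - ε * (2 * ρ + ε) * (1 / 2)) * (h⁻¹ + (n - h)⁻¹) - δ * ε * (n - h)⁻¹ -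
        Δ * (1 / 2) * (h⁻¹ - (n - h)⁻¹) + μ * (Δ * (2 * u - δ - (Δ - 1) * (1 / 2))) := by
    rw [hΔ, hρ]
    field_simp
    ring
  rw [e]
  have k1 : PowBd x (-198) (h⁻¹ + (n - h)⁻¹) := bh.add hx bh' (by norm_num) (by norm_num)
  have k2 : PowBd x (-198) (h⁻¹ - (n - h)⁻¹) := bh.sub hx bh' (by norm_num) (by norm_num)
  have k3 : PowBd x 126 (2 * u * ε - ε * (2 * ρ + ε) * (1 / 2)) :=
    ((b2.mul' hx bu).mul' hx bε).sub hx ((bε.mul' hx ((b2.mul' hx bρ).add hx bε (k := 105)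
      (by norm_num) (by norm_num))).mul' hx b2') (by norm_num) (by norm_num)
  have k4 : PowBd x 126 (2 * u - δ - (Δ - 1) * (1 / 2)) :=
    ((b2.mul' hx bu).sub hx bδ (k := 124) (by norm_num) (by norm_num)).sub hx
      ((bΔ.sub hx b1 (k := 105) (by norm_num) (by norm_num)).mul' hx b2') (by norm_num)
          (by norm_num)
  exact (((k3.mul' hx k1).sub hx ((bδ.mul' hx bε).mul' hx bh') (k := -60) (by norm_num)
    (by norm_num)).sub hx ((bΔ.mul' hx b2').mul' hx k2) (k := -55) (by norm_num)
        (by norm_num)).add hx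
      (bμ.mul' hx (bΔ.mul' hx k4)) (by norm_num) (by norm_num)

/-- The change of a product of two binomial coefficients under a shift of the upper indices. -/
lemma log_choose_mul_bd {x n r δ : ℝ} {h h₁ a b t s : ℕ} (hx : 10000 ≤ x) (hn : n = x ^ 200)
    (hh : x ^ 199 ≤ (h : ℝ)) (hh' : x ^ 199 ≤ n - h) (hh1 : (h₁ : ℝ) = n - h - 1)
    (hab : (a : ℝ) + b = n - 1) (hts : 2 * ((t : ℝ) + s) = n - 1 + δ) (hδ : |δ| ≤ x ^ 101)
    (hu : |(t : ℝ) - h / 2| ≤ x ^ 120) (hr : |r| ≤ 2 * x ^ 101)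
    (ha : |(a : ℝ) - h - r * (h * (n - h)) / n ^ 2| ≤ 1) :
    0 < a.choose t ∧ 0 < b.choose s ∧ 0 < h.choose t ∧ 0 < h₁.choose s ∧
    PowBd x (-40) (Real.log (a.choose t) + Real.log (b.choose s) -
      (Real.log (h.choose t) + Real.log (h₁.choose s)) -
      (2 * r * (t - h / 2) / n - r * h * δ / n ^ 2 - r ^ 2 * (h * (n - h)) / (2 * n ^ 3))) := by
  have hx0 : 0 < x := by linarith
  have hx1 : 1 ≤ x := by linarith
  have hl : (10000 : ℝ) ≤ x ^ 198 := by
    have : x ^ 1 ≤ x ^ 198 := pow_le_pow_right₀ (by linarith) (by norm_num)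
    linarith
  have e3 : x ^ 198 ≤ x ^ 199 / 2 := by
    rw [show x ^ 199 = x ^ 198 * x by ring]; nlinarith [pow_pos hx0 198]
  have c1 : 100 * x ^ 101 ≤ x ^ 102 := by
    have := mul_le_mul_of_nonneg_left (show (100 : ℝ) ≤ x by linarith) (pow_pos hx0 101).le
    have e : x ^ 102 = x ^ 101 * x := by ring
    linarith
  have c2 : (100 : ℝ) ≤ x ^ 101 := by
    have : x ^ 1 ≤ x ^ 101 := pow_le_pow_right₀ (by linarith) (by norm_num)
    linarith
  have c3 : x ^ 102 ≤ x ^ 120 := pow_le_pow_right₀ hx1 (by norm_num)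
  have c4 : 100 * x ^ 120 ≤ x ^ 198 := by
    have e : x ^ 198 = x ^ 120 * x ^ 78 := by ring
    have h2 : x ^ 1 ≤ x ^ 78 := pow_le_pow_right₀ hx1 (by norm_num)
    have := mul_le_mul_of_nonneg_left (show (100 : ℝ) ≤ x ^ 78 by linarith) (pow_pos hx0 120).le
    linarith
  have hn0 : 0 < n := by linarith
  have hh0 : 0 < (h : ℝ) := by linarith
  have hz : 0 ≤ (h : ℝ) * (n - h) := mul_nonneg hh0.le (by linarith)
  have hrr : |r * (h * (n - h)) / n ^ 2| ≤ 2 * x ^ 101 := by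
    rw [abs_div, abs_mul, abs_of_pos (show 0 < n ^ 2 by positivity), abs_of_nonneg hz,
      div_le_iff₀ (by positivity)]
    exact mul_le_mul hr (by nlinarith) hz (by positivity)
  have ha' : |(a : ℝ) - h| ≤ 2 * x ^ 101 + 1 := by
    have h2 := abs_add_le ((a : ℝ) - h - r * (h * (n - h)) / n ^ 2) (r * (h * (n - h)) / n ^ 2)
    rw [sub_add_cancel] at h2
    linarith
  have hb' : |(b : ℝ) - h₁| ≤ 2 * x ^ 101 + 1 := by
    rw [show (b : ℝ) - h₁ = -((a : ℝ) - h) by linarith, abs_neg]; exact ha'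
  have hus : (s : ℝ) - h₁ / 2 = δ / 2 - (t - h / 2) := by linarith
  have hu2 : |(s : ℝ) - h₁ / 2| ≤ 2 * x ^ 120 := by
    rw [hus]
    rw [abs_le] at hδ hu ⊢
    constructor <;> linarith
  have hh1' : x ^ 198 ≤ (h₁ : ℝ) := by linarith
  have hu1 : |(t : ℝ) - h / 2| ≤ 2 * x ^ 120 := by linarith [pow_pos hx0 120]
  have B1 := log_choose_sub_bd hx (by linarith) hu1 (ha'.trans (by linarith))
  have B2 := log_choose_sub_bd hx hh1' hu2 (hb'.trans (by linarith))
  have P1 : ∀ k : ℕ, x ^ 198 ≤ (k : ℝ) → ∀ j : ℕ, |(j : ℝ) - k| ≤ 2 * x ^ 101 + 1 → ∀ i : ℕ,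
      |(i : ℝ) - k / 2| ≤ 2 * x ^ 120 → 0 < j.choose i := by
    intro k hk j hj i hi
    exact (log_choose_succ_bd hx hk hi (hj.trans (by linarith))).1
  refine ⟨P1 h (by linarith) a ha' t hu1, P1 h₁ hh1' b hb' s hu2, P1 h (by linarith) h
      (by simp; linarith) t hu1,
    P1 h₁ hh1' h₁ (by simp; linarith) s hu2, ?_⟩
  have bm : ∀ z : ℝ, ∀ k : ℕ, |z| ≤ x ^ k → PowBd x k z := fun z k hz => PowBd.of_pow hz
  have zz : x ^ (199 : ℤ) = x ^ 199 := by norm_cast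
  have zz' : x ^ (198 : ℤ) = x ^ 198 := by norm_cast
  have bh : PowBd x (-199) (h : ℝ)⁻¹ := PowBd.inv hx (by rw [neg_neg, zz]; exact hh)
  have bh' : PowBd x (-199) (n - h : ℝ)⁻¹ := PowBd.inv hx (by rw [neg_neg, zz]; exact hh')
  have bh1 : PowBd x (-198) (h₁ : ℝ)⁻¹ := PowBd.inv hx (by rw [neg_neg, zz']; exact hh1')
  have hh1p : 0 < (h₁ : ℝ) := by linarith
  have hhp : 0 < n - (h : ℝ) := by linarith
  have eμ : (h₁ : ℝ)⁻¹ = (n - h : ℝ)⁻¹ + (h₁ : ℝ)⁻¹ * (n - h : ℝ)⁻¹ := by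
    have : n - (h : ℝ) = h₁ + 1 := by linarith
    rw [this] at hhp ⊢
    field_simp
  have c5 : x ^ 120 ≤ x ^ 121 := pow_le_pow_right₀ hx1 (by norm_num)
  have c6 : x ^ 102 ≤ x ^ 103 := pow_le_pow_right₀ hx1 (by norm_num)
  have B3 := shifted_main_term_bd (δ := δ) (r := r) hx hh0 hhp hn0 rfl
    (show (a : ℝ) - h = r * (h * (n - h)) / n ^ 2 + (a - h - r * (h * (n - h)) / n ^ 2) by ring)
    (PowBd.const hx (by linarith)) (bm _ 121 (hu.trans c5)) (bm _ 102 (by linarith))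
    (bm _ 103 (by linarith)) (bm _ 103 (by linarith)) bh bh' (bh1.mul hx bh' (by norm_num))
  rw [← eμ] at B3
  have := (B1.add hx B2 (k := -41) (by norm_num) (by norm_num)).add hx B3 (k := -40) (by norm_num)
    (by norm_num)
  convert this using 1
  have e1 : (b : ℝ) - h₁ = -((a : ℝ) - h) := by linarith
  rw [hus, e1]
  ring

/-- The point probabilities of a hypergeometric distribution. -/
noncomputable def hypergeom (a b D t : ℕ) : ℝ :=
  (a.choose t : ℝ) * (b.choose (D - t) : ℝ) / ((a + b).choose D : ℝ)

lemma hypergeom_nonneg (a b D t : ℕ) : 0 ≤ hypergeom a b D t := by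
  unfold hypergeom; positivity

lemma sum_hypergeom {a b D : ℕ} (hD : D ≤ a + b) : ∑ t ∈ range (D + 1), hypergeom a b D t = 1 := by
  have h1 := Nat.add_choose_eq a b D
  rw [Finset.Nat.sum_antidiagonal_eq_sum_range_succ (fun i j => a.choose i * b.choose j)] at h1
  unfold hypergeom
  rw [← Finset.sum_div, div_eq_one_iff_eq]
  · rw [h1]; push_cast; rfl
  · have := Nat.choose_pos hD
    positivity

lemma choose_mul_sub_cast (a t : ℕ) :
    (a.choose t : ℝ) * ((a : ℝ) - t) = a.choose (t + 1) * ((t : ℝ) + 1) := by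
  rcases le_or_gt t a with h | h
  · have := Nat.choose_succ_right_eq a t
    rw [← Nat.cast_sub h]
    exact_mod_cast this.symm
  · rw [Nat.choose_eq_zero_of_lt h, Nat.choose_eq_zero_of_lt (by omega)]; simp

lemma hypergeom_isNearBalanced {n x : ℝ} {a b D : ℕ} (hx : 0 ≤ x) (hD : D ≤ a + b) :
    IsNearBalanced n x a b 0 D (hypergeom a b D) := by
  refine ⟨fun t ht => ⟨hypergeom_nonneg _ _ _ _, ?_⟩, fun t ht => ?_⟩
  · rw [← sum_hypergeom hD]
    exact Finset.single_le_sum (fun i _ => hypergeom_nonneg a b D i) (mem_range.2 (by omega))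
  · have h1 := choose_mul_sub_cast a t
    have h2 := choose_mul_sub_cast b (D - (t + 1))
    have e1 : D - (t + 1) + 1 = D - t := by omega
    have e2 : ((D - (t + 1) : ℕ) : ℝ) = D - t - 1 := by
      rw [Nat.cast_sub (by omega)]; push_cast; ring
    rw [e1, e2] at h2
    have h3 : hypergeom a b D t * (((D : ℝ) - t) * (a - t) * (n + 0)) -
        hypergeom a b D (t + 1) * ((t + 1) * (b - D + t + 1) * (n - 0)) = 0 := by
      unfold hypergeom
      have : (a.choose t : ℝ) * (b.choose (D - t)) * (((D : ℝ) - t) * (a - t)) =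
          (a.choose (t + 1) : ℝ) * (b.choose (D - (t + 1))) * ((t + 1) * (b - D + t + 1)) := by
        calc _ = ((a.choose t : ℝ) * ((a : ℝ) - t)) *
            (b.choose (D - t) * ((D : ℝ) - t - 1 + 1)) := by
              ring
          _ = _ := by rw [h1, ← h2]; ring
      rw [div_mul_eq_mul_div, div_mul_eq_mul_div, ← sub_div, div_eq_zero_iff]
      left
      linear_combination n * this
    rw [h3, abs_zero]
    have := hypergeom_nonneg a b D t
    have := hypergeom_nonneg a b D (t + 1)
    positivity

section LambdaTerms

variable {n : ℕ} {d : Fin n → ℕ} {v : Fin n} {S : Finset (Fin n)}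

lemma disjoint_erase_compl (S : Finset (Fin n)) (v : Fin n) : Disjoint (S.erase v) (Sᶜ.erase v) :=
  (disjoint_compl_right (a := S)).mono (erase_subset _ _) (erase_subset _ _)

lemma erase_union_erase_compl (S : Finset (Fin n)) (v : Fin n) :
    S.erase v ∪ Sᶜ.erase v = univ.erase v := by
  rw [← erase_union_distrib, union_compl]

lemma sum_sum_sub_sq (A : Finset (Fin n)) (f : Fin n → ℝ) :
    ∑ i ∈ A, ∑ j ∈ A, (f i - f j) ^ 2 = 2 * (A.card * ∑ i ∈ A, f i ^ 2 - (∑ i ∈ A, f i) ^ 2) := by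
  have : ∀ i j, (f i - f j) ^ 2 = f i ^ 2 - 2 * (f i * f j) + f j ^ 2 := fun i j => by ring
  simp only [this, sum_add_distrib, sum_sub_distrib, ← mul_sum, sum_const, nsmul_eq_mul, ← sum_mul]
  ring

lemma beta_eq (n : ℕ) (d : Fin n → ℕ) (w : Fin n) :
    beta n d w = degExcess d w / Real.sqrt ((n : ℝ) - 1) := rfl

lemma Lam1_eq (hn : 1 < (n : ℝ)) : Lam1 n d v =
    (∑ w ∈ S.erase v, degExcess d w + ∑ w ∈ Sᶜ.erase v, degExcess d w + degExcess d v) *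
      (∑ w ∈ S.erase v, degExcess d w + ∑ w ∈ Sᶜ.erase v, degExcess d w + degExcess d v -
        2 * n * degExcess d v) / (2 * n ^ 2 * ((n : ℝ) - 1)) := by
  have h1 : ∑ w ∈ S.erase v, degExcess d w + ∑ w ∈ Sᶜ.erase v, degExcess d w + degExcess d v =
      ∑ w, degExcess d w := by
    rw [← sum_union (disjoint_erase_compl S v), erase_union_erase_compl,
      sum_erase_add _ _ (mem_univ v)]
  have h2 : ∑ w, beta n d w = (∑ w, degExcess d w) / Real.sqrt ((n : ℝ) - 1) := by
    simp only [beta_eq, sum_div]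
  have h3 : (0 : ℝ) < (n : ℝ) - 1 := by linarith
  have h4 : 0 < Real.sqrt ((n : ℝ) - 1) := Real.sqrt_pos.2 h3
  have h5 := Real.sq_sqrt h3.le
  rw [Lam1, h1, h2, beta_eq]
  rw [← h5, Real.sqrt_sq h4.le]
  have h6 : (n : ℝ) ≠ 0 := by linarith
  field_simp

lemma Lam2_eq (hn : 1 < (n : ℝ)) (hS : (S.card : ℝ) ≠ 0) (hS' : (n : ℝ) - S.card ≠ 0) (t : ℕ) :
    Lam2 n d v S t = -(2 * ((t : ℝ) - S.card / 2)) * (∑ w ∈ S.erase v, degExcess d w) /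
        (S.card * ((n : ℝ) - 1)) +
      (2 * ((t : ℝ) - S.card / 2) - degExcess d v + 1) * (∑ w ∈ Sᶜ.erase v, degExcess d w) /
        (((n : ℝ) - S.card) * ((n : ℝ) - 1)) := by
  have h3 : (0 : ℝ) < (n : ℝ) - 1 := by linarith
  have h4 : 0 < Real.sqrt ((n : ℝ) - 1) := Real.sqrt_pos.2 h3
  have h5 := Real.sq_sqrt h3.le
  have key : ∀ (c : ℝ) (A : Finset (Fin n)),
      ∑ i ∈ A, c * beta n d i / Real.sqrt ((n : ℝ) - 1) =
        c * (∑ i ∈ A, degExcess d i) / ((n : ℝ) - 1) := by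
    intro c A
    rw [mul_sum, sum_div]
    refine sum_congr rfl fun i _ => ?_
    rw [beta_eq, mul_div_assoc, div_div, ← sq, h5, mul_div_assoc]
  rw [Lam2, key, key]
  have e : degExcess d v = 2 * (d v : ℝ) - (n - 1) := rfl
  rw [e]
  field_simp
  ring

lemma Lam3_eq (hn : 1 < (n : ℝ)) : Lam3 n d v =
    (∑ w ∈ S.erase v, degExcess d w ^ 2 + ∑ w ∈ Sᶜ.erase v, degExcess d w ^ 2) /
      (2 * ((n : ℝ) - 1) ^ 2) := by
  have h3 : (0 : ℝ) < (n : ℝ) - 1 := by linarith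
  have h5 := Real.sq_sqrt h3.le
  rw [Lam3, ← erase_union_erase_compl S v, sum_union (disjoint_erase_compl S v)]
  simp only [beta_eq, div_pow, h5, div_div, ← sum_div]
  field_simp

lemma Lam4_eq (hn : 1 < (n : ℝ)) (hS : (S.card : ℝ) ≠ 0) (hS' : (n : ℝ) - S.card ≠ 0) :
    Lam4 n d v S = ((S.erase v).card * (∑ w ∈ S.erase v, degExcess d w ^ 2) -
        (∑ w ∈ S.erase v, degExcess d w) ^ 2) / (2 * n * S.card * ((n : ℝ) - 1)) +
      ((Sᶜ.erase v).card * (∑ w ∈ Sᶜ.erase v, degExcess d w ^ 2) -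
        (∑ w ∈ Sᶜ.erase v, degExcess d w) ^ 2) / (2 * n * (n - S.card) * ((n : ℝ) - 1)) := by
  have h3 : (0 : ℝ) < (n : ℝ) - 1 := by linarith
  have h5 := Real.sq_sqrt h3.le
  have h6 : (n : ℝ) ≠ 0 := by linarith
  have key : ∀ A : Finset (Fin n), ∑ i ∈ A, ∑ j ∈ A, (beta n d i - beta n d j) ^ 2 =
      2 * (A.card * ∑ i ∈ A, degExcess d i ^ 2 - (∑ i ∈ A, degExcess d i) ^ 2) / ((n : ℝ) - 1) := by
    intro A
    rw [sum_sum_sub_sq]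
    simp only [beta_eq, div_pow, h5, ← sum_div]
    field_simp
  rw [Lam4, key, key]
  field_simp
  ring

end LambdaTerms

section DegreeDistribution

variable {n : ℕ} {x : ℝ} {d : Fin n → ℕ}

lemma degree_le_of_excess (hx : 10000 ≤ x) (hn : (n : ℝ) = x ^ 200)
    (hd : ∀ w, |degExcess d w| ≤ x ^ 101) (v : Fin n) : d v ≤ n - 1 := by
  have h := hd v
  rw [degExcess, abs_le] at h
  have h1 : x ^ 101 + 1 ≤ x ^ 200 := by
    have e : x ^ 200 = x ^ 101 * x ^ 99 := by ring
    have h2 : x ^ 1 ≤ x ^ 99 := pow_le_pow_right₀ (by linarith) (by norm_num)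
    have h3 : (1 : ℝ) ≤ x ^ 101 := one_le_pow₀ (by linarith)
    have := mul_le_mul_of_nonneg_left (show (2 : ℝ) ≤ x ^ 99 by linarith)
        (by linarith : 0 ≤ x ^ 101)
    linarith
  have h2 : (d v : ℝ) + 1 ≤ n := by linarith [h.2]
  have h3 : d v + 1 ≤ n := by exact_mod_cast h2
  omega

lemma degSeqGraphs_nonempty (hx : 10000 ≤ x) (hn : (n : ℝ) = x ^ 200) (hlog : Real.log n ≤ x)
    (heven : Even (∑ w, d w)) (hd : ∀ w, |degExcess d w| ≤ x ^ 101) :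
    (degSeqGraphs n d).Nonempty := by
  have hn0 : 0 < n := by
    have : 0 < (n : ℝ) := by rw [hn]; exact pow_pos (by linarith) _
    exact_mod_cast this
  let v : Fin n := ⟨0, hn0⟩
  have h1 := degree_le_of_excess hx hn hd v
  have h2 : d v ≤ (univ.erase v).card := by rw [card_erase_of_mem (mem_univ v)]; simpa using h1
  obtain ⟨T, hT, hTc⟩ := exists_subset_card_eq h2
  have h3 := card_degSeqGraphs_nbhd_ge n x hx hn hlog d heven hd v T hT hTc
  have h4 := (Real.exp_pos _).trans_le h3
  have h5 : 0 < _ := Nat.cast_pos.1 h4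
  obtain ⟨G, hG⟩ := card_pos.1 h5
  exact ⟨G, (mem_filter.1 hG).1⟩

lemma degProb_nonneg (d : Fin n → ℕ) (S : Finset (Fin n)) (v : Fin n) (t : ℕ) :
    0 ≤ degProb n d S v t := by
  unfold degProb; positivity

lemma degProb_le_one (d : Fin n → ℕ) (S : Finset (Fin n)) (v : Fin n) (t : ℕ) :
    degProb n d S v t ≤ 1 := by
  unfold degProb
  apply div_le_one_of_le₀ _ (by positivity)
  exact_mod_cast card_le_card (filter_subset _ _)

lemma degIn_mono (G : SimpleGraph (Fin n)) {A B : Finset (Fin n)} (h : A ⊆ B) (v : Fin n) :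
    degIn G A v ≤ degIn G B v :=
  card_le_card (filter_subset_filter _ h)

lemma sum_degProb (h : (degSeqGraphs n d).Nonempty) (S : Finset (Fin n)) (v : Fin n) :
    ∑ t ∈ range (d v + 1), degProb n d S v t = 1 := by
  unfold degProb
  rw [← sum_div, div_eq_one_iff_eq (by have := card_pos.2 h; positivity)]
  have h2 := card_eq_sum_card_fiberwise (s := degSeqGraphs n d) (t := range (d v + 1))
    (f := fun G => degIn G S v) (fun G hG => by
      have hG' : G ∈ degSeqGraphs n d := hG
      simp only [degSeqGraphs, mem_filter, mem_univ, true_and] at hG'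
      have := degIn_mono G (subset_univ S) v
      rw [hG' v] at this
      simp only [coe_range, Set.mem_Iio]
      omega)
  rw [h2]
  push_cast
  rfl

lemma degProb_eq (d : Fin n → ℕ) (S : Finset (Fin n)) (v : Fin n) (t : ℕ) :
    degProb n d S v t =
      ((fiberGraphs d (S.erase v) v t).card : ℝ) / (degSeqGraphs n d).card := by
  unfold degProb fiberGraphs
  simp only [degIn_erase_self]

lemma card_erase_bd (A : Finset (Fin n)) (v : Fin n) :
    |((A.erase v).card : ℝ) - A.card| ≤ 1 := by
  have h1 := card_erase_le (s := A) (a := v)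
  have h2 := pred_card_le_card_erase (s := A) (a := v)
  have h3 : ((A.erase v).card : ℝ) ≤ A.card := by exact_mod_cast h1
  have h4 : (A.card : ℝ) ≤ (A.erase v).card + 1 := by
    have : A.card ≤ (A.erase v).card + 1 := by omega
    exact_mod_cast this
  rw [abs_le]
  constructor <;> linarith

lemma card_compl_cast (S : Finset (Fin n)) : (Sᶜ.card : ℝ) = n - S.card := by
  have h := card_add_card_compl S
  rw [Fintype.card_fin] at h
  have : (S.card : ℝ) + Sᶜ.card = n := by exact_mod_cast h
  linarith

lemma card_erase_add_card_erase_compl (S : Finset (Fin n)) (v : Fin n) :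
    ((S.erase v).card : ℝ) + (Sᶜ.erase v).card = n - 1 := by
  have h := card_union_of_disjoint (disjoint_erase_compl S v)
  rw [erase_union_erase_compl, card_erase_of_mem (mem_univ v), card_univ, Fintype.card_fin] at h
  have hn : 0 < n := v.pos
  have : (S.erase v).card + (Sᶜ.erase v).card + 1 = n := by omega
  have : ((S.erase v).card : ℝ) + (Sᶜ.erase v).card + 1 = n := by exact_mod_cast this
  linarith

/-- The average excess degree over a set. -/
noncomputable def avgExcess (d : Fin n → ℕ) (A : Finset (Fin n)) : ℝ :=
  (∑ w ∈ A, degExcess d w) / A.card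

lemma abs_avgExcess_le {D : ℝ} (hD : 0 ≤ D) (hd : ∀ w, |degExcess d w| ≤ D) (A : Finset (Fin n)) :
    |avgExcess d A| ≤ D := by
  rw [avgExcess, abs_div, abs_of_nonneg (show (0 : ℝ) ≤ A.card by positivity)]
  apply div_le_of_le_mul₀ (by positivity) hD
  refine (abs_sum_le_sum_abs _ _).trans ((sum_le_card_nsmul _ _ D fun w _ => hd w).trans ?_)
  rw [nsmul_eq_mul, mul_comm]

lemma degProb_isNearBalanced (hx : 10000 ≤ x) (hn : (n : ℝ) = x ^ 200) (hlog : Real.log n ≤ x)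
    (heven : Even (∑ w, d w)) (hd : ∀ w, |degExcess d w| ≤ x ^ 101) (S : Finset (Fin n)) (v : Fin n)
    (hS : x ^ 199 ≤ (S.card : ℝ)) (hS' : x ^ 199 ≤ (n : ℝ) - S.card) :
    IsNearBalanced n x (S.erase v).card (Sᶜ.erase v).card
      (avgExcess d (S.erase v) - avgExcess d (Sᶜ.erase v)) (d v) (degProb n d S v) := by
  have hx0 : 0 < x := by linarith
  have hl : (2 : ℝ) ≤ x ^ 199 := by
    have : x ^ 1 ≤ x ^ 199 := pow_le_pow_right₀ (by linarith) (by norm_num)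
    linarith
  have key : ∀ A : Finset (Fin n), x ^ 199 ≤ (A.card : ℝ) → (n : ℝ) ≤ 2 * x * (A.erase v).card := by
    intro A hA
    have h1 := (abs_le.1 (card_erase_bd A v)).1
    have h2 : x ^ 199 / 2 ≤ ((A.erase v).card : ℝ) := by linarith
    have := mul_le_mul_of_nonneg_left h2 (show 0 ≤ 2 * x by linarith)
    refine le_trans (le_of_eq ?_) this
    rw [hn]; ring
  have hA := key S hS
  have hB := key Sᶜ (by rw [card_compl_cast]; exact hS')
  refine ⟨fun t _ => ⟨degProb_nonneg _ _ _ _, degProb_le_one _ _ _ _⟩, fun t ht => ?_⟩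
  obtain ⟨s, hs⟩ : ∃ s, t + (s + 1) = d v := ⟨d v - t - 1, by omega⟩
  have h := abs_card_fiberGraphs_balance_le hx hn hlog heven hd (disjoint_erase_compl S v)
    (erase_union_erase_compl S v) hA hB hs
        (r := avgExcess d (S.erase v) - avgExcess d (Sᶜ.erase v)) rfl
  have e : (d v : ℝ) = t + (s + 1) := by rw [← hs]; push_cast; ring
  have e1 : (d v : ℝ) - t = s + 1 := by rw [e]; ring
  have e2 : ((Sᶜ.erase v).card : ℝ) - d v + t + 1 = (Sᶜ.erase v).card - s := by rw [e]; ring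
  rw [e1, e2, degProb_eq, degProb_eq]
  have hN : 0 < ((degSeqGraphs n d).card : ℝ) := by
    have := card_pos.2 (degSeqGraphs_nonempty hx hn hlog heven hd)
    exact_mod_cast this
  rw [div_mul_eq_mul_div, div_mul_eq_mul_div, ← sub_div, ← add_div, abs_div, abs_of_pos hN,
    ← mul_div_assoc]
  exact div_le_div_of_nonneg_right h hN.le

lemma degProb_tail_le (hx : 10000 ≤ x) (hn : (n : ℝ) = x ^ 200) (hlog : Real.log n ≤ x)
    (heven : Even (∑ w, d w)) (hd : ∀ w, |degExcess d w| ≤ x ^ 101) (S : Finset (Fin n)) (v : Fin n)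
    (hS : x ^ 199 ≤ (S.card : ℝ)) (hS' : x ^ 199 ≤ (n : ℝ) - S.card) {t : ℕ} (ht : t ≤ d v)
    (htu : x ^ 120 < |(t : ℝ) - S.card / 2|) :
    degProb n d S v t ≤ Real.exp (-((t : ℝ) - S.card / 2) ^ 2 / (40 * n)) := by
  have hx0 : 0 < x := by linarith
  have c1 : 100 * x ^ 101 ≤ x ^ 102 := by
    have := mul_le_mul_of_nonneg_left (show (100 : ℝ) ≤ x by linarith) (pow_pos hx0 101).le
    have e : x ^ 102 = x ^ 101 * x := by ring
    linarith
  have c2 : (1 : ℝ) ≤ x ^ 102 := one_le_pow₀ (by linarith)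
  have hl : 0 < x ^ 199 := by positivity
  refine (degProb_isNearBalanced hx hn hlog heven hd S v hS hS').tail hx hn (hd v)
    ((card_erase_bd S v).trans c2) ?_ ?_ (by linarith) (by linarith) ht htu
  · rw [← card_compl_cast]; exact (card_erase_bd Sᶜ v).trans c2
  · have h1 := abs_avgExcess_le (by positivity) hd (S.erase v)
    have h2 := abs_avgExcess_le (by positivity) hd (Sᶜ.erase v)
    refine (abs_sub _ _).trans ?_
    linarith [pow_pos hx0 101]

end DegreeDistribution

lemma abs_div_sub_one_le {p q B ω y : ℝ} (hB : 0 < B) (hq : q = B * Real.exp ω)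
    (hpq : |p - q| ≤ y * q) (hω : |ω| ≤ y) (hy : y ≤ 1 / 10) : |p / B - 1| ≤ 10 * y := by
  have hy0 : 0 ≤ y := (abs_nonneg _).trans hω
  have h1 := Real.abs_exp_sub_one_le (x := ω) (by linarith)
  have h2 : |Real.exp ω - 1| ≤ 2 * y := by linarith
  have h3 : p / B - 1 = (p - q) / B + (Real.exp ω - 1) := by
    rw [hq]; field_simp; ring
  have h4 : |(p - q) / B| ≤ y * Real.exp ω := by
    rw [abs_div, abs_of_pos hB, div_le_iff₀ hB]
    refine hpq.trans (le_of_eq ?_)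
    rw [hq]; ring
  rw [h3]
  refine (abs_add_le _ _).trans ?_
  have h5 : Real.exp ω ≤ 2 := by linarith [(abs_le.1 h2).2]
  nlinarith

lemma lam_bd {n : ℕ} {x : ℝ} {d : Fin n → ℕ} (hx : 10000 ≤ x) (hn : (n : ℝ) = x ^ 200)
    (hd : ∀ w, |degExcess d w| ≤ x ^ 101) (S : Finset (Fin n)) (v : Fin n)
    (hS : x ^ 199 ≤ (S.card : ℝ)) (hS' : x ^ 199 ≤ (n : ℝ) - S.card) {t : ℕ} {r : ℝ}
    (htu : |(t : ℝ) - S.card / 2| ≤ x ^ 120)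
    (hr : r = avgExcess d (S.erase v) - avgExcess d (Sᶜ.erase v)) :
    PowBd x (-80) (Lam1 n d v - Lam2 n d v S t - Lam3 n d v + Lam4 n d v S -
      (2 * r * ((t : ℝ) - S.card / 2) / n - r * S.card * degExcess d v / n ^ 2 -
        r ^ 2 * (S.card * (n - S.card)) / (2 * n ^ 3))) := by
  have hx0 : 0 < x := by linarith
  have hl : (10000 : ℝ) ≤ x ^ 199 := by
    have : x ^ 1 ≤ x ^ 199 := pow_le_pow_right₀ (by linarith) (by norm_num)
    linarith
  have bm : ∀ z : ℝ, ∀ k : ℕ, |z| ≤ x ^ k → PowBd x k z := fun z k hz => PowBd.of_pow hz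
  have bQ : ∀ A : Finset (Fin n), PowBd x 402 (∑ w ∈ A, degExcess d w ^ 2) := by
    intro A
    refine bm _ 402 ?_
    rw [abs_of_nonneg (sum_nonneg fun w _ => sq_nonneg _)]
    refine (sum_le_card_nsmul _ _ ((x ^ 101) ^ 2) fun w _ => ?_).trans ?_
    · rw [← sq_abs]; exact pow_le_pow_left₀ (abs_nonneg _) (hd w) 2
    · rw [nsmul_eq_mul]
      refine (mul_le_mul_of_nonneg_right (card_le_real A) (by positivity)).trans (le_of_eq ?_)
      rw [hn]; ring
  have bE : ∀ A : Finset (Fin n), PowBd x 101 (avgExcess d A) := fun A =>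
    bm _ 101 (abs_avgExcess_le (by positivity) hd A)
  have hc : ∀ A : Finset (Fin n), x ^ 199 ≤ (A.card : ℝ) →
      ((A.erase v).card : ℝ) * avgExcess d (A.erase v) = ∑ w ∈ A.erase v, degExcess d w := by
    intro A hA
    have h1 := (abs_le.1 (card_erase_bd A v)).1
    have : ((A.erase v).card : ℝ) ≠ 0 := by linarith
    rw [avgExcess]; field_simp
  have L := lambda_bd (h0 := (S.erase v).card) (h1 := (Sᶜ.erase v).card) hx hn hS hS'
    (card_erase_bd S v) (by rw [← card_compl_cast]; exact card_erase_bd Sᶜ v)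
    (bE (S.erase v)) (bE (Sᶜ.erase v)) (bQ (S.erase v)) (bQ (Sᶜ.erase v))
    (bm _ 101 (hd v)) (bm _ 120 htu)
  rw [hc S hS, hc Sᶜ (by rw [card_compl_cast]; exact hS'), ← hr] at L
  have hn1 : 1 < (n : ℝ) := by linarith
  have hS0 : (S.card : ℝ) ≠ 0 := by linarith
  have hS0' : (n : ℝ) - S.card ≠ 0 := by linarith
  rw [Lam1_eq (S := S) hn1, Lam2_eq hn1 hS0 hS0', Lam3_eq (S := S) hn1, Lam4_eq hn1 hS0 hS0']
  exact L

lemma degProb_window {n : ℕ} {x : ℝ} {d : Fin n → ℕ} (hx : 10000 ≤ x) (hn : (n : ℝ) = x ^ 200)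
    (hlog : Real.log n ≤ x) (heven : Even (∑ w, d w)) (hd : ∀ w, |degExcess d w| ≤ x ^ 101)
    (S : Finset (Fin n)) (v : Fin n)
    (hS : x ^ 199 ≤ (S.card : ℝ)) (hS' : x ^ 199 ≤ (n : ℝ) - S.card) {t : ℕ} (ht : t ≤ d v)
    (htu : |(t : ℝ) - S.card / 2| ≤ x ^ 120) :
    ∃ θ : ℝ, |θ| ≤ (x ^ 20)⁻¹ ∧ degProb n d S v t =
      (1 + θ) * ((S.card.choose t : ℝ) * ((n - S.card - 1).choose (d v - t) : ℝ) /
        ((n - 1).choose (d v) : ℝ)) *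
          Real.exp (Lam1 n d v - Lam2 n d v S t - Lam3 n d v + Lam4 n d v S) := by
  have hx0 : 0 < x := by linarith
  have hx1 : 1 ≤ x := by linarith
  have c0 : (10 : ℝ) ≤ x ^ 101 := by
    have : x ^ 1 ≤ x ^ 101 := pow_le_pow_right₀ (by linarith) (by norm_num)
    linarith
  have c1 : 100 * x ^ 101 ≤ x ^ 199 := by
    have e : x ^ 199 = x ^ 101 * x ^ 98 := by ring
    have h2 : x ^ 1 ≤ x ^ 98 := pow_le_pow_right₀ hx1 (by norm_num)
    have := mul_le_mul_of_nonneg_left (show (100 : ℝ) ≤ x ^ 98 by linarith) (pow_pos hx0 101).le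
    linarith
  have hDn := degree_le_of_excess hx hn hd v
  have hn0 : 0 < (n : ℝ) := by linarith
  set r := avgExcess d (S.erase v) - avgExcess d (Sᶜ.erase v) with hr
  have hr2 : |r| ≤ 2 * x ^ 101 := by
    have h1 := abs_avgExcess_le (by positivity) hd (S.erase v)
    have h2 := abs_avgExcess_le (by positivity) hd (Sᶜ.erase v)
    refine (abs_sub _ _).trans ?_
    linarith
  set ρ := r * (S.card * ((n : ℝ) - S.card)) / n ^ 2 with hρ
  have hρ2 : |ρ| ≤ 2 * x ^ 101 := by
    have hz : 0 ≤ (S.card : ℝ) * (n - S.card) := mul_nonneg (by linarith) (by linarith)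
    rw [hρ, abs_div, abs_mul, abs_of_pos (show 0 < (n : ℝ) ^ 2 by positivity), abs_of_nonneg hz,
      div_le_iff₀ (by positivity)]
    exact mul_le_mul hr2 (by nlinarith) hz (by positivity)
  rw [abs_le] at hρ2
  obtain ⟨a, ha⟩ : ∃ a : ℕ, |(a : ℝ) - S.card - ρ| ≤ 1 := by
    refine ⟨⌊(S.card : ℝ) + ρ⌋₊, ?_⟩
    have h1 := Nat.floor_le (show 0 ≤ (S.card : ℝ) + ρ by linarith)
    have h2 := Nat.lt_floor_add_one ((S.card : ℝ) + ρ)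
    rw [abs_le]
    constructor <;> linarith
  have ha2 := abs_le.1 ha
  have han : a + 1 ≤ n := by
    have : (a : ℝ) + 1 ≤ n := by linarith
    exact_mod_cast this
  obtain ⟨b, hb⟩ : ∃ b, a + b = n - 1 := ⟨n - 1 - a, by omega⟩
  have hnc : ((n - 1 : ℕ) : ℝ) = (n : ℝ) - 1 := by rw [Nat.cast_sub (by omega)]; simp
  have hbc : (a : ℝ) + b = (n : ℝ) - 1 := by rw [← hnc, ← hb]; push_cast; ring
  have hSn : S.card + 1 ≤ n := by
    have : (S.card : ℝ) + 1 ≤ n := by linarith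
    exact_mod_cast this
  have hh1 : ((n - S.card - 1 : ℕ) : ℝ) = (n : ℝ) - S.card - 1 := by
    rw [Nat.sub_sub, Nat.cast_sub hSn]; push_cast; ring
  have hchoose := fun (j : ℕ) (hj : j ≤ d v) (hj' : |(j : ℝ) - S.card / 2| ≤ x ^ 120) =>
    log_choose_mul_bd (t := j) (s := d v - j) (δ := degExcess d v) hx hn hS hS' hh1 hbc
      (by rw [Nat.cast_sub hj, degExcess]; ring) (hd v) hj' hr2 ha
  have hDab : d v ≤ a + b := by omega
  have hden : 0 < ((a + b).choose (d v) : ℝ) := by exact_mod_cast Nat.choose_pos hDab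
  have hcmp := window_compare (degProb_isNearBalanced hx hn hlog heven hd S v hS hS')
    (hypergeom_isNearBalanced hx0.le hDab) hx hn (hd v) hr2 hS hS'
    (card_erase_add_card_erase_compl S v) hbc (card_erase_bd S v) ha
    (fun j hj hj' => by
      obtain ⟨p1, p2, -⟩ := hchoose j hj hj'
      unfold hypergeom
      positivity)
    (degProb_nonneg d S v) (hypergeom_nonneg a b (d v))
    (sum_degProb (degSeqGraphs_nonempty hx hn hlog heven hd) S v) (sum_hypergeom hDab) ht htu
  obtain ⟨p1, p2, p3, p4, hL⟩ := hchoose t ht htu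
  have hΛ := lam_bd hx hn hd S v hS hS' htu hr
  set Λ := Lam1 n d v - Lam2 n d v S t - Lam3 n d v + Lam4 n d v S with hΛd
  set L := Real.log (a.choose t) + Real.log (b.choose (d v - t)) -
      (Real.log (S.card.choose t) + Real.log ((n - S.card - 1).choose (d v - t))) with hLd
  set base := (S.card.choose t : ℝ) * ((n - S.card - 1).choose (d v - t) : ℝ) /
        ((n - 1).choose (d v) : ℝ) with hbase
  have p1' : (0 : ℝ) < a.choose t := by exact_mod_cast p1
  have p2' : (0 : ℝ) < b.choose (d v - t) := by exact_mod_cast p2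
  have p3' : (0 : ℝ) < S.card.choose t := by exact_mod_cast p3
  have p4' : (0 : ℝ) < (n - S.card - 1).choose (d v - t) := by exact_mod_cast p4
  rw [hb] at hden
  have hbase0 : 0 < base := by rw [hbase]; positivity
  have hω : |L - Λ| ≤ (x ^ 30)⁻¹ := by
    have := (hL.sub hx hΛ (k := -(30 : ℕ)) (by norm_num) (by norm_num)).le_inv
    convert this using 2
    ring
  have hq : hypergeom a b (d v) t = base * Real.exp Λ * Real.exp (L - Λ) := by
    rw [mul_assoc, ← Real.exp_add, add_sub_cancel, hLd, Real.exp_sub, Real.exp_add, Real.exp_add,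
      Real.exp_log p1', Real.exp_log p2', Real.exp_log p3', Real.exp_log p4', hbase, hypergeom, hb]
    field_simp
  have hy : (x ^ 30)⁻¹ ≤ 1 / 10 := by
    rw [inv_le_comm₀ (by positivity) (by norm_num)]
    have : x ^ 1 ≤ x ^ 30 := pow_le_pow_right₀ hx1 (by norm_num)
    linarith
  have hBpos : 0 < base * Real.exp Λ := mul_pos hbase0 (Real.exp_pos _)
  have hfin := abs_div_sub_one_le hBpos hq hcmp hω hy
  refine ⟨degProb n d S v t / (base * Real.exp Λ) - 1, hfin.trans ?_, ?_⟩
  · rw [← div_eq_mul_inv, div_le_iff₀ (by positivity), ← div_eq_inv_mul, le_div_iff₀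
      (by positivity)]
    have e : x ^ 30 = x ^ 10 * x ^ 20 := by ring
    have h2 : x ^ 1 ≤ x ^ 10 := pow_le_pow_right₀ hx1 (by norm_num)
    have := mul_le_mul_of_nonneg_right (show (10 : ℝ) ≤ x ^ 10 by linarith) (pow_pos hx0 20).le
    linarith
  · field_simp
    ring

lemma eventually_root_large : ∃ n₀ : ℕ, ∀ n : ℕ, n₀ ≤ n →
    10000 ≤ (n : ℝ) ^ ((1 : ℝ) / 200) ∧ Real.log n ≤ (n : ℝ) ^ ((1 : ℝ) / 200) ∧
      1 ≤ Real.log n := by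
  have h1 : ∀ᶠ y : ℝ in Filter.atTop, 10000 ≤ y ^ ((1 : ℝ) / 200) :=
    (tendsto_rpow_atTop (by norm_num)).eventually_ge_atTop _
  have h2 : ∀ᶠ y : ℝ in Filter.atTop, Real.log y ≤ y ^ ((1 : ℝ) / 200) := by
    have := (isLittleO_log_rpow_atTop (r := (1 : ℝ) / 200) (by norm_num)).bound (c := 1) one_pos
    filter_upwards [this, Filter.eventually_ge_atTop 0] with y hy hy0
    rw [one_mul, Real.norm_eq_abs, Real.norm_of_nonneg (Real.rpow_nonneg hy0 _)] at hy
    exact (le_abs_self _).trans hy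
  have h3 : ∀ᶠ y : ℝ in Filter.atTop, 1 ≤ Real.log y :=
    Real.tendsto_log_atTop.eventually_ge_atTop _
  have h := tendsto_natCast_atTop_atTop (R := ℝ) |>.eventually (h1.and (h2.and h3))
  exact Filter.eventually_atTop.1 h

/-- point probabilities for degrees into a fixed set, in a uniformly random
graph with given near-regular degree sequence. -/
theorem statement16 :
    ∃ C : ℝ, 0 < C ∧ ∃ n₀ : ℕ, ∀ n : ℕ, n₀ ≤ n → ∀ d : Fin n → ℕ,
      Even (∑ w, d w) →
      (∀ w, |beta n d w| ≤ Real.log n) →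
      (∑ w, (beta n d w) ^ 2 ≤ (n : ℝ) * (Real.log n) ^ ((1 : ℝ) / 9)) →
      (∃ G : SimpleGraph (Fin n), ∀ w, degIn G Finset.univ w = d w) ∧
      ∀ (v : Fin n) (S : Finset (Fin n)),
        (n : ℝ) / (Real.log n) ^ ((1 : ℝ) / 8) ≤ min (S.card : ℝ) ((n : ℝ) - (S.card : ℝ)) →
        ∀ t : ℕ, t ≤ d v →
        ((|(t : ℝ) - (S.card : ℝ) / 2| > (n : ℝ) ^ ((3 : ℝ) / 5) →
            degProb n d S v t ≤
              Real.exp (-((t : ℝ) - (S.card : ℝ) / 2) ^ 2 / (C * (n : ℝ)))) ∧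
          (|(t : ℝ) - (S.card : ℝ) / 2| ≤ (n : ℝ) ^ ((3 : ℝ) / 5) →
            ∃ θ : ℝ, |θ| ≤ C * (n : ℝ) ^ (-(1 : ℝ) / 10) ∧
              degProb n d S v t =
                (1 + θ) *
                  ((S.card.choose t : ℝ) * ((n - S.card - 1).choose (d v - t) : ℝ) /
                    ((n - 1).choose (d v) : ℝ)) *
                  Real.exp (Lam1 n d v - Lam2 n d v S t - Lam3 n d v + Lam4 n d v S))) := by
  obtain ⟨n₀, hn₀⟩ := eventually_root_large
  refine ⟨40, by norm_num, n₀, fun n hn d heven hβ _ => ?_⟩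
  obtain ⟨hx, hlog, hlog1⟩ := hn₀ n hn
  have hn0 : (0 : ℝ) ≤ n := Nat.cast_nonneg n
  have hpow : ∀ k : ℕ, ((n : ℝ) ^ ((1 : ℝ) / 200)) ^ k = (n : ℝ) ^ ((k : ℝ) / 200) := by
    intro k
    rw [← Real.rpow_natCast, ← Real.rpow_mul hn0]
    congr 1
    ring
  have e200 := hpow 200
  have e120 := hpow 120
  have e20 := hpow 20
  norm_num only [Nat.cast_ofNat, Real.rpow_one] at e200 e120 e20
  norm_num only at hx hlog
  generalize (n : ℝ) ^ ((1 : ℝ) / 200) = x at *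
  have hx0 : 0 < x := by linarith
  have hnx : (n : ℝ) = x ^ 200 := e200.symm
  have hd : ∀ w, |degExcess d w| ≤ x ^ 101 := by
    intro w
    have hn1 : (1 : ℝ) < n := by
      rw [hnx]
      exact one_lt_pow₀ (by linarith) (by norm_num)
    have hs : 0 < Real.sqrt ((n : ℝ) - 1) := Real.sqrt_pos.2 (by linarith)
    have hs' : Real.sqrt ((n : ℝ) - 1) ≤ x ^ 100 := by
      rw [Real.sqrt_le_left (by positivity), ← pow_mul, ← hnx]
      linarith
    have h := (hβ w).trans hlog
    rw [beta_eq, abs_div, abs_of_pos hs, div_le_iff₀ hs] at h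
    calc |degExcess d w| ≤ x * Real.sqrt ((n : ℝ) - 1) := h
      _ ≤ x * x ^ 100 := by gcongr
      _ = x ^ 101 := by ring
  refine ⟨?_, fun v S hS t ht => ?_⟩
  · obtain ⟨G, hG⟩ := degSeqGraphs_nonempty hx hnx hlog heven hd
    exact ⟨G, (mem_filter.1 hG).2⟩
  have hr : Real.log n ^ ((1 : ℝ) / 8) ≤ x :=
    (Real.rpow_le_self_of_one_le hlog1 (by norm_num)).trans hlog
  have hr0 : 0 < Real.log n ^ ((1 : ℝ) / 8) := Real.rpow_pos_of_pos (by linarith) _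
  have hq : x ^ 199 ≤ (n : ℝ) / Real.log n ^ ((1 : ℝ) / 8) := by
    rw [le_div_iff₀ hr0]
    calc x ^ 199 * Real.log n ^ ((1 : ℝ) / 8) ≤ x ^ 199 * x := by gcongr
      _ = (n : ℝ) := by rw [hnx]; ring
  obtain ⟨hS1, hS2⟩ := le_min_iff.1 (hq.trans hS)
  rw [← e120]
  refine ⟨fun h => degProb_tail_le hx hnx hlog heven hd S v hS1 hS2 ht h, fun h => ?_⟩
  obtain ⟨θ, hθ, hP⟩ := degProb_window hx hnx hlog heven hd S v hS1 hS2 ht h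
  refine ⟨θ, hθ.trans ?_, hP⟩
  rw [neg_div, Real.rpow_neg hn0, ← e20]
  have : 0 < (x ^ 20)⁻¹ := by positivity
  linarith
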